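/- arXiv:2210.06279 — 2 statements merged into one kernel-verified Lean document; each statement's English description precedes it below -/
import Mathlib

section
/- Let C be a diamond category and let (M_G)_G be real numbers indexed by isomorphism classes of C that are well-behaved (i.e. well-behaved at every level). (Existence:) There exists a measure ν on the set P of pro-isomorphism classes of C (with the σ-algebra generated by the sets U_{𝒞,F}) whose G-moment ∫_P |Sur(X,G)| dν(X) equals M_G for every object G, if and only if v_{𝒞,F} ≥ 0 for every level 𝒞 and every F ∈ 𝒞. (Uniqueness:) When such a measure ν exists, it is unique, and ν(U_{𝒞,F}) = v_{𝒞,F} for every level 𝒞 and F ∈ 𝒞. -/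
open CategoryTheory Opposite Filter Topology MeasureTheory
open scoped ENNReal Classical

universe u

namespace MomentCat

variable {C : Type u} [SmallCategory C]

/-- The poset of isomorphism classes of quotient objects of `G`,
realized as subobjects of `op G` in `Cᵒᵖ`.  The order is: `a ≤ b` iff `a` is a
further quotient of `b`, so that `⊤` is the class of the identity `G → G`. -/
abbrev Quotients (G : C) := Subobject (op G)

/-- The join of two quotient classes (the least upper bound, when it exists). -/
noncomputable def qSup {G : C} (a b : Quotients G) : Quotients G :=
  if h : ∃ c, IsLUB {a, b} c then h.choose else a

/-- The meet of two quotient classes (the greatest lower bound, when it exists). -/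
noncomputable def qInf {G : C} (a b : Quotients G) : Quotients G :=
  if h : ∃ c, IsGLB {a, b} c then h.choose else a

/-- The join of a set of quotient classes (when it exists). -/
noncomputable def qsSup {G : C} (s : Set (Quotients G)) : Quotients G :=
  if h : ∃ c, IsLUB s c then h.choose else ⊤

/-- The quotient class determined by an epimorphism `π : G ⟶ F`. -/
noncomputable def quotOf {G F : C} (π : G ⟶ F) (h : Epi π) : Quotients G :=
  haveI := h
  Subobject.mk π.op

/-- The underlying object of a quotient class. -/
noncomputable def qObj {G : C} (a : Quotients G) : C :=
  unop (Subobject.underlying.obj a)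

/-- An object is minimal if its only quotient is itself. -/
def IsMinimalObj (G : C) : Prop := Subsingleton (Quotients G)

/-- An epimorphism is simple if it is not an isomorphism and the interval
`[F, G]` contains only the two endpoints. -/
def IsSimpleEpi {G F : C} (π : G ⟶ F) : Prop :=
  ∃ h : Epi π, ¬IsIso π ∧ ∀ X : Quotients G, quotOf π h ≤ X → X = quotOf π h ∨ X = ⊤

/-- The interval `[a, ⊤]` is a complemented lattice. -/
def IntervalComplTop {G : C} (a : Quotients G) : Prop :=
  ∀ X : Quotients G, a ≤ X → ∃ Y : Quotients G, a ≤ Y ∧ qSup X Y = ⊤ ∧ qInf X Y = a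

/-- The interval `[a, b]` is a complemented lattice. -/
def IntervalCompl {G : C} (a b : Quotients G) : Prop :=
  ∀ X : Quotients G, a ≤ X → X ≤ b →
    ∃ Y : Quotients G, a ≤ Y ∧ Y ≤ b ∧ qSup X Y = b ∧ qInf X Y = a

/-- An epimorphism `π : G ⟶ F` is semisimple if the interval `[F,G]` is complemented. -/
def IsSemisimpleEpi {G F : C} (π : G ⟶ F) : Prop :=
  ∃ h : Epi π, IntervalComplTop (quotOf π h)

/-- A set of objects (stable under isomorphism) closed under quotients. -/
def DownwardClosed (S : Set C) : Prop :=
  ∀ G ∈ S, ∀ (F : C) (π : G ⟶ F), Epi π → F ∈ S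

/-- A set of objects closed under joins of quotients of a common object. -/
def JoinClosed (S : Set C) : Prop :=
  ∀ (G : C) (a b : Quotients G), qObj a ∈ S → qObj b ∈ S →
    (∃ c, IsLUB {a, b} c) → qObj (qSup a b) ∈ S

/-- A set of objects containing all minimal objects. -/
def MinClosed (S : Set C) : Prop := ∀ G : C, IsMinimalObj G → G ∈ S

/-- A formation: downward-closed, join-closed, containing all minimal objects. -/
def IsFormation (S : Set C) : Prop := DownwardClosed S ∧ JoinClosed S ∧ MinClosed S

/-- The smallest downward-closed join-closed set containing `B` and all minimal objects. -/
def levelGen (B : Set C) : Set C := ⋂₀ {S : Set C | IsFormation S ∧ B ⊆ S}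

/-- A level is a formation generated by a finite set of objects. -/
def IsLevel (S : Set C) : Prop := ∃ B : Set C, B.Finite ∧ S = levelGen B

/-- The type of isomorphism classes of objects of `C`. -/
abbrev IsoCls (C : Type u) [SmallCategory C] := Quotient (CategoryTheory.isIsomorphicSetoid C)

/-- The isomorphism class of an object. -/
def cls (G : C) : IsoCls C := Quotient.mk (CategoryTheory.isIsomorphicSetoid C) G

/-- The set of epimorphisms from `G` to `F`. -/
abbrev Epis (G F : C) := {π : G ⟶ F // Epi π}

/-- There is a chain of covers of length `d` from `a` to `b` (i.e. the morphism
`qObj b → qObj a` has dimension `d`). -/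
def CovChain {G : C} (a b : Quotients G) (d : ℕ) : Prop :=
  ∃ c : Fin (d + 1) → Quotients G, c 0 = a ∧ c (Fin.last d) = b ∧
    ∀ i : Fin d, c i.castSucc ⋖ c i.succ

/-- An epimorphism has dimension `d`. -/
def EpiDim {G F : C} (π : G ⟶ F) (h : Epi π) (d : ℕ) : Prop :=
  CovChain (quotOf π h) ⊤ d

/-- A set of isomorphism classes is narrow if each of its members receives simple
epimorphisms from only finitely many of its members (up to isomorphism). -/
def Narrow (S : Set C) : Prop :=
  ∀ G ∈ S, {X : IsoCls C | X.out ∈ S ∧ ∃ π : X.out ⟶ G, IsSimpleEpi π}.Finite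

/-- The minimal quotient: the bottom of the quotient poset, when it exists. -/
noncomputable def qBot (G : C) : Quotients G :=
  if h : ∃ b : Quotients G, ∀ x, b ≤ x then h.choose else ⊤

/-- `G` has complexity at most `k`: the map to the minimal quotient is a
composition of `k` semisimple epimorphisms. -/
def complexityLE (G : C) (k : ℕ) : Prop :=
  ∃ c : Fin (k + 1) → Quotients G, c 0 = qBot G ∧ c (Fin.last k) = ⊤ ∧
    ∀ i : Fin k, c i.castSucc ≤ c i.succ ∧ IntervalCompl (c i.castSucc) (c i.succ)

/-- A diamond category. -/
structure IsDiamond (C : Type u) [SmallCategory C] : Prop where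
  /-- quotient posets are finite … -/
  quotFinite : ∀ G : C, Finite (Quotients G)
  /-- … and are lattices: all pairwise joins exist … -/
  lub : ∀ (G : C) (a b : Quotients G), ∃ c, IsLUB {a, b} c
  /-- … and all pairwise meets exist … -/
  glb : ∀ (G : C) (a b : Quotients G), ∃ c, IsGLB {a, b} c
  /-- … and are modular. -/
  modular : ∀ (G : C) (a b x : Quotients G), a ≤ b →
    qSup a (qInf x b) = qInf (qSup a x) b
  /-- automorphism groups are finite -/
  autFinite : ∀ G : C, Finite (Aut G)
  /-- levels are narrow -/
  levelNarrow : ∀ S : Set C, IsLevel S → Narrow S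
  /-- countably many isomorphism classes of minimal objects -/
  minCountable : Set.Countable {X : IsoCls C | IsMinimalObj X.out}

/-- A family assigning to each object the Möbius function of its quotient poset:
`mob G x x = 1` and for `x < y`, `∑_{x ≤ z ≤ y} mob G x z = 0`. -/
def IsMobiusFamily (mob : ∀ G : C, Quotients G → Quotients G → ℝ) : Prop :=
  ∀ G : C, (∀ x : Quotients G, mob G x x = 1) ∧
    ∀ x y : Quotients G, x < y → ∑ᶠ z ∈ Set.Icc x y, mob G x z = 0

/-- `μ(π) = μ(F, G)` for an epimorphism `π : G ⟶ F`. -/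
noncomputable def muEpi (mob : ∀ G : C, Quotients G → Quotients G → ℝ)
    {G F : C} (π : G ⟶ F) (h : Epi π) : ℝ :=
  mob G (quotOf π h) ⊤

/-- `μ̂(F,G) = ∑_{π ∈ Epi(G,F)/Aut(F)} μ(π) = (∑_{π ∈ Epi(G,F)} μ(π))/|Aut F|`
(the `Aut F`-action on epimorphisms being free). -/
noncomputable def muHat (mob : ∀ G : C, Quotients G → Quotients G → ℝ) (F G : C) : ℝ :=
  (∑' π : Epis G F, muEpi mob π.1 π.2) / (Nat.card (Aut F) : ℝ)

/-- `S_{G,F} = |Epi(G,F)|/|Aut F|`. -/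
noncomputable def SQ (G F : C) : ℝ :=
  (Nat.card (Epis G F) : ℝ) / (Nat.card (Aut F) : ℝ)

/-- `T_{G,F} = μ̂(F,G)`. -/
noncomputable def TQ (mob : ∀ G : C, Quotients G → Quotients G → ℝ) (G F : C) : ℝ :=
  muHat mob F G

/-- `Z(π)`: the number of `H ∈ [F,G]` satisfying the distributive law. -/
noncomputable def Zfn {G F : C} (π : G ⟶ F) (h : Epi π) : ℕ :=
  Nat.card {H : Quotients G // quotOf π h ≤ H ∧ ∀ K₁ K₂ : Quotients G,
    quotOf π h ≤ K₁ → quotOf π h ≤ K₂ →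
      qSup H (qInf K₁ K₂) = qInf (qSup H K₁) (qSup H K₂)}

/-- The isomorphism classes lying in `W`. -/
abbrev WSub (W : Set C) := {X : IsoCls C // X.out ∈ W}

/-- `(M_G)` is well-behaved at `W`:
`∑_{G ∈ W} ∑_{π ∈ Epi(G,F)} (|μ(F,G)|/|Aut G|) Z(π)³ |M_G| < ∞` for every `F ∈ W`. -/
def WellBehavedAt (mob : ∀ G : C, Quotients G → Quotients G → ℝ) (M : IsoCls C → ℝ)
    (W : Set C) : Prop :=
  ∀ F : C, F ∈ W → Summable (fun q : Σ X : WSub W, Epis X.1.out F =>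
    |mob q.1.1.out (quotOf q.2.1 q.2.2) ⊤| / (Nat.card (Aut q.1.1.out) : ℝ)
      * ((Zfn q.2.1 q.2.2 : ℝ)) ^ 3 * |M q.1.1|)

/-- The `W`-quotient `G^W`: the join of all quotients of `G` lying in `W`. -/
noncomputable def wQuot (W : Set C) (G : C) : Quotients G :=
  qsSup {a : Quotients G | qObj a ∈ W}

/-- An epimorphism `φ : G ⟶ E` is relative-`W` if `G → G^W ∨ E` is an isomorphism. -/
def RelativeW (W : Set C) {G E : C} (φ : G ⟶ E) (h : Epi φ) : Prop :=
  qSup (wQuot W G) (quotOf φ h) = ⊤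

/-- `v_{W,F} = ∑_{G ∈ W} μ̂(F,G) M_G / |Aut G|`. -/
noncomputable def vWF (mob : ∀ G : C, Quotients G → Quotients G → ℝ) (M : IsoCls C → ℝ)
    (W : Set C) (F : C) : ℝ :=
  ∑' X : WSub W, muHat mob F X.1.out * M X.1 / (Nat.card (Aut X.1.out) : ℝ)

theorem epiComp {G F E : C} {π : G ⟶ F} {ρ : F ⟶ E} (h1 : Epi π) (h2 : Epi ρ) :
    Epi (π ≫ ρ) := by
  haveI := h1; haveI := h2; infer_instance

/-- The radical of an epimorphism with class `a`: the join of all minimal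
elements of `[a, ⊤]` distinct from `a` (together with `a` itself). -/
noncomputable def radicalEl {G : C} (a : Quotients G) : Quotients G :=
  qsSup (insert a {X : Quotients G | a ⋖ X})

end MomentCat

namespace MomentCat

variable (C : Type u) [SmallCategory C]

/-- A pro-isomorphism class: for each level `𝒞` an isomorphism class
`X^𝒞 ∈ 𝒞`, compatibly: `(X^{𝒞'})^𝒞 ≅ X^𝒞` whenever `𝒞 ⊆ 𝒞'`. -/
structure ProIso : Type u where
  comp : ∀ (S : Set C), IsLevel S → IsoCls C
  mem : ∀ (S : Set C) (hS : IsLevel S), (comp S hS).out ∈ S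
  compat : ∀ (S S' : Set C) (hS : IsLevel S) (hS' : IsLevel S'), S ⊆ S' →
    Nonempty (qObj (wQuot S (comp S' hS').out) ≅ (comp S hS).out)

variable {C}

/-- `U_{𝒞,F} = {X ∈ 𝒫 | X^𝒞 ≅ F}`. -/
def USet (S : Set C) (hS : IsLevel S) (F : C) : Set (ProIso C) :=
  {X | Nonempty ((X.comp S hS).out ≅ F)}

/-- The σ-algebra on `𝒫` generated by the `U_{𝒞,F}` for levels `𝒞` and `F ∈ 𝒞`. -/
instance : MeasurableSpace (ProIso C) :=
  MeasurableSpace.generateFrom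
    {U | ∃ (S : Set C) (hS : IsLevel S) (F : C), F ∈ S ∧ U = USet S hS F}

/-- `|Sur(X, G)| = |Epi(X^𝒞, G)|` for any level `𝒞` containing `G`; we use the
level generated by `G`. -/
noncomputable def surCount (X : ProIso C) (G : C) : ℕ :=
  Nat.card (Epis (X.comp (levelGen {G}) ⟨{G}, Set.finite_singleton G, rfl⟩).out G)

/-- The `G`-moment of `ν` is the (finite) value `∫ |Sur(X,G)| dν(X)`, equal to `m`. -/
def HasMoment (ν : MeasureTheory.Measure (ProIso C)) (G : C) (m : ℝ) : Prop :=
  (∫⁻ X, (surCount X G : ℝ≥0∞) ∂ν) ≠ ⊤ ∧ (∫⁻ X, (surCount X G : ℝ≥0∞) ∂ν).toReal = m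

end MomentCat

namespace MomentAux

section LatticePart
open Finset

variable {D : Type*} [Lattice D] [BoundedOrder D] [Fintype D] [IsModularLattice D]

/-- Atoms below `x` but not below `h`. -/
noncomputable def Off (x h : D) : Finset D :=
  univ.filter (fun p => IsAtom p ∧ p ≤ x ∧ ¬ p ≤ h)

theorem mem_Off {x h p : D} : p ∈ Off x h ↔ IsAtom p ∧ p ≤ x ∧ ¬ p ≤ h := by
  simp [Off]

theorem atom_covBy {p k : D} (hp : IsAtom p) (h : ¬ p ≤ k) : k ⋖ p ⊔ k := by
  apply covBy_sup_of_inf_covBy_left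
  have : p ⊓ k = ⊥ := (hp.le_iff.1 inf_le_left).resolve_right (fun e => h (e ▸ inf_le_right))
  rw [this]; exact hp.bot_covBy

theorem atom_inf {p k : D} (hp : IsAtom p) (h : ¬ p ≤ k) : p ⊓ k = ⊥ :=
  (hp.le_iff.1 inf_le_left).resolve_right (fun e => h (e ▸ inf_le_right))

theorem inf_covBy_of {x h z : D} (hx : h ⋖ x) (hz : z ≤ x) (hzh : ¬ z ≤ h) : z ⊓ h ⋖ z := by
  apply inf_covBy_of_covBy_sup_right
  have : z ⊔ h = x := (hx.eq_or_eq (c := z ⊔ h) le_sup_right (sup_le hz hx.le)).resolve_left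
    (fun e => hzh (e ▸ le_sup_left))
  rw [this]; exact hx

theorem sum_off (F : D → ℝ) {x h y : D} (hx : h ⋖ x) (hy : y ≤ x) :
    ∑ z ∈ univ.filter (fun z => z ≤ y ∧ ¬ z ≤ h), ((Off z h).card : ℝ) * F (z ⊓ h)
      = ((Off y h).card : ℝ) * ∑ t ∈ univ.filter (fun t => t ≤ y ⊓ h), F t := by
  have h1 : ∀ z : D, ((Off z h).card : ℝ) * F (z ⊓ h) = ∑ p ∈ Off z h, F (z ⊓ h) := by
    intro z; rw [sum_const, nsmul_eq_mul]
  simp_rw [h1]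
  rw [sum_sigma']
  have h2 : ((Off y h).card : ℝ) * ∑ t ∈ univ.filter (fun t => t ≤ y ⊓ h), F t
      = ∑ p ∈ Off y h, ∑ t ∈ univ.filter (fun t => t ≤ y ⊓ h), F t := by
    rw [sum_const, nsmul_eq_mul]
  rw [h2, sum_sigma']
  refine sum_bij' (fun a _ => ⟨a.2, a.1 ⊓ h⟩) (fun b _ => ⟨b.1 ⊔ b.2, b.1⟩) ?_ ?_ ?_ ?_ ?_
  · rintro ⟨z, p⟩ hzp
    simp only [mem_sigma, mem_filter, mem_univ, true_and, mem_Off] at hzp ⊢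
    exact ⟨⟨hzp.2.1, hzp.2.2.1.trans hzp.1.1, hzp.2.2.2⟩, inf_le_inf_right _ hzp.1.1⟩
  · rintro ⟨p, t⟩ hpt
    simp only [mem_sigma, mem_filter, mem_univ, true_and, mem_Off] at hpt ⊢
    refine ⟨⟨sup_le hpt.1.2.1 (hpt.2.trans inf_le_left), fun hh => hpt.1.2.2 (le_sup_left.trans hh)⟩,
      hpt.1.1, le_sup_left, hpt.1.2.2⟩
  · rintro ⟨z, p⟩ hzp
    simp only [mem_sigma, mem_filter, mem_univ, true_and, mem_Off] at hzp
    obtain ⟨⟨hz1, hz2⟩, hp1, hp2, hp3⟩ := hzp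
    have hc := inf_covBy_of hx (hz1.trans hy) hz2
    have : p ⊔ z ⊓ h = z := (hc.eq_or_eq (c := p ⊔ z ⊓ h) le_sup_right
      (sup_le hp2 inf_le_left)).resolve_left
      (fun e => hp3 ((e ▸ le_sup_left : p ≤ z ⊓ h).trans inf_le_right))
    simp [this]
  · rintro ⟨p, t⟩ hpt
    simp only [mem_sigma, mem_filter, mem_univ, true_and, mem_Off] at hpt
    have hth : t ≤ h := hpt.2.trans inf_le_right
    have : (p ⊔ t) ⊓ h = t := by
      rw [sup_comm, sup_inf_assoc_of_le p hth, atom_inf hpt.1.1 hpt.1.2.2, sup_bot_eq]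
    simp [this]
  · intros; rfl

/-- `g` is the function `μ(⊥, ·)`. -/
def IsMu (g : D → ℝ) : Prop :=
  ∀ y, ∑ z ∈ univ.filter (fun z => z ≤ y), g z = if y = ⊥ then 1 else 0

theorem split_sum (F : D → ℝ) (y h : D) :
    ∑ z ∈ univ.filter (fun z => z ≤ y), F z
      = ∑ z ∈ univ.filter (fun z => z ≤ y ⊓ h), F z
        + ∑ z ∈ univ.filter (fun z => z ≤ y ∧ ¬ z ≤ h), F z := by
  rw [← sum_filter_add_sum_filter_not (univ.filter (fun z => z ≤ y)) (fun z => z ≤ h)]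
  simp only [filter_filter, le_inf_iff]

theorem mu_off {g : D → ℝ} (hg : IsMu g) {x h : D} (hx : h ⋖ x) :
    ∀ y, y ≤ x → ¬ y ≤ h → g y = - ((Off y h).card : ℝ) * g (y ⊓ h) := by
  intro y
  induction y using WellFoundedLT.induction with
  | ind y ih =>
  intro hy hyh
  have hyb : y ≠ ⊥ := fun e => hyh (e ▸ bot_le)
  have h0 := hg y
  rw [if_neg hyb, split_sum g y h, hg (y ⊓ h)] at h0
  have h1 := sum_off g hx hy
  rw [hg (y ⊓ h)] at h1
  have hmem : y ∈ univ.filter (fun z => z ≤ y ∧ ¬ z ≤ h) := by simp [hyh]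
  rw [← add_sum_erase _ _ hmem] at h0 h1
  have h2 : ∑ z ∈ (univ.filter (fun z => z ≤ y ∧ ¬ z ≤ h)).erase y, g z
      = - ∑ z ∈ (univ.filter (fun z => z ≤ y ∧ ¬ z ≤ h)).erase y,
        ((Off z h).card : ℝ) * g (z ⊓ h) := by
    rw [← sum_neg_distrib]
    refine sum_congr rfl fun z hz => ?_
    simp only [mem_erase, mem_filter, mem_univ, true_and] at hz
    rw [ih z (lt_of_le_of_ne hz.2.1 hz.1) (hz.2.1.trans hy) hz.2.2]; ring
  rw [h2] at h0
  by_cases hb : y ⊓ h = ⊥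
  · have hat : IsAtom y := by
      rw [← bot_covBy_iff, ← hb]; exact inf_covBy_of hx hy hyh
    have : Off y h = {y} := by
      ext p
      simp only [mem_Off, mem_singleton]
      constructor
      · rintro ⟨hp, hpy, -⟩
        exact (hat.le_iff.1 hpy).resolve_left hp.1
      · rintro rfl; exact ⟨hat, le_rfl, hyh⟩
    rw [if_pos hb] at h0 h1
    rw [this] at h1 ⊢
    simp only [card_singleton, Nat.cast_one] at h1 ⊢
    linarith
  · rw [if_neg hb] at h0 h1
    linarith

/-- Total absolute Möbius mass below `x`. -/
noncomputable def Lam (g : D → ℝ) (x : D) : ℝ := ∑ z ∈ univ.filter (fun z => z ≤ x), |g z|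

theorem Off_self_pos {x h : D} (hx : h ⋖ x) (hat : IsAtomistic D) : 1 ≤ (Off x h).card := by
  have : ¬ x ≤ h := hx.lt.not_ge
  rw [le_iff_atom_le_imp] at this
  push Not at this
  obtain ⟨p, hp, h1, h2⟩ := this
  exact card_pos.2 ⟨p, mem_Off.2 ⟨hp, h1, h2⟩⟩

theorem mu_cov {g : D → ℝ} (hg : IsMu g) {x h : D} (hx : h ⋖ x) :
    |g x| = ((Off x h).card : ℝ) * |g h| := by
  rw [mu_off hg hx x le_rfl hx.lt.not_ge, inf_eq_right.2 hx.le, abs_mul, abs_neg, Nat.abs_cast]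

theorem Lam_cov {g : D → ℝ} (hg : IsMu g) {x h : D} (hx : h ⋖ x) :
    Lam g x = (1 + ((Off x h).card : ℝ)) * Lam g h := by
  have h1 := sum_off (fun t => |g t|) hx le_rfl
  unfold Lam
  rw [split_sum _ x h]
  rw [inf_eq_right.2 hx.le] at h1 ⊢
  rw [add_mul, one_mul, ← h1]
  congr 1
  refine sum_congr rfl fun z hz => ?_
  simp only [mem_filter, mem_univ, true_and] at hz
  rw [mu_off hg hx z hz.1 hz.2, abs_mul, abs_neg, Nat.abs_cast]

theorem mu_bot {g : D → ℝ} (hg : IsMu g) : g ⊥ = 1 := by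
  have := hg ⊥
  simpa [le_bot_iff, sum_filter] using this

theorem Lam_bot {g : D → ℝ} (hg : IsMu g) : Lam g ⊥ = 1 := by
  simp [Lam, le_bot_iff, sum_filter, mu_bot hg]

/-- If every atom below `e ⊔ c` is below `e` or `c`, and `e ⊓ c = ⊥`, then multiplicativity. -/
theorem mult {g : D → ℝ} (hg : IsMu g) (e : D) :
    ∀ c : D, e ⊓ c = ⊥ → (∀ p, IsAtom p → p ≤ e ⊔ c → p ≤ e ∨ p ≤ c) →
      |g (e ⊔ c)| = |g e| * |g c| ∧ Lam g (e ⊔ c) = Lam g e * Lam g c := by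
  intro c
  induction c using WellFoundedLT.induction with
  | ind c ih =>
  intro hec hp
  rcases eq_or_ne c ⊥ with rfl | hc
  · simp [mu_bot hg, Lam_bot hg]
  obtain ⟨c', hc'⟩ : ∃ c', c' ⋖ c := by
    obtain ⟨c', -, h⟩ := exists_le_covBy_of_lt (bot_lt_iff_ne_bot.2 hc)
    exact ⟨c', h⟩
  have hinf : c ⊓ (e ⊔ c') = c' := by
    rw [sup_comm, inf_comm, sup_inf_assoc_of_le e hc'.le, hec, sup_bot_eq]
  have hnle : ¬ c ≤ e ⊔ c' := fun h => hc'.lt.not_ge (by rw [inf_eq_left.2 h] at hinf; exact hinf.le)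
  have hcov : e ⊔ c' ⋖ e ⊔ c := by
    have h1 : c ⊓ (e ⊔ c') ⋖ c := by rw [hinf]; exact hc'
    have := covBy_sup_of_inf_covBy_left h1
    have h2 : c ⊔ (e ⊔ c') = e ⊔ c := by
      rw [sup_left_comm, sup_eq_left.2 hc'.le]
    rwa [h2] at this
  have hoff : Off (e ⊔ c) (e ⊔ c') = Off c c' := by
    ext p
    simp only [mem_Off]
    constructor
    · rintro ⟨h1, h2, h3⟩
      refine ⟨h1, (hp p h1 h2).resolve_left (fun h => h3 (h.trans le_sup_left)),
        fun h => h3 (h.trans le_sup_right)⟩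
    · rintro ⟨h1, h2, h3⟩
      refine ⟨h1, h2.trans le_sup_right, fun h => h3 ?_⟩
      rw [← hinf]; exact le_inf h2 h
  have hbot : e ⊓ c' = ⊥ := le_bot_iff.1 (hec ▸ inf_le_inf_left _ hc'.le)
  obtain ⟨i1, i2⟩ := ih c' hc'.lt hbot (by
    intro p hpa hpl
    rcases hp p hpa (hpl.trans hcov.le) with h | h
    · exact Or.inl h
    · right; rw [← hinf]; exact le_inf h hpl)
  constructor
  · rw [mu_cov hg hcov, mu_cov hg hc', hoff, i1]; ring
  · rw [Lam_cov hg hcov, Lam_cov hg hc', hoff, i2]; ring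

end LatticePart
end MomentAux

namespace MomentAux

section LatticePart2
open Finset

variable {D : Type*} [Lattice D] [BoundedOrder D] [Fintype D] [IsModularLattice D]

theorem half {hat : IsAtomistic D} {p k l : D} (hp : IsAtom p) (h : p ≤ k ⊔ l) (hl : ¬ p ≤ l) :
    ∃ q, IsAtom q ∧ q ≤ k ∧ ¬ q ≤ l ∧ p ≤ q ⊔ l := by
  have h1 : k ⊓ (p ⊔ l) ⊔ l = p ⊔ l := by
    rw [sup_comm, ← sup_inf_assoc_of_le k (le_sup_right : l ≤ p ⊔ l), sup_comm l k]
    exact inf_eq_right.2 (sup_le h le_sup_right)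
  have h2 : ¬ k ⊓ (p ⊔ l) ≤ l := fun h3 => by
    rw [sup_eq_right.2 h3] at h1; exact hl (h1 ▸ le_sup_left)
  rw [le_iff_atom_le_imp] at h2
  push Not at h2
  obtain ⟨q, hq, hq1, hq2⟩ := h2
  refine ⟨q, hq, hq1.trans inf_le_left, hq2, ?_⟩
  have := (atom_covBy hp hl).eq_or_eq (c := q ⊔ l) le_sup_right
    (sup_le (hq1.trans inf_le_right) le_sup_right)
  rcases this with h | h
  · exact absurd (h ▸ le_sup_left) hq2
  · rw [h]; exact le_sup_left

theorem full {hat : IsAtomistic D} {p k l : D} (hp : IsAtom p) (h : p ≤ k ⊔ l)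
    (hk : ¬ p ≤ k) (hl : ¬ p ≤ l) :
    ∃ q r, IsAtom q ∧ IsAtom r ∧ q ≤ k ∧ r ≤ l ∧ p ≤ q ⊔ r := by
  obtain ⟨q, hq, hqk, -, hpq⟩ := half (hat := hat) hp h hl
  obtain ⟨r, hr, hrl, -, hpr⟩ := half (hat := hat) hp (k := l) (l := q) (by rwa [sup_comm])
    (fun e => hk (e.trans hqk))
  exact ⟨q, r, hq, hr, hqk, hrl, by rwa [sup_comm]⟩

theorem exch {p q a : D} (hp : IsAtom p) (hq : IsAtom q) (ha : IsAtom a) (h : a ≤ p ⊔ q)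
    (hne : a ≠ p) : q ≤ p ⊔ a := by
  by_cases hqp : q ≤ p
  · exact hqp.trans le_sup_left
  have hap : ¬ a ≤ p := fun h => hne ((hp.le_iff.1 h).resolve_left ha.1)
  have := (atom_covBy hq hqp).eq_or_eq (c := p ⊔ a) le_sup_left
    (sup_le le_sup_right (by rwa [sup_comm]))
  rcases this with h | h
  · exact absurd (h ▸ le_sup_right) hap
  · rw [h]; exact le_sup_left

theorem atom_le {p q : D} (hp : IsAtom p) (hq : IsAtom q) : p ≤ q ↔ p = q :=
  ⟨fun h => (hq.le_iff.1 h).resolve_left hp.1, fun h => h.le⟩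

/-- Perspectivity: equal, or joined by a line with a third point. -/
def Per (p q : D) : Prop := p = q ∨ ∃ r, IsAtom r ∧ r ≠ p ∧ r ≠ q ∧ r ≤ p ⊔ q

theorem Per.symm {p q : D} (h : Per p q) : Per q p := by
  rcases h with h | ⟨r, h1, h2, h3, h4⟩
  · exact Or.inl h.symm
  · exact Or.inr ⟨r, h1, h3, h2, by rwa [sup_comm]⟩

/-- third point on a line is perspective to both. -/
theorem Per.of_line {p q r : D} (hp : IsAtom p) (hq : IsAtom q) (hr : IsAtom r) (hpq : p ≠ q)
    (h : r ≤ p ⊔ q) (hrp : r ≠ p) (hrq : r ≠ q) : Per r p :=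
  Or.inr ⟨q, hq, Ne.symm hrq, hpq.symm, (exch hp hq hr h hrp).trans (by rw [sup_comm])⟩

theorem Per.trans {hat : IsAtomistic D} {p q r : D} (hp : IsAtom p) (hq : IsAtom q) (hr : IsAtom r)
    (h1 : Per p q) (h2 : Per q r) : Per p r := by
  by_cases hpr : p = r
  · exact Or.inl hpr
  by_cases hpq : p = q
  · subst hpq; exact h2
  by_cases hqr : q = r
  · subst hqr; exact h1
  by_cases hcol : q ≤ p ⊔ r
  · exact Or.inr ⟨q, hq, Ne.symm hpq, hqr, hcol⟩
  obtain ⟨a, ha, hap, haq, hal⟩ := h1.resolve_left hpq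
  obtain ⟨b, hb, hbq, hbr, hbl⟩ := h2.resolve_left hqr
  have hqa : q ≤ p ⊔ a := exch hp hq ha hal hap
  have hbpr : ¬ b ≤ p ⊔ r := fun h => by
    have : q ≤ r ⊔ b := exch hr hq hb (by rwa [sup_comm]) hbr
    exact hcol (this.trans (sup_le le_sup_right h))
  have hbb : b ≤ a ⊔ (p ⊔ r) := by
    refine hbl.trans (sup_le (hqa.trans ?_) ?_)
    · exact sup_le (le_sup_left.trans le_sup_right) le_sup_left
    · exact le_sup_right.trans le_sup_right
  have hrpq : ¬ r ≤ p ⊔ q := fun h => hcol (exch hp hq hr h (Ne.symm hpr))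
  have hpqr : ¬ p ≤ q ⊔ r := fun h => by
    have := exch hq hr hp h hpq
    exact hrpq (this.trans (by rw [sup_comm]))
  have hba : ¬ b ≤ a := fun h => by
    rw [atom_le hb ha] at h
    subst h
    have h3 : p ≤ q ⊔ b := exch hq hp ha (by rwa [sup_comm]) haq
    exact hpqr (h3.trans (sup_le le_sup_left hbl))
  obtain ⟨a', t, ha', ht, haa, htl, hbt⟩ := full (hat := hat) hb hbb hba hbpr
  rw [atom_le ha' ha] at haa
  subst haa
  refine Or.inr ⟨t, ht, ?_, ?_, htl⟩
  · rintro rfl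
    have h3 : b ≤ t ⊔ q := hbt.trans (sup_le hal le_sup_left)
    have h4 : r ≤ q ⊔ b := exch hq hr hb hbl hbq
    exact hrpq (h4.trans (sup_le le_sup_right h3))
  · rintro rfl
    have h3 : a' ≤ t ⊔ b := exch ht ha' hb (by rwa [sup_comm]) hbr
    have h4 : p ≤ q ⊔ a' := exch hq hp ha (by rwa [sup_comm]) haq
    exact hpqr (h4.trans (sup_le le_sup_left (h3.trans (sup_le le_sup_right hbl))))

theorem subspace {hat : IsAtomistic D} (T : D → Prop)
    (hT : ∀ q1 q2 r, IsAtom q1 → IsAtom q2 → IsAtom r → T q1 → T q2 → q1 ≠ q2 → r ≤ q1 ⊔ q2 →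
      r ≠ q1 → r ≠ q2 → T r)
    (s : Finset D) (hs : ∀ q ∈ s, IsAtom q ∧ T q) :
    ∀ r, IsAtom r → r ≤ s.sup id → T r := by
  induction s using Finset.induction_on with
  | empty => intro r hr h; simp at h; exact absurd h hr.1
  | insert t s hts ih =>
    have ih' := ih (fun q hq => hs q (mem_insert_of_mem hq))
    have ⟨hta, htT⟩ := hs t (mem_insert_self _ _)
    intro r hr h
    rw [sup_insert, id] at h
    by_cases h1 : r ≤ t
    · rw [atom_le hr hta] at h1; exact h1 ▸ htT
    by_cases h2 : r ≤ s.sup id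
    · exact ih' r hr h2
    obtain ⟨q, r2, hq, hr2, hqt, hrs, hrr⟩ := full (hat := hat) hr h h1 h2
    rw [atom_le hq hta] at hqt
    subst hqt
    by_cases he : q = r2
    · subst he; simp only [sup_idem] at hrr; exact absurd hrr h1
    by_cases h3 : r = r2
    · exact h3 ▸ ih' r2 hr2 hrs
    exact hT q r2 r hq hr2 hr htT (ih' r2 hr2 hrs) he hrr (fun e => h1 e.le) h3

/-- Connected element: any two atoms below it are perspective. -/
def Conn (e : D) : Prop := ∀ p q, IsAtom p → IsAtom q → p ≤ e → q ≤ e → Per p q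

theorem Conn.mono {e f : D} (h : Conn e) (hf : f ≤ e) : Conn f :=
  fun p q hp hq hpf hqf => h p q hp hq (hpf.trans hf) (hqf.trans hf)

/-- doubling of the number of points off a hyperplane. -/
theorem double {hat : IsAtomistic D} {e h h2 : D} (he : Conn e) (h1 : h ⋖ e) (h12 : h2 ⋖ h)
    (N : ℕ) (hN : ∀ k, k ⋖ e → ∀ l, l ⋖ k → N ≤ (Off k l).card) : 2 * N ≤ (Off e h).card := by
  obtain ⟨p, hp⟩ := card_pos.1 (Off_self_pos h1 hat)
  obtain ⟨r, hr⟩ := card_pos.1 (Off_self_pos h12 hat)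
  rw [mem_Off] at hp hr
  obtain ⟨hpa, hpe, hph⟩ := hp
  obtain ⟨hra, hrh, hrh2⟩ := hr
  have hpr : p ≠ r := fun h => hph (h ▸ hrh)
  obtain ⟨p', hp'a, hp'p, hp'r, hp'l⟩ := (he p r hpa hra hpe (hrh.trans h1.le)).resolve_left hpr
  have hp'e : p' ≤ e := hp'l.trans (sup_le hpe (hrh.trans h1.le))
  have hp'h : ¬ p' ≤ h := fun hh => by
    have : p ≤ r ⊔ p' := exch hra hpa hp'a (by rwa [sup_comm]) hp'r
    exact hph (this.trans (sup_le hrh hh))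
  have key : ∀ q, IsAtom q → q ≤ e → ¬ q ≤ h → h2 ⋖ q ⊔ h2 ∧ q ⊔ h2 ⋖ e ∧ h ⊓ (q ⊔ h2) = h2 := by
    intro q hq hqe hqh
    have a1 : h2 ⋖ q ⊔ h2 := atom_covBy hq (fun h => hqh (h.trans h12.le))
    have a3 : h ⊓ (q ⊔ h2) = h2 := by
      rw [sup_comm, inf_comm, sup_inf_assoc_of_le q h12.le, atom_inf hq hqh, sup_bot_eq]
    refine ⟨a1, ?_, a3⟩
    have : h ⊓ (q ⊔ h2) ⋖ h := by rw [a3]; exact h12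
    have h5 := covBy_sup_of_inf_covBy_left this
    have h6 : h ⊔ (q ⊔ h2) = e := by
      refine (h1.eq_or_eq (c := h ⊔ (q ⊔ h2)) le_sup_left
        (sup_le h1.le (sup_le hqe (h12.le.trans h1.le)))).resolve_left ?_
      intro e'
      exact hqh ((le_sup_left.trans le_sup_right).trans e'.le)
    rwa [h6] at h5
  obtain ⟨b1, b2, b3⟩ := key p hpa hpe hph
  obtain ⟨c1, c2, c3⟩ := key p' hp'a hp'e hp'h
  have hdisj : Disjoint (Off (p ⊔ h2) h2) (Off (p' ⊔ h2) h2) := by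
    rw [Finset.disjoint_left]
    intro q hq hq'
    rw [mem_Off] at hq hq'
    have d1 : q ⊔ h2 = p ⊔ h2 := (b1.eq_or_eq (c := q ⊔ h2) le_sup_right
      (sup_le hq.2.1 le_sup_right)).resolve_left (fun e => hq.2.2 (e ▸ le_sup_left))
    have d2 : q ⊔ h2 = p' ⊔ h2 := (c1.eq_or_eq (c := q ⊔ h2) le_sup_right
      (sup_le hq'.2.1 le_sup_right)).resolve_left (fun e => hq.2.2 (e ▸ le_sup_left))
    have d3 : r ≤ p ⊔ h2 := by
      have : r ≤ p ⊔ p' := exch hpa hra hp'a hp'l hp'p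
      refine this.trans (sup_le le_sup_left ?_)
      rw [← d1, d2]; exact le_sup_left
    exact hrh2 (b3 ▸ le_inf hrh d3)
  have hsub : Off (p ⊔ h2) h2 ∪ Off (p' ⊔ h2) h2 ⊆ Off e h := by
    intro q hq
    rw [mem_union, mem_Off, mem_Off] at hq
    rw [mem_Off]
    rcases hq with ⟨d1, d2, d3⟩ | ⟨d1, d2, d3⟩
    · exact ⟨d1, d2.trans b2.le, fun hh => d3 (b3 ▸ le_inf hh d2)⟩
    · exact ⟨d1, d2.trans c2.le, fun hh => d3 (c3 ▸ le_inf hh d2)⟩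
  calc 2 * N = N + N := two_mul N
    _ ≤ (Off (p ⊔ h2) h2).card + (Off (p' ⊔ h2) h2).card :=
        add_le_add (hN _ b2 _ b1) (hN _ c2 _ c1)
    _ = (Off (p ⊔ h2) h2 ∪ Off (p' ⊔ h2) h2).card := (card_union_of_disjoint hdisj).symm
    _ ≤ _ := card_le_card hsub

theorem Lam_nonneg (g : D → ℝ) (x : D) : 0 ≤ Lam g x := sum_nonneg fun _ _ => abs_nonneg _

theorem conn_bound {hat : IsAtomistic D} {g : D → ℝ} (hg : IsMu g) :
    ∀ e : D, e ≠ ⊥ → Conn e → ∃ N : ℕ, 1 ≤ N ∧ (∀ h, h ⋖ e → N ≤ (Off e h).card) ∧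
      ((N : ℝ) * Lam g e ≤ (8 * N - 8) * |g e| ∨ (N = 1 ∧ Lam g e = 2 * |g e|)) := by
  intro e
  induction e using WellFoundedLT.induction with
  | ind e ih =>
  intro heb hec
  by_cases hea : IsAtom e
  · refine ⟨1, le_rfl, fun h hh => Off_self_pos hh hat, Or.inr ⟨rfl, ?_⟩⟩
    have hcov : ⊥ ⋖ e := hea.bot_covBy
    have hcard : (Off e ⊥).card = 1 := by
      rw [card_eq_one]
      refine ⟨e, ?_⟩
      ext p
      simp only [mem_Off, mem_singleton]
      constructor
      · rintro ⟨h1, h2, -⟩; exact (atom_le h1 hea).1 h2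
      · rintro rfl; exact ⟨hea, le_rfl, fun h => heb (le_bot_iff.1 h)⟩
    rw [Lam_cov hg hcov, mu_cov hg hcov, hcard, Lam_bot hg, mu_bot hg]; norm_num
  have hk0 : ∀ k, k ⋖ e → k ≠ ⊥ := by
    rintro k hk rfl; exact hea (bot_covBy_iff.1 hk)
  choose! f hf1 hf2 hf3 using fun k (hk : k ⋖ e) =>
    ih k hk.lt (hk0 k hk) (hec.mono hk.le)
  have hne : (univ.filter (fun k => k ⋖ e)).Nonempty := by
    obtain ⟨k, -, hk⟩ := exists_le_covBy_of_lt (bot_lt_iff_ne_bot.2 heb)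
    exact ⟨k, by simpa using hk⟩
  obtain ⟨k0, hk0m, hmin⟩ := exists_min_image _ f hne
  simp only [mem_filter, mem_univ, true_and] at hk0m hmin
  have hall : ∀ h, h ⋖ e → 2 * f k0 ≤ (Off e h).card := by
    intro h hh
    obtain ⟨h2, -, hh2⟩ := exists_le_covBy_of_lt (bot_lt_iff_ne_bot.2 (hk0 h hh))
    exact double (hat := hat) hec hh hh2 (f k0) (fun k hk l hl => (hmin k hk).trans (hf2 k hk l hl))
  refine ⟨2 * f k0, by have := hf1 k0 hk0m; omega, hall, Or.inl ?_⟩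
  have hm := hall k0 hk0m
  rw [Lam_cov hg hk0m, mu_cov hg hk0m]
  have hm' : (2 : ℝ) * f k0 ≤ ((Off e k0).card : ℝ) := by exact_mod_cast hm
  have hf1' : (1 : ℝ) ≤ f k0 := by exact_mod_cast hf1 k0 hk0m
  set m : ℝ := ((Off e k0).card : ℝ)
  set n : ℝ := (f k0 : ℝ)
  have hg0 := abs_nonneg (g k0)
  push_cast
  rcases hf3 k0 hk0m with h | ⟨hN, hL⟩
  · have h' : n * Lam g k0 ≤ (8 * n - 8) * |g k0| := h
    have e1 : (2 * n) * ((1 + m) * Lam g k0) ≤ 2 * (1 + m) * ((8 * n - 8) * |g k0|) := by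
      nlinarith
    refine e1.trans ?_
    have : 2 * (1 + m) * (8 * n - 8) ≤ (8 * (2 * n) - 8) * m := by nlinarith
    nlinarith
  · have hn : n = 1 := by simp [n, hN]
    rw [hL]
    have e0 : (f k0 : ℝ) = 1 := hn
    rw [e0]
    have e2 : (2 : ℝ) ≤ m := by rw [hn] at hm'; linarith
    nlinarith [mul_nonneg (sub_nonneg.2 e2) hg0]

theorem conn_bound' {hat : IsAtomistic D} {g : D → ℝ} (hg : IsMu g) (e : D) (he : Conn e)
    (heb : e ≠ ⊥) : Lam g e ≤ 8 * |g e| := by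
  obtain ⟨N, hN, -, h⟩ := conn_bound (hat := hat) hg e heb he
  have := abs_nonneg (g e)
  rcases h with h | ⟨-, h⟩
  · have hN' : (1 : ℝ) ≤ N := by exact_mod_cast hN
    have : (N : ℝ) * Lam g e ≤ N * (8 * |g e|) := by nlinarith
    exact le_of_mul_le_mul_left this (by linarith)
  · linarith

/-- `H` is a union of components among atoms below `x`. -/
noncomputable def Zc (x : D) : Finset D :=
  univ.filter (fun H => H ≤ x ∧ ∀ p q, IsAtom p → IsAtom q → p ≤ x → q ≤ H → Per p q → p ≤ H)

theorem mem_Zc {x H : D} : H ∈ Zc x ↔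
    H ≤ x ∧ ∀ p q, IsAtom p → IsAtom q → p ≤ x → q ≤ H → Per p q → p ≤ H := by simp [Zc]

theorem main_bound {hat : IsAtomistic D} {g : D → ℝ} (hg : IsMu g) :
    ∀ x : D, Lam g x ≤ ((Zc x).card : ℝ) ^ 3 * |g x| := by
  intro x
  induction x using WellFoundedLT.induction with
  | ind x ih =>
  by_cases hx : x = ⊥
  · subst hx
    rw [Lam_bot hg, mu_bot hg]
    have : (1 : ℝ) ≤ ((Zc (⊥ : D)).card : ℝ) := by
      exact_mod_cast card_pos.2 ⟨⊥, mem_Zc.2 ⟨le_rfl, fun p q hp hq h1 h2 h3 => h1⟩⟩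
    rw [abs_one, mul_one]
    exact one_le_pow₀ this
  obtain ⟨p, hp, hpx⟩ := (IsAtomic.eq_bot_or_exists_atom_le x).resolve_left hx
  set A := univ.filter (fun q : D => IsAtom q ∧ q ≤ x ∧ Per p q) with hA
  set B := univ.filter (fun q : D => IsAtom q ∧ q ≤ x ∧ ¬ Per p q) with hB
  set e := A.sup id with he
  set c := B.sup id with hc
  have hex : e ≤ x := Finset.sup_le fun q hq => by simp [hA] at hq; exact hq.2.1
  have hcx : c ≤ x := Finset.sup_le fun q hq => by simp [hB] at hq; exact hq.2.1
  have hAe : ∀ r, IsAtom r → r ≤ e → Per p r :=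
    subspace (hat := hat) (fun r => Per p r) (by
      intro q1 q2 r h1 h2 h3 t1 t2 hne hr hr1 hr2
      exact Per.trans (hat := hat) hp h1 h3 t1 (Per.of_line h1 h2 h3 hne hr hr1 hr2).symm) A
      (fun q hq => by simp [hA] at hq; exact ⟨hq.1, hq.2.2⟩)
  have hBc : ∀ r, IsAtom r → r ≤ c → ¬ Per p r :=
    subspace (hat := hat) (fun r => ¬ Per p r) (by
      intro q1 q2 r h1 h2 h3 t1 t2 hne hr hr1 hr2 hcon
      exact t1 (Per.trans (hat := hat) hp h3 h1 hcon (Per.of_line h1 h2 h3 hne hr hr1 hr2))) B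
      (fun q hq => by simp [hB] at hq; exact ⟨hq.1, hq.2.2⟩)
  have hor : ∀ q, IsAtom q → q ≤ x → q ≤ e ∨ q ≤ c := by
    intro q hq hqx
    by_cases h : Per p q
    · exact Or.inl (le_sup (f := id) (by simp [hA, hq, hqx, h] : q ∈ A))
    · exact Or.inr (le_sup (f := id) (by simp [hB, hq, hqx, h] : q ∈ B))
  have hecx : e ⊔ c = x := by
    refine le_antisymm (sup_le hex hcx) ?_
    rw [le_iff_atom_le_imp]
    intro q hq hqx
    rcases hor q hq hqx with h | h
    · exact h.trans le_sup_left
    · exact h.trans le_sup_right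
  have hbot : e ⊓ c = ⊥ := by
    by_contra hne
    obtain ⟨q, hq, hqq⟩ := (IsAtomic.eq_bot_or_exists_atom_le (e ⊓ c)).resolve_left hne
    exact hBc q hq (hqq.trans inf_le_right) (hAe q hq (hqq.trans inf_le_left))
  have hpe : p ≤ e := le_sup (f := id) (mem_filter.2 ⟨mem_univ _, hp, hpx, Or.inl rfl⟩ : p ∈ A)
  have heb : e ≠ ⊥ := fun h => hp.1 (le_bot_iff.1 (h ▸ hpe))
  have hconn : Conn e := fun q r hq hr hqe hre =>
    Per.trans (hat := hat) hq hp hr (hAe q hq hqe).symm (hAe r hr hre)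
  have hclt : c < x := lt_of_le_of_ne hcx (fun h => by
    rw [h] at hbot
    rw [inf_eq_left.2 hex] at hbot; exact heb hbot)
  obtain ⟨m1, m2⟩ := mult hg e c hbot (fun q hq h => hor q hq (hecx ▸ h))
  rw [hecx] at m1 m2
  -- count
  have hHc : ∀ H, H ≤ c → c ⊓ (H ⊔ e) = H := by
    intro H hH
    rw [inf_comm, sup_inf_assoc_of_le e hH, hbot, sup_bot_eq]
  have hsub : Zc c ∪ (Zc c).image (fun H => H ⊔ e) ⊆ Zc x := by
    intro H' hH'
    rw [mem_union, mem_image] at hH'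
    rcases hH' with hH | ⟨H, hH, rfl⟩
    · rw [mem_Zc] at hH ⊢
      refine ⟨hH.1.trans hcx, ?_⟩
      intro q r hq hr hqx hrH hqr
      rcases hor q hq hqx with h | h
      · exact absurd (Per.trans (hat := hat) hp hq hr (hAe q hq h) hqr) (hBc r hr (hrH.trans hH.1))
      · exact hH.2 q r hq hr h hrH hqr
    · rw [mem_Zc] at hH ⊢
      refine ⟨sup_le (hH.1.trans hcx) hex, ?_⟩
      intro q r hq hr hqx hrH hqr
      rcases hor q hq hqx with h | h
      · exact h.trans le_sup_right
      · rcases hor r hr (hrH.trans (sup_le (hH.1.trans hcx) hex)) with h' | h'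
        · exact absurd (Per.trans (hat := hat) hp hr hq (hAe r hr h') hqr.symm) (hBc q hq h)
        · have hrH' : r ≤ H := by
            rw [← hHc H hH.1]; exact le_inf h' hrH
          exact (hH.2 q r hq hr h hrH' hqr).trans le_sup_left
  have hdisj : Disjoint (Zc c) ((Zc c).image (fun H => H ⊔ e)) := by
    rw [Finset.disjoint_left]
    intro H' h1 h2
    rw [mem_image] at h2
    obtain ⟨H, -, rfl⟩ := h2
    have : e ≤ c := le_sup_right.trans (mem_Zc.1 h1).1
    rw [inf_eq_left.2 this] at hbot
    exact heb hbot
  have hinj : ((Zc c).image (fun H => H ⊔ e)).card = (Zc c).card := by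
    apply card_image_of_injOn
    intro H h1 H' h2 heq
    rw [← hHc H (mem_Zc.1 h1).1, ← hHc H' (mem_Zc.1 h2).1]
    exact congrArg (fun t => c ⊓ t) heq
  have hcard : 2 * (Zc c).card ≤ (Zc x).card := by
    calc 2 * (Zc c).card = (Zc c).card + ((Zc c).image (fun H => H ⊔ e)).card := by rw [hinj]; ring
      _ = _ := (card_union_of_disjoint hdisj).symm
      _ ≤ _ := card_le_card hsub
  have hcard' : (2 : ℝ) * (Zc c).card ≤ (Zc x).card := by exact_mod_cast hcard
  have i1 := ih c hclt
  have i2 := conn_bound' (hat := hat) hg e hconn heb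
  rw [m1, m2]
  calc Lam g e * Lam g c ≤ (8 * |g e|) * (((Zc c).card : ℝ) ^ 3 * |g c|) :=
        mul_le_mul i2 i1 (Lam_nonneg _ _) (by positivity)
    _ = (2 * ((Zc c).card : ℝ)) ^ 3 * (|g e| * |g c|) := by ring
    _ ≤ _ := by gcongr

theorem Zc_distrib {hat : IsAtomistic D} {H : D} (hH : H ∈ Zc (⊤ : D)) (k l : D) :
    H ⊓ (k ⊔ l) = (H ⊓ k) ⊔ (H ⊓ l) := by
  rw [mem_Zc] at hH
  refine le_antisymm ?_ le_inf_sup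
  rw [le_iff_atom_le_imp]
  intro p hp h
  have hpH := h.trans inf_le_left
  have hpkl := h.trans inf_le_right
  by_cases hk : p ≤ k
  · exact (le_inf hpH hk).trans le_sup_left
  by_cases hl : p ≤ l
  · exact (le_inf hpH hl).trans le_sup_right
  obtain ⟨q, r, hq, hr, hqk, hrl, hpqr⟩ := full (hat := hat) hp hpkl hk hl
  have h1 : p ≠ q := fun e => hk (e ▸ hqk)
  have h2 : p ≠ r := fun e => hl (e ▸ hrl)
  have hqr : q ≠ r := by
    rintro rfl
    rw [sup_idem, atom_le hp hq] at hpqr; exact h1 hpqr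
  have hqH : q ≤ H := hH.2 q p hq hp le_top hpH (Per.of_line hq hr hp hqr hpqr h1 h2).symm
  have hrH : r ≤ H := hH.2 r p hr hp le_top hpH
    (Per.of_line hr hq hp hqr.symm (by rwa [sup_comm]) h2 h1).symm
  exact hpqr.trans (sup_le_sup (le_inf hqH hqk) (le_inf hrH hrl))

theorem lattice_ineq (hat : IsAtomistic D) {g : D → ℝ} (hg : IsMu g) :
    ∑ z, |g z| ≤ (Nat.card {H : D // ∀ k l : D, H ⊓ (k ⊔ l) = (H ⊓ k) ⊔ (H ⊓ l)} : ℝ) ^ 3 * |g ⊤| := by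
  have h1 := main_bound (hat := hat) hg ⊤
  have h2 : Lam g (⊤ : D) = ∑ z, |g z| := by simp [Lam]
  rw [← h2]
  refine h1.trans ?_
  have h3 : (Zc (⊤ : D)).card ≤
      Nat.card {H : D // ∀ k l : D, H ⊓ (k ⊔ l) = (H ⊓ k) ⊔ (H ⊓ l)} := by
    rw [Nat.card_eq_fintype_card, Fintype.card_subtype]
    refine card_le_card fun H hH => ?_
    simp only [mem_filter, mem_univ, true_and]
    exact Zc_distrib (hat := hat) hH
  have h4 : ((Zc (⊤ : D)).card : ℝ) ≤
      (Nat.card {H : D // ∀ k l : D, H ⊓ (k ⊔ l) = (H ⊓ k) ⊔ (H ⊓ l)} : ℝ) := by exact_mod_cast h3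
  gcongr

end LatticePart2
end MomentAux

namespace MomentAux

section LatticePart3
open Finset

variable {L : Type*} [Lattice L] [BoundedOrder L] [Fintype L]

/-- `[w,t]` is generated by its atoms. -/
def AtSup (w t : L) : Prop := w ≤ t ∧ ∀ y, w ≤ y → (∀ p, w ⋖ p → p ≤ t → p ≤ y) → t ≤ y

/-- `[w,t]` is complemented. -/
def Cpl (w t : L) : Prop :=
  w ≤ t ∧ ∀ x, w ≤ x → x ≤ t → ∃ y, w ≤ y ∧ y ≤ t ∧ x ⊔ y = t ∧ x ⊓ y = w

/-- `w` is a meet of coatoms. -/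
def CoM (w : L) : Prop := ∀ y, (∀ c, w ≤ c → IsCoatom c → y ≤ c) → y ≤ w

theorem Cpl.atSup {w t : L} (h : Cpl w t) : AtSup w t := by
  refine ⟨h.1, fun y hy hp => ?_⟩
  obtain ⟨z, hz1, hz2, hz3, hz4⟩ := h.2 (y ⊓ t) (le_inf hy h.1) inf_le_right
  by_cases hzw : z = w
  · subst hzw
    rw [sup_eq_left.2 (le_inf hy h.1)] at hz3
    exact inf_eq_right.1 hz3
  · obtain ⟨p, hp1, hp2⟩ := exists_covBy_le_of_lt (lt_of_le_of_ne hz1 (Ne.symm hzw))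
    have := hp p hp1 (hp2.trans hz2)
    have h2 : p ≤ w := hz4 ▸ le_inf (le_inf this (hp2.trans hz2)) hp2
    exact absurd h2 hp1.lt.not_ge

variable [IsModularLattice L]

theorem AtSup.cpl {w t : L} (h : AtSup w t) : Cpl w t := by
  refine ⟨h.1, fun x hx hxt => ?_⟩
  have hne : (univ.filter (fun y : L => w ≤ y ∧ y ≤ t ∧ x ⊓ y = w)).Nonempty :=
    ⟨w, by simp [h.1, hx]⟩
  obtain ⟨y, hy⟩ := Finset.exists_maximal hne
  have hym := hy.1
  simp only [mem_filter, mem_univ, true_and] at hym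
  obtain ⟨h1, h2, h3⟩ := hym
  refine ⟨y, h1, h2, ?_, h3⟩
  refine le_antisymm (sup_le hxt h2) (h.2 _ (h1.trans le_sup_right) ?_)
  intro p hp hpt
  by_contra hpn
  have e1 : p ⊓ (x ⊔ y) = w := by
    rcases hp.eq_or_eq (c := p ⊓ (x ⊔ y)) (le_inf hp.le (hx.trans le_sup_left)) inf_le_left with e | e
    · exact e
    · exact absurd (inf_eq_left.1 e) hpn
  have e2 : x ⊓ (y ⊔ p) = w := by
    refine le_antisymm ?_ (le_inf hx (h1.trans le_sup_left))
    rw [← h3]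
    refine le_inf inf_le_left ?_
    calc x ⊓ (y ⊔ p) ≤ (y ⊔ p) ⊓ (x ⊔ y) := le_inf inf_le_right (inf_le_left.trans le_sup_left)
      _ = y ⊔ p ⊓ (x ⊔ y) := sup_inf_assoc_of_le p le_sup_right
      _ = y := by rw [e1, sup_eq_left.2 h1]
  have e3 := hy.2 (y := y ⊔ p) (by simp [h1.trans le_sup_left, h2, hpt, e2]) le_sup_left
  exact hpn ((le_sup_right.trans e3).trans le_sup_right)

theorem Cpl.left {w t a : L} (h : Cpl w t) (h1 : w ≤ a) (h2 : a ≤ t) : Cpl w a := by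
  refine ⟨h1, fun x hx hxa => ?_⟩
  obtain ⟨y, y1, y2, y3, y4⟩ := h.2 x hx (hxa.trans h2)
  refine ⟨y ⊓ a, le_inf y1 h1, inf_le_right, ?_, ?_⟩
  · rw [← sup_inf_assoc_of_le y hxa, y3, inf_eq_right.2 h2]
  · rw [← inf_assoc, y4, inf_eq_left.2 h1]

theorem Cpl.right {w t a : L} (h : Cpl w t) (h1 : w ≤ a) (h2 : a ≤ t) : Cpl a t := by
  refine ⟨h2, fun x hx hxa => ?_⟩
  obtain ⟨y, y1, y2, y3, y4⟩ := h.2 x (h1.trans hx) hxa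
  refine ⟨a ⊔ y, le_sup_left, sup_le h2 y2, ?_, ?_⟩
  · rw [← sup_assoc, sup_eq_left.2 hx, y3]
  · rw [inf_comm, sup_inf_assoc_of_le y hx, inf_comm, y4, sup_eq_left.2 h1]

/-- transposition `[w ⊓ a, a] ≅ [w, w ⊔ a]`. -/
theorem Cpl.inf {w t a : L} (h : Cpl w t) (h2 : a ≤ t) : Cpl (w ⊓ a) a := by
  have h' : Cpl w (w ⊔ a) := h.left le_sup_left (sup_le h.1 h2)
  refine ⟨inf_le_right, fun x hx hxa => ?_⟩
  have hxx : (w ⊔ x) ⊓ a = x := by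
    rw [sup_comm, sup_inf_assoc_of_le w hxa, sup_eq_left.2 hx]
  obtain ⟨y, y1, y2, y3, y4⟩ := h'.2 (w ⊔ x) le_sup_left (sup_le_sup_left hxa w)
  refine ⟨y ⊓ a, inf_le_inf_right _ y1, inf_le_right, ?_, ?_⟩
  · rw [← sup_inf_assoc_of_le y hxa]
    refine inf_eq_right.2 ?_
    have : x ⊔ y = w ⊔ a := by rw [← y3, sup_comm w x, sup_assoc, sup_eq_right.2 y1]
    rw [this]; exact le_sup_right
  · calc x ⊓ (y ⊓ a) = ((w ⊔ x) ⊓ a) ⊓ (y ⊓ a) := by rw [hxx]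
      _ = ((w ⊔ x) ⊓ y) ⊓ a := by
        rw [inf_inf_inf_comm, inf_idem]
      _ = _ := by rw [y4]

/-- a cover of `w` pushed up. -/
theorem cover_push {w p v : L} (hp : w ⋖ p) (hv : w ≤ v) : p ⊔ v = v ∨ v ⋖ p ⊔ v := by
  rcases hp.eq_or_eq (c := p ⊓ v) (le_inf hp.le hv) inf_le_left with e | e
  · right
    apply covBy_sup_of_inf_covBy_left
    rw [e]; exact hp
  · left; exact sup_eq_right.2 (inf_eq_left.1 e)

theorem AtSup.sup {w t w' t' : L} (h : AtSup w t) (h' : AtSup w' t') : AtSup (w ⊔ w') (t ⊔ t') := by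
  refine ⟨sup_le_sup h.1 h'.1, fun y hy hp => ?_⟩
  refine sup_le (h.2 y (le_sup_left.trans hy) fun p hpw hpt => ?_)
    (h'.2 y (le_sup_right.trans hy) fun p hpw hpt => ?_)
  · rcases cover_push hpw (le_sup_left : w ≤ w ⊔ w') with e | e
    · exact (sup_eq_right.1 e).trans hy
    · exact le_sup_left.trans (hp _ e (sup_le (hpt.trans le_sup_left) (sup_le_sup h.1 h'.1)))
  · rcases cover_push hpw (le_sup_right : w' ≤ w ⊔ w') with e | e
    · exact (sup_eq_right.1 e).trans hy
    · exact le_sup_left.trans (hp _ e (sup_le (hpt.trans le_sup_right) (sup_le_sup h.1 h'.1)))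

theorem AtSup.join {w t v b : L} (h : AtSup w t) (hv : w ≤ v) (hvt : v ≤ t) :
    AtSup (v ⊔ b) (t ⊔ b) := by
  refine ⟨sup_le_sup_right hvt _, fun y hy hp => ?_⟩
  refine sup_le (h.2 y ((hv.trans le_sup_left).trans hy) fun p hpw hpt => ?_) (le_sup_right.trans hy)
  rcases cover_push hpw (hv.trans le_sup_left : w ≤ v ⊔ b) with e | e
  · exact (sup_eq_right.1 e).trans hy
  · exact le_sup_left.trans (hp _ e (sup_le (hpt.trans le_sup_left) (sup_le_sup_right hvt _)))

theorem Cpl.coM {w : L} (h : Cpl w ⊤) : CoM w := by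
  intro y hy
  obtain ⟨z, z1, -, z3, z4⟩ := h.2 (y ⊔ w) le_sup_right le_top
  rcases IsCoatomic.eq_top_or_exists_le_coatom z with rfl | ⟨c, hc, hzc⟩
  · rw [inf_top_eq] at z4; exact sup_eq_right.1 z4
  · exfalso
    have := hy c (z1.trans hzc) hc
    have h2 : (⊤ : L) ≤ c := z3 ▸ sup_le (sup_le this (z1.trans hzc)) hzc
    exact hc.1 (top_le_iff.1 h2)

theorem CoM.cpl {w : L} (h : CoM w) : Cpl w ⊤ := by
  refine ⟨le_top, fun x hx _ => ?_⟩
  have hne : (univ.filter (fun y : L => w ≤ y ∧ x ⊔ y = ⊤)).Nonempty := ⟨⊤, by simp⟩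
  obtain ⟨y, hy⟩ := Finset.exists_minimal hne
  have hym := hy.1
  simp only [mem_filter, mem_univ, true_and] at hym
  obtain ⟨h1, h3⟩ := hym
  refine ⟨y, h1, le_top, h3, ?_⟩
  refine le_antisymm (h _ ?_) (le_inf hx h1)
  intro c hwc hc
  by_contra hpn
  have e1 : c ⊔ x ⊓ y = ⊤ := hc.2 _ (lt_of_le_of_ne le_sup_left (fun e => hpn (e ▸ le_sup_right)))
  have e2 : x ⊔ (y ⊓ c) = ⊤ := by
    refine top_le_iff.1 ?_
    rw [← h3]
    refine sup_le le_sup_left ?_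
    calc y = y ⊓ (c ⊔ x ⊓ y) := by rw [e1, inf_top_eq]
      _ = (x ⊓ y ⊔ c) ⊓ y := by rw [inf_comm, sup_comm]
      _ = x ⊓ y ⊔ c ⊓ y := sup_inf_assoc_of_le c inf_le_right
      _ ≤ _ := sup_le (inf_le_left.trans le_sup_left) (by rw [inf_comm]; exact le_sup_right)
  have e3 := hy.2 (y := y ⊓ c) (by simp [h1, hwc, e2]) inf_le_left
  exact hpn (inf_le_right.trans (e3.trans inf_le_right))

theorem CoM.inf {w v : L} (h : CoM w) (h' : CoM v) : CoM (w ⊓ v) := fun y hy =>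
  le_inf (h y fun c hc hc' => hy c (inf_le_left.trans hc) hc')
    (h' y fun c hc hc' => hy c (inf_le_right.trans hc) hc')

theorem CoM.mono {w v : L} (h : CoM w) (h' : w ≤ v) : CoM v :=
  (h.cpl.right h' le_top).coM

/-- `g x = μ(x,⊤)`. -/
def IsNu (g : L → ℝ) : Prop :=
  ∀ x, ∑ z ∈ univ.filter (fun z => x ≤ z), g z = if x = ⊤ then 1 else 0

theorem eq_zero_of_up {h : L → ℝ} (hh : ∀ x, ∑ z ∈ univ.filter (fun z => x ≤ z), h z = 0) :
    ∀ x, h x = 0 := by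
  intro x
  induction x using WellFoundedGT.induction with
  | ind x ih =>
  have := hh x
  rw [← this]
  symm
  refine Finset.sum_eq_single_of_mem x (by simp) ?_
  intro y hy hne
  simp only [mem_filter, mem_univ, true_and] at hy
  exact ih y (lt_of_le_of_ne hy (Ne.symm hne))

theorem weisner {g : L → ℝ} (hg : IsNu g) {d : L} (hd : d ≠ ⊤) (a : L) :
    ∑ x ∈ univ.filter (fun x => x ⊓ d = a), g x = 0 := by
  refine eq_zero_of_up (h := fun a => ∑ x ∈ univ.filter (fun x => x ⊓ d = a), g x) ?_ a
  intro x
  simp only [sum_filter]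
  rw [← sum_filter, sum_comm]
  have : ∀ y : L, (∑ z ∈ univ.filter (fun z => x ≤ z), if y ⊓ d = z then g y else 0)
      = if x ≤ y ⊓ d then g y else 0 := by
    intro y; simp
  simp_rw [this]
  rw [← sum_filter]
  by_cases hx : x ≤ d
  · have h1 := hg x
    have hxt : x ≠ ⊤ := by
      rintro rfl
      exact hd (top_le_iff.1 hx)
    rw [if_neg hxt] at h1
    rw [← h1]
    congr 1
    ext y; simp [hx]
  · rw [filter_false_of_mem, sum_empty]
    intro y _ h
    exact hx (h.trans inf_le_right)

theorem nu_coM {g : L → ℝ} (hg : IsNu g) {a : L} (ha : g a ≠ 0) : CoM a := by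
  intro y hy
  by_contra hya
  have key : ∀ x, a ≤ x → ¬ y ≤ x → g x = 0 := by
    intro x
    induction x using WellFoundedGT.induction with
    | ind x ih =>
    intro hax hyx
    have hx := hg x
    have hxt : x ≠ ⊤ := fun e => hyx (e ▸ le_top)
    rw [if_neg hxt] at hx
    have h2 := hg (x ⊔ y)
    have hxyt : x ⊔ y ≠ ⊤ := by
      intro e
      obtain ⟨c, hc, hxc⟩ := (IsCoatomic.eq_top_or_exists_le_coatom x).resolve_left hxt
      exact hc.1 (top_le_iff.1 (e ▸ sup_le hxc (hy c (hax.trans hxc) hc)))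
    rw [if_neg hxyt] at h2
    rw [← sum_filter_add_sum_filter_not (univ.filter (fun z => x ≤ z)) (fun z => y ≤ z)] at hx
    simp only [filter_filter, ← sup_le_iff] at hx
    rw [h2, zero_add] at hx
    rw [← hx]
    symm
    refine Finset.sum_eq_single_of_mem x (by simp [hyx]) ?_
    intro z hz hne
    simp only [mem_filter, mem_univ, true_and] at hz
    exact ih z (lt_of_le_of_ne hz.1 (Ne.symm hne)) (hax.trans hz.1) hz.2
  exact ha (key a le_rfl hya)

/-- number of distributive elements in `[a,⊤]`. -/
noncomputable def Znum (a : L) : ℕ :=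
  Nat.card {H : L // a ≤ H ∧ ∀ K₁ K₂ : L, a ≤ K₁ → a ≤ K₂ → H ⊔ (K₁ ⊓ K₂) = (H ⊔ K₁) ⊓ (H ⊔ K₂)}

theorem Znum_pos (a : L) : 1 ≤ Znum a := by
  unfold Znum
  haveI : Nonempty {H : L // a ≤ H ∧ ∀ K₁ K₂ : L, a ≤ K₁ → a ≤ K₂ →
    H ⊔ (K₁ ⊓ K₂) = (H ⊔ K₁) ⊓ (H ⊔ K₂)} := ⟨⟨⊤, le_top, by simp⟩⟩
  exact Nat.card_pos

theorem nu_ineq {g : L → ℝ} (hg : IsNu g) {a : L} (ha : CoM a) :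
    ∑ z ∈ univ.filter (fun z => a ≤ z), |g z| ≤ (Znum a : ℝ) ^ 3 * |g a| := by
  have hat : IsAtomistic (Set.Ici a)ᵒᵈ := by
    rw [isAtomistic_dual_iff_isCoatomistic]
    refine ⟨fun b => ⟨{c | IsCoatom c ∧ b ≤ c}, ⟨fun c hc => hc.2, fun y hy => ?_⟩, fun c hc => hc.1⟩⟩
    refine (ha.mono b.2) y.1 fun c hbc hc => ?_
    have hac : a ≤ c := le_trans b.2 hbc
    refine hy (a := ⟨c, hac⟩) ⟨⟨fun e => hc.1 (congrArg Subtype.val e), fun z hz => ?_⟩, hbc⟩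
    exact Subtype.ext (hc.2 z.1 hz)
  have hmu : IsMu (fun x : (Set.Ici a)ᵒᵈ => g (OrderDual.ofDual x).1) := by
    intro y
    have h1 := hg (OrderDual.ofDual y).1
    have h2 : ((OrderDual.ofDual y).1 = ⊤) ↔ y = ⊥ := by
      constructor
      · intro e; exact congrArg OrderDual.toDual (Subtype.ext e : OrderDual.ofDual y = ⊤)
      · intro e; rw [e]; rfl
    refine Eq.trans ?_ (h1.trans ?_)
    rotate_left
    · by_cases hy : y = ⊥
      · rw [if_pos hy, if_pos (h2.2 hy)]
      · rw [if_neg hy, if_neg (fun h => hy (h2.1 h))]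
    refine Finset.sum_bij (fun x _ => (OrderDual.ofDual x).1) ?_ ?_ ?_ ?_
    · intro x hx
      simp only [mem_filter, mem_univ, true_and] at hx ⊢
      exact hx
    · intro x _ x' _ h
      exact Subtype.ext h
    · intro x hx
      simp only [mem_filter, mem_univ, true_and] at hx
      exact ⟨OrderDual.toDual ⟨x, le_trans (OrderDual.ofDual y).2 hx⟩, mem_filter.2 ⟨mem_univ _, hx⟩, rfl⟩
    · intro x _; rfl
  have h := lattice_ineq hat hmu
  have e1 : ∑ z : (Set.Ici a)ᵒᵈ, |g (OrderDual.ofDual z).1|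
      = ∑ z ∈ univ.filter (fun z => a ≤ z), |g z| := by
    refine Finset.sum_bij (fun x _ => (OrderDual.ofDual x).1) ?_ ?_ ?_ ?_
    · intro x hx
      simp only [mem_filter, mem_univ, true_and]
      exact (OrderDual.ofDual x).2
    · intro x _ x' _ h
      exact Subtype.ext h
    · intro x hx
      simp only [mem_filter, mem_univ, true_and] at hx
      exact ⟨OrderDual.toDual ⟨x, hx⟩, by simp, rfl⟩
    · intro x _; rfl
  have e2 : Nat.card {H : (Set.Ici a)ᵒᵈ // ∀ k l : (Set.Ici a)ᵒᵈ, H ⊓ (k ⊔ l) = (H ⊓ k) ⊔ (H ⊓ l)}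
      = Znum a := by
    refine Nat.card_congr ⟨fun H => ⟨(OrderDual.ofDual H.1).1, (OrderDual.ofDual H.1).2,
      fun K₁ K₂ h1 h2 => ?_⟩, fun H => ⟨OrderDual.toDual ⟨H.1, H.2.1⟩, fun k l => ?_⟩, ?_, ?_⟩
    · exact congrArg (fun z : (Set.Ici a)ᵒᵈ => (OrderDual.ofDual z).1)
        (H.2 (OrderDual.toDual ⟨K₁, h1⟩) (OrderDual.toDual ⟨K₂, h2⟩))
    · exact congrArg OrderDual.toDual (Subtype.ext (H.2.2 (OrderDual.ofDual k).1 (OrderDual.ofDual l).1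
        (OrderDual.ofDual k).2 (OrderDual.ofDual l).2) :
        (⟨H.1, H.2.1⟩ : Set.Ici a) ⊔ (OrderDual.ofDual k ⊓ OrderDual.ofDual l) =
         (⟨H.1, H.2.1⟩ ⊔ OrderDual.ofDual k) ⊓ (⟨H.1, H.2.1⟩ ⊔ OrderDual.ofDual l))
    · intro H; rfl
    · intro H; rfl
  rw [e1, e2] at h
  exact h

theorem fib_bound {g : L → ℝ} (hg : IsNu g) {d : L} (hd : CoM d) (a : L) :
    ∑ x ∈ univ.filter (fun x => x ⊓ d = a), |g x| ≤ (Znum a : ℝ) ^ 3 * |g a| := by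
  by_cases h : ∀ x, x ⊓ d = a → g x = 0
  · rw [Finset.sum_eq_zero]
    · positivity
    · intro x hx
      simp only [mem_filter, mem_univ, true_and] at hx
      rw [h x hx, abs_zero]
  · push Not at h
    obtain ⟨x, hx, hx0⟩ := h
    have ha : CoM a := hx ▸ (nu_coM hg hx0).inf hd
    refine le_trans (sum_le_sum_of_subset_of_nonneg ?_ fun _ _ _ => abs_nonneg _) (nu_ineq hg ha)
    intro z hz
    simp only [mem_filter, mem_univ, true_and] at hz ⊢
    rw [← hz]; exact inf_le_left

end LatticePart3
end MomentAux

namespace MomentAux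

section PIsec
variable {P R T : Type*} [Lattice P] [Lattice R] [Lattice T]

/-- partial isomorphism of the ideals below `a` and `c`. -/
structure PI (a : P) (c : R) where
  f : P → R
  g : R → P
  fle : ∀ z, z ≤ a → f z ≤ c
  gle : ∀ z, z ≤ c → g z ≤ a
  gf : ∀ z, z ≤ a → g (f z) = z
  fg : ∀ z, z ≤ c → f (g z) = z
  fmono : ∀ z z', z ≤ z' → z' ≤ a → f z ≤ f z'
  gmono : ∀ z z', z ≤ z' → z' ≤ c → g z ≤ g z'

namespace PI
variable {a : P} {c : R} {d : T}

def refl (a : P) : PI a a := ⟨id, id, fun _ h => h, fun _ h => h, fun _ _ => rfl, fun _ _ => rfl,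
  fun _ _ h _ => h, fun _ _ h _ => h⟩

def symm (e : PI a c) : PI c a := ⟨e.g, e.f, e.gle, e.fle, e.fg, e.gf, e.gmono, e.fmono⟩

def trans (e : PI a c) (e' : PI c d) : PI a d where
  f := fun z => e'.f (e.f z)
  g := fun z => e.g (e'.g z)
  fle := fun z h => e'.fle _ (e.fle _ h)
  gle := fun z h => e.gle _ (e'.gle _ h)
  gf := fun z h => by rw [e'.gf _ (e.fle _ h), e.gf _ h]
  fg := fun z h => by rw [e.fg _ (e'.gle _ h), e'.fg _ h]
  fmono := fun z z' h h' => e'.fmono _ _ (e.fmono _ _ h h') (e.fle _ h')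
  gmono := fun z z' h h' => e.gmono _ _ (e'.gmono _ _ h h') (e'.gle _ h')

theorem f_top (e : PI a c) : e.f a = c := by
  refine le_antisymm (e.fle _ le_rfl) ?_
  conv_lhs => rw [← e.fg c le_rfl]
  exact e.fmono _ _ (e.gle _ le_rfl) le_rfl

theorem f_le_iff (e : PI a c) {z z' : P} (h : z ≤ a) (h' : z' ≤ a) : e.f z ≤ e.f z' ↔ z ≤ z' := by
  refine ⟨fun hh => ?_, fun hh => e.fmono _ _ hh h'⟩
  rw [← e.gf z h, ← e.gf z' h']
  exact e.gmono _ _ hh (e.fle _ h')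

theorem f_inj (e : PI a c) {z z' : P} (h : z ≤ a) (h' : z' ≤ a) (hh : e.f z = e.f z') : z = z' := by
  rw [← e.gf z h, ← e.gf z' h', hh]

def restrict (e : PI a c) {b : P} (hb : b ≤ a) : PI b (e.f b) where
  f := e.f
  g := e.g
  fle := fun z h => e.fmono _ _ h hb
  gle := fun z h => by
    rw [← e.gf b hb]; exact e.gmono _ _ h (e.fle _ hb)
  gf := fun z h => e.gf _ (h.trans hb)
  fg := fun z h => e.fg _ (h.trans (e.fle _ hb))
  fmono := fun z z' h h' => e.fmono _ _ h (h'.trans hb)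
  gmono := fun z z' h h' => e.gmono _ _ h (h'.trans (e.fle _ hb))

theorem f_sup (e : PI a c) {z z' : P} (h : z ≤ a) (h' : z' ≤ a) : e.f (z ⊔ z') = e.f z ⊔ e.f z' := by
  have hs : z ⊔ z' ≤ a := sup_le h h'
  refine le_antisymm ?_ (sup_le (e.fmono _ _ le_sup_left hs) (e.fmono _ _ le_sup_right hs))
  have h1 : e.f z ⊔ e.f z' ≤ c := sup_le (e.fle _ h) (e.fle _ h')
  rw [← e.fg _ h1]
  refine e.fmono _ _ (sup_le ?_ ?_) (e.gle _ h1)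
  · conv_lhs => rw [← e.gf z h]
    exact e.gmono _ _ le_sup_left h1
  · conv_lhs => rw [← e.gf z' h']
    exact e.gmono _ _ le_sup_right h1

theorem f_inf (e : PI a c) {z z' : P} (h : z ≤ a) (h' : z' ≤ a) : e.f (z ⊓ z') = e.f z ⊓ e.f z' := by
  refine le_antisymm (le_inf (e.fmono _ _ inf_le_left h) (e.fmono _ _ inf_le_right h')) ?_
  have h1 : e.f z ⊓ e.f z' ≤ c := inf_le_left.trans (e.fle _ h)
  rw [← e.fg _ h1]
  refine e.fmono _ _ (le_inf ?_ ?_) (inf_le_left.trans h)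
  · conv_rhs => rw [← e.gf z h]
    exact e.gmono _ _ inf_le_left (e.fle _ h)
  · conv_rhs => rw [← e.gf z' h']
    exact e.gmono _ _ inf_le_right (e.fle _ h')

theorem f_bot [OrderBot P] [OrderBot R] (e : PI a c) : e.f ⊥ = ⊥ := by
  refine le_bot_iff.1 ?_
  rw [← e.fg ⊥ bot_le]
  exact e.fmono _ _ bot_le (e.gle _ bot_le)

theorem f_lt (e : PI a c) {z z' : P} (h' : z' ≤ a) (hh : z < z') : e.f z < e.f z' := by
  refine lt_of_le_of_ne (e.fmono _ _ hh.le h') fun h => ?_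
  exact hh.ne (e.f_inj (hh.le.trans h') h' h)

theorem f_covBy (e : PI a c) {w p : P} (hp : p ≤ a) (h : w ⋖ p) : e.f w ⋖ e.f p := by
  refine ⟨e.f_lt hp h.lt, fun x h1 h2 => ?_⟩
  have hx : x ≤ c := h2.le.trans (e.fle _ hp)
  have h3 := e.symm.f_lt hx h1
  have h4 := e.symm.f_lt (e.fle _ hp) h2
  simp only [symm] at h3 h4
  rw [e.gf _ (h.le.trans hp)] at h3
  rw [e.gf _ hp] at h4
  exact h.2 h3 h4

theorem f_atSup (e : PI a c) {w : P} (h : AtSup w a) : AtSup (e.f w) c := by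
  refine ⟨e.fle _ h.1, fun y hy hp => ?_⟩
  have hyc : y ⊓ c ≤ c := inf_le_right
  have : a ≤ e.g (y ⊓ c) := by
    refine h.2 _ ?_ fun p hwp hpa => ?_
    · rw [← e.gf w h.1]; exact e.gmono _ _ (le_inf hy (e.fle _ h.1)) hyc
    · rw [← e.gf p hpa]
      exact e.gmono _ _ (le_inf (hp _ (e.f_covBy hpa hwp) (e.fle _ hpa)) (e.fle _ hpa)) hyc
  have h2 := e.fmono _ _ this (e.gle _ hyc)
  rw [e.fg _ hyc, e.f_top] at h2
  exact h2.trans inf_le_left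

end PI
end PIsec

universe v
variable {I : Type v} {Q : I → Type v} [∀ X, Lattice (Q X)] [∀ X, BoundedOrder (Q X)]
  [∀ X, Fintype (Q X)] [∀ X, IsModularLattice (Q X)]

/-- A system of quotient lattices. -/
structure MSys (I : Type v) (Q : I → Type v) [∀ X, Lattice (Q X)] [∀ X, BoundedOrder (Q X)] where
  cl : ∀ {X : I}, Q X → I
  cl_top : ∀ X : I, cl (⊤ : Q X) = X
  pi : ∀ {X : I} (a : Q X), ∃ e : PI a (⊤ : Q (cl a)), ∀ z, z ≤ a → cl (e.f z) = cl z

namespace MSys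
variable (σ : MSys I Q)

/-- formation -/
structure Fm (S : Set I) : Prop where
  dc : ∀ {X : I} (a : Q X), X ∈ S → σ.cl a ∈ S
  jc : ∀ {X : I} (a b : Q X), σ.cl a ∈ S → σ.cl b ∈ S → σ.cl (a ⊔ b) ∈ S
  mc : ∀ X : I, (⊥ : Q X) = ⊤ → X ∈ S

/-- narrow -/
def Nar (S : Set I) : Prop := ∀ A ∈ S, {Y | Y ∈ S ∧ ∃ a : Q Y, a ⋖ ⊤ ∧ σ.cl a = A}.Finite

variable {σ}

theorem Fm.dc_le {S : Set I} (h : σ.Fm S) {X : I} {a b : Q X} (hb : b ≤ a) (ha : σ.cl a ∈ S) :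
    σ.cl b ∈ S := by
  obtain ⟨e, he⟩ := σ.pi a
  rw [← he b hb]; exact h.dc _ ha

variable (σ) in
theorem cl_bot_triv {X : I} : (⊥ : Q (σ.cl (⊥ : Q X))) = ⊤ := by
  obtain ⟨e, he⟩ := σ.pi (⊥ : Q X)
  rw [← e.f_top, e.f_bot]

theorem Fm.inter {S S' : Set I} (h : σ.Fm S) (h' : σ.Fm S') : σ.Fm (S ∩ S') where
  dc := fun a ha => ⟨h.dc a ha.1, h'.dc a ha.2⟩
  jc := fun a b ha hb => ⟨h.jc a b ha.1 hb.1, h'.jc a b ha.2 hb.2⟩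
  mc := fun X hX => ⟨h.mc X hX, h'.mc X hX⟩

variable (σ) in
/-- maximal quotient in `S` -/
noncomputable def tr (S : Set I) (X : I) : Q X := (Finset.univ.filter (fun z : Q X => σ.cl z ∈ S)).sup id

variable (σ) in
noncomputable def trI (S : Set I) (X : I) : I := σ.cl (σ.tr S X)

theorem le_tr {S : Set I} {X : I} {z : Q X} (hz : σ.cl z ∈ S) : z ≤ σ.tr S X :=
  Finset.le_sup (f := id) (by simpa using hz)

theorem tr_mem {S : Set I} (h : σ.Fm S) (X : I) : σ.trI S X ∈ S := by
  unfold trI tr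
  refine Finset.sup_induction (p := fun z : Q X => σ.cl z ∈ S) (h.mc _ σ.cl_bot_triv)
    (fun a ha b hb => h.jc a b ha hb) ?_
  intro b hb; simpa using hb

theorem le_tr_iff {S : Set I} (h : σ.Fm S) {X : I} {z : Q X} : z ≤ σ.tr S X ↔ σ.cl z ∈ S :=
  ⟨fun hz => h.dc_le hz (tr_mem h X), le_tr⟩

theorem tr_eq_top {S : Set I} (h : σ.Fm S) {X : I} : σ.tr S X = ⊤ ↔ X ∈ S := by
  rw [← top_le_iff, le_tr_iff h, σ.cl_top]

theorem trI_eq {S : Set I} (h : σ.Fm S) {X : I} (hX : X ∈ S) : σ.trI S X = X := by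
  unfold trI; rw [(tr_eq_top h).2 hX, σ.cl_top]

theorem tr_pi {S : Set I} (h : σ.Fm S) {X Y : I} {a : Q X} {c : Q Y} (e : PI a c)
    (he : ∀ z, z ≤ a → σ.cl (e.f z) = σ.cl z) : e.f (σ.tr S X ⊓ a) = σ.tr S Y ⊓ c := by
  refine le_antisymm (le_inf ?_ (e.fle _ inf_le_right)) ?_
  · rw [le_tr_iff h, he _ inf_le_right, ← le_tr_iff h]; exact inf_le_left
  · rw [← e.fg (σ.tr S Y ⊓ c) inf_le_right]
    refine e.fmono _ _ (le_inf ?_ (e.gle _ inf_le_right)) inf_le_right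
    rw [le_tr_iff h, ← he _ (e.gle _ inf_le_right), e.fg _ inf_le_right, ← le_tr_iff h]
    exact inf_le_left

theorem trI_cl {S : Set I} (h : σ.Fm S) {X : I} (a : Q X) : σ.trI S (σ.cl a) = σ.cl (σ.tr S X ⊓ a) := by
  obtain ⟨e, he⟩ := σ.pi a
  rw [← he _ inf_le_right, tr_pi h e he, inf_top_eq, trI]

theorem trI_trI_inf {S S' : Set I} (h : σ.Fm S) (X : I) :
    σ.trI S (σ.trI S' X) = σ.cl (σ.tr S X ⊓ σ.tr S' X) := trI_cl h _

theorem trI_trI {S S' : Set I} (h : σ.Fm S) (h' : σ.Fm S') (hs : S ⊆ S') (X : I) :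
    σ.trI S (σ.trI S' X) = σ.trI S X := by
  rw [trI_trI_inf h, inf_eq_left.2, trI]
  exact le_tr (hs (tr_mem h X))

theorem trI_comm {S S' : Set I} (h : σ.Fm S) (h' : σ.Fm S') (X : I) :
    σ.trI S (σ.trI S' X) = σ.trI S' (σ.trI S X) := by
  rw [trI_trI_inf h, trI_trI_inf h', inf_comm]

theorem tr_inter {S S' : Set I} (h : σ.Fm S) (h' : σ.Fm S') (X : I) :
    σ.tr (S ∩ S') X = σ.tr S X ⊓ σ.tr S' X := by
  refine le_antisymm (le_inf ?_ ?_) ?_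
  · exact le_tr (tr_mem (h.inter h') X).1
  · exact le_tr (tr_mem (h.inter h') X).2
  · rw [le_tr_iff (h.inter h')]
    exact ⟨(le_tr_iff h).1 inf_le_left, (le_tr_iff h').1 inf_le_right⟩

variable (σ) in
/-- Loewy length at most `k`. -/
def W : ℕ → Set I
  | 0 => {X | (⊥ : Q X) = ⊤}
  | k + 1 => {X | ∃ w : Q X, σ.cl w ∈ W k ∧ AtSup w ⊤}

theorem cl_mem_W_zero {X : I} (a : Q X) : σ.cl a ∈ σ.W 0 ↔ a = ⊥ := by
  obtain ⟨e, he⟩ := σ.pi a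
  show (⊥ : Q (σ.cl a)) = ⊤ ↔ _
  rw [← e.f_top, ← e.f_bot]
  exact ⟨fun h => (e.f_inj bot_le le_rfl h).symm, fun h => congrArg e.f h.symm⟩

theorem cl_mem_W_succ {X : I} (a : Q X) (k : ℕ) :
    σ.cl a ∈ σ.W (k + 1) ↔ ∃ w : Q X, w ≤ a ∧ σ.cl w ∈ σ.W k ∧ AtSup w a := by
  obtain ⟨e, he⟩ := σ.pi a
  constructor
  · rintro ⟨w, h1, h2⟩
    refine ⟨e.g w, e.gle _ le_top, ?_, e.symm.f_atSup h2⟩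
    rwa [← he _ (e.gle _ le_top), e.fg _ le_top]
  · rintro ⟨w, h0, h1, h2⟩
    refine ⟨e.f w, ?_, e.f_atSup h2⟩
    rwa [he _ h0]

theorem atSup_refl {L : Type*} [Lattice L] (x : L) : AtSup x x := ⟨le_rfl, fun _ h _ => h⟩

theorem W_mono_succ (k : ℕ) : σ.W k ⊆ σ.W (k + 1) := fun X hX =>
  ⟨⊤, by rwa [σ.cl_top], atSup_refl _⟩

theorem W_mono {k l : ℕ} (h : k ≤ l) : σ.W k ⊆ σ.W l := by
  induction l, h using Nat.le_induction with
  | base => exact subset_rfl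
  | succ l _ ih => exact ih.trans (W_mono_succ l)

theorem W_fm (k : ℕ) : σ.Fm (σ.W k) := by
  induction k with
  | zero =>
    refine ⟨fun {X} a ha => ?_, fun a b ha hb => ?_, fun X h => h⟩
    · rw [cl_mem_W_zero]
      exact le_bot_iff.1 (le_top.trans (le_of_eq (Eq.symm ha)))
    · rw [cl_mem_W_zero] at *
      rw [ha, hb, sup_bot_eq]
  | succ k ih =>
    refine ⟨fun {X} a ha => ?_, fun a b ha hb => ?_, fun X h => ?_⟩
    · obtain ⟨w, h1, h2⟩ := ha
      rw [cl_mem_W_succ]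
      exact ⟨w ⊓ a, inf_le_right, ih.dc_le inf_le_left h1, (h2.cpl.inf le_top).atSup⟩
    · rw [cl_mem_W_succ] at *
      obtain ⟨w, h0, h1, h2⟩ := ha
      obtain ⟨w', h0', h1', h2'⟩ := hb
      exact ⟨w ⊔ w', sup_le_sup h0 h0', ih.jc _ _ h1 h1', h2.sup h2'⟩
    · exact W_mono (Nat.zero_le _) (show X ∈ σ.W 0 from h)

theorem exists_W' : ∀ {X : I} (a : Q X), ∃ k, σ.cl a ∈ σ.W k := by
  intro X a
  induction a using WellFoundedLT.induction with
  | ind a ih =>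
  by_cases ha : a = ⊥
  · exact ⟨0, (cl_mem_W_zero a).2 ha⟩
  · obtain ⟨c, -, hc⟩ := exists_le_covBy_of_lt (bot_lt_iff_ne_bot.2 ha)
    obtain ⟨k, hk⟩ := ih c hc.lt
    refine ⟨k + 1, (cl_mem_W_succ a k).2 ⟨c, hc.le, hk, hc.le, fun y hy hp => hp a hc le_rfl⟩⟩

theorem exists_W (X : I) : ∃ k, X ∈ σ.W k := by
  obtain ⟨k, hk⟩ := exists_W' (σ := σ) (⊤ : Q X)
  exact ⟨k, by rwa [σ.cl_top] at hk⟩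

/-- (P3) -/
theorem loewy_atSup {X : I} (k : ℕ) : AtSup (σ.tr (σ.W k) X) (σ.tr (σ.W (k + 1)) X) := by
  have h1 : σ.cl (σ.tr (σ.W (k + 1)) X) ∈ σ.W (k + 1) := tr_mem (W_fm (k + 1)) X
  rw [cl_mem_W_succ] at h1
  obtain ⟨w, h0, h1, h2⟩ := h1
  have := h2.join (v := σ.tr (σ.W k) X) (b := σ.tr (σ.W k) X) (le_tr h1)
    (le_tr (W_mono_succ k (tr_mem (W_fm k) X)))
  rwa [sup_idem, sup_eq_left.2 (le_tr (W_mono_succ k (tr_mem (W_fm k) X)))] at this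

theorem loewy_coM {X : I} (k : ℕ) (b : Q X) (hb : σ.tr (σ.W (k + 1)) X ⊔ b = ⊤) :
    CoM (σ.tr (σ.W k) X ⊔ b) := by
  have := (loewy_atSup (σ := σ) (X := X) k)
  have h2 := this.join (b := b) le_rfl this.1
  rw [hb] at h2
  exact h2.cpl.coM

theorem stab {Sn : ℕ → Set I} (hfm : ∀ n, σ.Fm (Sn n)) (hmono : Monotone Sn) {F : ℕ → I}
    (hF : ∀ n, F n ∈ Sn n) (hth : ∀ m n, m ≤ n → σ.trI (Sn m) (F n) = F m)
    {S : Set I} (hS : σ.Fm S) (hnar : σ.Nar S) {K : ℕ} (hK : S ⊆ σ.W K) :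
    ∃ N, ∀ n, N ≤ n → σ.trI S (F n) = σ.trI S (F N) := by
  have main : ∀ k, ∃ N, ∀ n, N ≤ n → σ.trI (σ.W k ∩ S) (F n) = σ.trI (σ.W k ∩ S) (F N) := by
    intro k
    induction k with
    | zero =>
      refine ⟨0, fun n hn => ?_⟩
      have h0 : ∀ X, σ.trI (σ.W 0 ∩ S) X = σ.cl (⊥ : Q X) := by
        intro X
        have := (tr_mem ((W_fm 0).inter hS) X).1
        rw [trI, cl_mem_W_zero] at this
        rw [trI, this]
      rw [h0, h0]
      have h1 := hth 0 n hn
      rw [← h1, trI]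
      obtain ⟨e, he⟩ := σ.pi (σ.tr (Sn 0) (F n))
      rw [← he ⊥ bot_le, e.f_bot]
    | succ k ih =>
      obtain ⟨N, hN⟩ := ih
      set A := σ.trI (σ.W k ∩ S) (F N) with hA
      have hfk := (W_fm (σ := σ) k).inter hS
      have hfk1 := (W_fm (σ := σ) (k + 1)).inter hS
      have hAS : A ∈ S := (tr_mem hfk _).2
      have hfin := hnar A hAS
      set D := {Y | Y ∈ S ∧ ∃ a : Q Y, a ⋖ ⊤ ∧ σ.cl a = A} with hD
      have hN' : ∃ N', N ≤ N' ∧ ∀ d ∈ D, (∃ n, d ∈ Sn n) → d ∈ Sn N' := by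
        choose! m hm using fun (d : I) (h : ∃ n, d ∈ Sn n) => h
        obtain ⟨B, hB⟩ := (hfin.image m).bddAbove
        refine ⟨max N B, le_max_left _ _, fun d hd h => ?_⟩
        exact hmono ((hB ⟨d, hd, rfl⟩).trans (le_max_right _ _)) (hm d h)
      obtain ⟨N', hNN, hN'⟩ := hN'
      refine ⟨N', fun n hn => ?_⟩
      have hcA : σ.cl (σ.tr (σ.W k ∩ S) (F n)) = A := hN n (hNN.trans hn)
      set s := σ.tr (σ.W k ∩ S) (F n) with hs
      set t := σ.tr (σ.W (k + 1) ∩ S) (F n) with ht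
      have htm := tr_mem hfk1 (F n)
      have hst : s ≤ t := by
        rw [ht, le_tr_iff hfk1]
        exact ⟨W_mono_succ k (tr_mem hfk (F n)).1, (tr_mem hfk (F n)).2⟩
      have hat : AtSup s t := by
        obtain ⟨w, h0, h1, h2⟩ := (cl_mem_W_succ _ k).1 htm.1
        have hws : w ≤ s := by
          rw [hs, le_tr_iff hfk]
          exact ⟨h1, hS.dc_le h0 htm.2⟩
        have := h2.join (b := s) hws hst
        rwa [sup_idem, sup_eq_left.2 hst] at this
      have hsu : s ≤ σ.tr (Sn N') (F n) := by
        rw [le_tr_iff (hfm _), hcA]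
        exact (hfm _).dc _ (hmono hNN (hF N))
      have htu : t ≤ σ.tr (Sn N') (F n) := by
        refine hat.2 _ hsu fun p hsp hpt => ?_
        rw [le_tr_iff (hfm _)]
        refine hN' _ ⟨hS.dc_le hpt htm.2, ?_⟩ ⟨n, (hfm n).dc _ (hF n)⟩
        obtain ⟨e, he⟩ := σ.pi p
        refine ⟨e.f s, ?_, by rw [he _ hsp.le, hcA]⟩
        have := e.f_covBy le_rfl hsp
        rwa [e.f_top] at this
      rw [← hth N' n hn, trI_trI_inf hfk1, inf_eq_left.2 htu, trI]
  obtain ⟨N, hN⟩ := main K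
  rw [Set.inter_eq_right.2 hK] at hN
  exact ⟨N, hN⟩

end MSys
end MomentAux

namespace MomentAux

section Gen

theorem sumGroup {ι : Type*} {P : ι → Type*} [∀ i, Fintype (P i)] {f : (Σ i, P i) → ℝ}
    (h : Summable (fun i => ∑ p, |f ⟨i, p⟩|)) :
    Summable f ∧ ∑' x, f x = ∑' i, ∑ p, f ⟨i, p⟩ := by
  have h1 : Summable (fun x => |f x|) := by
    rw [summable_sigma_of_nonneg (fun _ => abs_nonneg _)]
    refine ⟨fun i => (hasSum_fintype _).summable, ?_⟩
    simpa only [tsum_fintype] using h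
  have h2 : Summable f := h1.of_abs
  refine ⟨h2, ?_⟩
  rw [h2.tsum_sigma' (fun i => (hasSum_fintype _).summable)]
  simp only [tsum_fintype]

theorem summable_of_ofReal {α : Type*} {f : α → ℝ} (h0 : ∀ x, 0 ≤ f x)
    (h : ∑' x, ENNReal.ofReal (f x) ≠ ⊤) : Summable f := by
  have := ENNReal.summable_toReal h
  simpa only [ENNReal.toReal_ofReal (h0 _)] using this

end Gen

universe v
variable {I : Type v} {Q : I → Type v} [∀ X, Lattice (Q X)] [∀ X, BoundedOrder (Q X)]
  [∀ X, Fintype (Q X)] [∀ X, IsModularLattice (Q X)]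

namespace MSys
open Finset
variable {σ : MSys I Q}

/-- right Möbius identity -/
def MobR (mob : ∀ X : I, Q X → Q X → ℝ) : Prop :=
  ∀ X (x y : Q X), x ≤ y →
    ∑ z ∈ univ.filter (fun z => x ≤ z ∧ z ≤ y), mob X x z = if x = y then 1 else 0

theorem MobR.left {mob : ∀ X : I, Q X → Q X → ℝ} (h : MobR mob) (X : I) (x y : Q X) (hxy : x ≤ y) :
    ∑ z ∈ univ.filter (fun z => x ≤ z ∧ z ≤ y), mob X z y = if x = y then 1 else 0 := by
  let A : Matrix (Q X) (Q X) ℝ := fun x z => if x ≤ z then mob X x z else 0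
  let Z : Matrix (Q X) (Q X) ℝ := fun z y => if z ≤ y then 1 else 0
  have hAZ : A * Z = 1 := by
    ext x y
    rw [Matrix.mul_apply, Matrix.one_apply]
    simp only [A, Z, mul_ite, mul_one, mul_zero, ← ite_and]
    by_cases hxy : x ≤ y
    · rw [← h X x y hxy, sum_filter]
      refine sum_congr rfl fun z _ => ?_
      simp only [and_comm]
    · rw [if_neg (fun e => hxy e.le)]
      refine sum_eq_zero fun z _ => ?_
      rw [if_neg]; rintro ⟨h1, h2⟩; exact hxy (h2.trans h1)
  have hZA : Z * A = 1 := mul_eq_one_comm.1 hAZ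
  have := congrFun (congrFun hZA x) y
  rw [Matrix.mul_apply, Matrix.one_apply] at this
  rw [← this, sum_filter]
  refine sum_congr rfl fun z _ => ?_
  simp only [A, Z, ite_mul, one_mul, zero_mul, ← ite_and]

theorem MobR.isNu {mob : ∀ X : I, Q X → Q X → ℝ} (h : MobR mob) (X : I) :
    IsNu (fun x : Q X => mob X x ⊤) := by
  intro x
  have := h.left X x ⊤ le_top
  simpa using this

theorem MobR.transport {mob : ∀ X : I, Q X → Q X → ℝ} (h : MobR mob) {X Y : I} {b : Q X}
    (e : PI b (⊤ : Q Y)) {a : Q X} (ha : a ≤ b) : mob X a b = mob Y (e.f a) ⊤ := by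
  have key := eq_zero_of_up (h := fun z : Q Y => mob X (e.g z) b - mob Y z ⊤) ?_ (e.f a)
  · have key2 : mob X (e.g (e.f a)) b - mob Y (e.f a) ⊤ = 0 := key
    rw [e.gf _ ha] at key2
    linarith
  intro z
  rw [sum_sub_distrib, sub_eq_zero]
  have h1 := h.left X (e.g z) b (e.gle _ le_top)
  have h2 : (e.g z = b) ↔ z = ⊤ := by
    constructor
    · intro hh; rw [← e.fg z le_top, hh, e.f_top]
    · rintro rfl; exact e.symm.f_top
  simp only [h2] at h1
  have h4 := h.isNu Y z
  refine Eq.trans ?_ (h1.trans h4.symm)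
  refine Finset.sum_bij' (fun x _ => e.g x) (fun x _ => e.f x) ?_ ?_ ?_ ?_ ?_
  · intro x hx
    simp only [mem_filter, mem_univ, true_and] at hx ⊢
    exact ⟨e.gmono _ _ hx le_top, e.gle _ le_top⟩
  · intro x hx
    simp only [mem_filter, mem_univ, true_and] at hx ⊢
    rw [← e.fg z le_top]
    exact e.fmono _ _ hx.1 hx.2
  · intro x hx; exact e.fg _ le_top
  · intro x hx
    simp only [mem_filter, mem_univ, true_and] at hx
    exact e.gf _ hx.2
  · intro x hx; rfl

variable (σ) in
/-- number of quotients of `X` in class `E`. -/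
noncomputable def s (X E : I) : ℕ := (univ.filter (fun b : Q X => σ.cl b = E)).card

variable (σ) in
/-- `v_{S,F}` -/
noncomputable def vv (mob : ∀ X : I, Q X → Q X → ℝ) (w : I → ℝ) (S : Set I) (F : I) : ℝ :=
  ∑' X : S, (∑ a ∈ univ.filter (fun a : Q X => σ.cl a = F), mob X a ⊤) * w X

theorem sum_transport {mob : ∀ X : I, Q X → Q X → ℝ} (h : MobR mob) (φ : ℝ → ℝ) {G : I} (b : Q G)
    (F : I) : ∑ a ∈ univ.filter (fun a : Q (σ.cl b) => σ.cl a = F), φ (mob (σ.cl b) a ⊤)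
      = ∑ a ∈ univ.filter (fun a : Q G => a ≤ b ∧ σ.cl a = F), φ (mob G a b) := by
  obtain ⟨e, he⟩ := σ.pi b
  refine Finset.sum_bij' (fun x _ => e.g x) (fun x _ => e.f x) ?_ ?_ ?_ ?_ ?_
  · intro x hx
    simp only [mem_filter, mem_univ, true_and] at hx ⊢
    refine ⟨e.gle _ le_top, ?_⟩
    rw [← he _ (e.gle _ le_top), e.fg _ le_top, hx]
  · intro x hx
    simp only [mem_filter, mem_univ, true_and] at hx ⊢
    rw [he _ hx.1, hx.2]
  · intro x hx; exact e.fg _ le_top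
  · intro x hx
    simp only [mem_filter, mem_univ, true_and] at hx
    exact e.gf _ hx.1
  · intro x hx
    rw [h.transport e (e.gle _ le_top), e.fg _ le_top]

theorem mob_inv {mob : ∀ X : I, Q X → Q X → ℝ} (h : MobR mob) (G F : I) :
    ∑ b : Q G, ∑ a ∈ univ.filter (fun a : Q (σ.cl b) => σ.cl a = F), mob (σ.cl b) a ⊤
      = if G = F then 1 else 0 := by
  have h1 := fun b : Q G => sum_transport (σ := σ) h id b F
  simp only [id] at h1
  simp_rw [h1, sum_filter]
  rw [sum_comm]
  have h2 : ∀ a : Q G, ∑ b : Q G, (if a ≤ b ∧ σ.cl a = F then mob G a b else 0)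
      = if a = ⊤ then (if G = F then 1 else 0) else 0 := by
    intro a
    by_cases ha : σ.cl a = F
    · have := h G a ⊤ le_top
      simp only [le_top, and_true, sum_filter] at this
      simp only [ha, and_true, this]
      by_cases hat : a = ⊤
      · subst hat
        rw [σ.cl_top] at ha
        simp [ha]
      · simp [hat]
    · simp only [ha, and_false, if_false, sum_const_zero]
      by_cases hat : a = ⊤
      · subst hat
        rw [σ.cl_top] at ha
        simp [ha]
      · simp [hat]
  simp_rw [h2]
  simp

theorem s_self_pos (F : I) : 1 ≤ σ.s F F :=
  card_pos.2 ⟨⊤, by simp [σ.cl_top]⟩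

/-- (U): moments determine the measure at a level. -/
theorem uniq {mob : ∀ X : I, Q X → Q X → ℝ} (h : MobR mob) {w : I → ℝ} {S : Set I} (hS : σ.Fm S)
    (hw : ∀ E ∈ S, 0 ≤ w E) {ν : I → ℝ≥0∞}
    (hν : ∀ E ∈ S, ∑' F : S, (σ.s F E : ℝ≥0∞) * ν F = ENNReal.ofReal (w E))
    {F : I} (hF : F ∈ S)
    (hwb : Summable (fun X : S => (∑ a ∈ univ.filter (fun a : Q X => σ.cl a = F), |mob X a ⊤|) * |w X|)) :
    ν F ≠ ⊤ ∧ σ.vv mob w S F = (ν F).toReal := by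
  have hfin : ∀ F ∈ S, ν F ≠ ⊤ := by
    intro F hF htop
    have h1 := hν F hF
    have h2 := ENNReal.le_tsum (f := fun G : S => (σ.s G F : ℝ≥0∞) * ν G) ⟨F, hF⟩
    rw [h1] at h2
    simp only [htop] at h2
    rw [ENNReal.mul_top (by have := s_self_pos (σ := σ) F; simp; omega)] at h2
    exact ENNReal.ofReal_ne_top (top_le_iff.1 h2)
  refine ⟨hfin F hF, ?_⟩
  set r : I → ℝ := fun G => (ν G).toReal with hr
  set m : I → ℝ := fun X => ∑ a ∈ univ.filter (fun a : Q X => σ.cl a = F), |mob X a ⊤| with hm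
  set M : I → ℝ := fun X => ∑ a ∈ univ.filter (fun a : Q X => σ.cl a = F), mob X a ⊤ with hM
  have hMm : ∀ X, |M X| ≤ m X := fun X => abs_sum_le_sum_abs _ _
  have hm0 : ∀ X, 0 ≤ m X := fun X => sum_nonneg fun _ _ => abs_nonneg _
  have hr0 : ∀ G, 0 ≤ r G := fun G => ENNReal.toReal_nonneg
  have hrν : ∀ G ∈ S, ENNReal.ofReal (r G) = ν G := fun G hG => ENNReal.ofReal_toReal (hfin G hG)
  -- moments as reals
  have hmom : ∀ E ∈ S, HasSum (fun G : S => (σ.s G E : ℝ) * r G) (w E) := by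
    intro E hE
    have h1 := hν E hE
    have h2 := ENNReal.hasSum_toReal (f := fun G : S => (σ.s G E : ℝ≥0∞) * ν G)
      (by rw [h1]; exact ENNReal.ofReal_ne_top)
    rw [← ENNReal.tsum_toReal_eq, h1, ENNReal.toReal_ofReal (hw E hE)] at h2
    · simpa only [ENNReal.toReal_mul, ENNReal.toReal_natCast] using h2
    · intro G
      exact ENNReal.mul_ne_top (ENNReal.natCast_ne_top _) (hfin G G.2)
  let B := Σ G : S, Q (G : I)
  let key : B → S := fun x => ⟨σ.cl x.2, hS.dc _ x.1.2⟩
  let f : B → ℝ := fun x => r x.1 * M (σ.cl x.2)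
  have hsum0 : Summable (fun G : S => ∑ b : Q (G : I), r G * m (σ.cl b)) := by
    refine summable_of_ofReal (fun G => sum_nonneg fun b _ => mul_nonneg (hr0 _) (hm0 _)) ?_
    have e1 : ∀ G : S, ENNReal.ofReal (∑ b : Q (G : I), r G * m (σ.cl b))
        = ∑' X : S, (σ.s G X : ℝ≥0∞) * ν G * ENNReal.ofReal (m X) := by
      intro G
      rw [ENNReal.ofReal_sum_of_nonneg (fun b _ => mul_nonneg (hr0 _) (hm0 _))]
      have e2 : ∀ b : Q (G : I), ENNReal.ofReal (r G * m (σ.cl b))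
          = ∑' X : S, if key ⟨G, b⟩ = X then ν G * ENNReal.ofReal (m X) else 0 := by
        intro b
        rw [tsum_ite_eq' (key ⟨G, b⟩), ENNReal.ofReal_mul (hr0 _), hrν G G.2]
      simp_rw [e2]
      rw [← Summable.tsum_finsetSum (fun _ _ => ENNReal.summable)]
      congr 1; ext X
      rw [← sum_filter, sum_const, s, nsmul_eq_mul, mul_assoc]
      congr 3
      ext b
      simp [key, Subtype.ext_iff]
    simp_rw [e1]
    rw [ENNReal.tsum_comm]
    simp_rw [ENNReal.tsum_mul_right, hν _ (Subtype.prop _)]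
    have e3 : ∀ X : S, ENNReal.ofReal (w X) * ENNReal.ofReal (m X) = ENNReal.ofReal (m X * |w X|) := by
      intro X
      rw [← ENNReal.ofReal_mul (hw X X.2), mul_comm, abs_of_nonneg (hw X X.2)]
    simp_rw [e3]
    rw [← ENNReal.ofReal_tsum_of_nonneg (fun X => mul_nonneg (hm0 _) (abs_nonneg _)) hwb]
    exact ENNReal.ofReal_ne_top
  have hsumf : Summable (fun G : S => ∑ b : Q (G : I), |f ⟨G, b⟩|) := by
    refine Summable.of_nonneg_of_le (fun G => sum_nonneg fun b _ => abs_nonneg _) (fun G => ?_) hsum0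
    refine sum_le_sum fun b _ => ?_
    simp only [f]
    rw [abs_mul, abs_of_nonneg (hr0 _)]
    exact mul_le_mul_of_nonneg_left (hMm _) (hr0 _)
  obtain ⟨hs1, hs2⟩ := sumGroup hsumf
  -- group by key
  have hk := (hs1.hasSum.tsum_fiberwise key).tsum_eq
  have hfib : ∀ X : S, ∑' x : key ⁻¹' {X}, f x = M X * w X := by
    intro X
    have e1 : ∀ x : key ⁻¹' {X}, f x = M X * r x.1.1 := by
      rintro ⟨x, hx⟩
      have : σ.cl x.2 = X := congrArg Subtype.val hx
      simp only [f, this, mul_comm]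
    simp_rw [e1]
    rw [tsum_mul_left]
    congr 1
    rw [tsum_subtype (key ⁻¹' {X}) (fun x : B => r x.1)]
    have e2 : ∀ G : S, ∑ b : Q (G : I), (key ⁻¹' {X}).indicator (fun x : B => r x.1) ⟨G, b⟩
        = (σ.s G X : ℝ) * r G := by
      intro G
      simp only [Set.indicator_apply, s]
      rw [← sum_filter, sum_const, nsmul_eq_mul]
      congr 3
      ext b
      simp [key, Subtype.ext_iff]
    have e3 := sumGroup (f := (key ⁻¹' {X}).indicator (fun x : B => r x.1)) ?_
    · rw [e3.2]
      simp_rw [e2]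
      exact (hmom X X.2).tsum_eq
    · have e4 : ∀ x : B, |(key ⁻¹' {X}).indicator (fun x : B => r x.1) x| =
          (key ⁻¹' {X}).indicator (fun x : B => r x.1) x := fun x =>
        abs_of_nonneg (Set.indicator_nonneg (fun _ _ => hr0 _) _)
      simp_rw [e4, e2]
      exact (hmom X X.2).summable
  simp_rw [hfib] at hk
  rw [vv, hk, hs2]
  have hG : ∀ G : S, ∑ b : Q (G : I), f ⟨G, b⟩ = if G = ⟨F, hF⟩ then r G else 0 := by
    intro G
    simp only [f]
    rw [← mul_sum, mob_inv h G F]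
    simp [Subtype.ext_iff]
  simp_rw [hG]
  rw [tsum_ite_eq]

end MSys
end MomentAux

namespace MomentAux
universe v
variable {I : Type v} {Q : I → Type v} [∀ X, Lattice (Q X)] [∀ X, BoundedOrder (Q X)]
  [∀ X, Fintype (Q X)] [∀ X, IsModularLattice (Q X)]

theorem PI.restrict' {P R : Type*} [Lattice P] [Lattice R] {a : P} {c : R} (e : PI a c) {b : P}
    (hb : b ≤ a) {c' : R} (h : e.f b = c') : ∃ e' : PI b c', e'.f = e.f := by
  subst h; exact ⟨e.restrict hb, rfl⟩

namespace MSys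
open Finset
variable (σ : MSys I Q)

/-- triples -/
def Rel (t u : Σ X : I, Q X × Q X) : Prop :=
  ∃ e : PI t.2.1 u.2.1, (∀ z, z ≤ t.2.1 → σ.cl (e.f z) = σ.cl z) ∧
    e.f (t.2.2 ⊓ t.2.1) = u.2.2 ⊓ u.2.1

theorem Rel_equiv : Equivalence σ.Rel where
  refl := fun t => ⟨PI.refl _, fun _ _ => rfl, rfl⟩
  symm := by
    rintro t u ⟨e, h1, h2⟩
    refine ⟨e.symm, fun z hz => ?_, ?_⟩
    · have := h1 _ (e.gle _ hz)
      rw [e.fg _ hz] at this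
      exact this.symm
    · rw [← h2]; exact e.gf _ inf_le_right
  trans := by
    rintro t u w ⟨e, h1, h2⟩ ⟨e', h1', h2'⟩
    refine ⟨e.trans e', fun z hz => ?_, ?_⟩
    · exact (h1' _ (e.fle _ hz)).trans (h1 _ hz)
    · show e'.f (e.f _) = _
      rw [h2, h2']

def relSetoid : Setoid (Σ X : I, Q X × Q X) := ⟨σ.Rel, σ.Rel_equiv⟩

def Kt : Type v := Quotient σ.relSetoid

def key (t : Σ X : I, Q X × Q X) : σ.Kt := Quotient.mk σ.relSetoid t

variable {σ}

theorem key_eq {t u : Σ X : I, Q X × Q X} : σ.key t = σ.key u ↔ σ.Rel t u :=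
  ⟨fun h => Quotient.exact h, fun h => Quotient.sound h⟩

variable (σ) in
noncomputable def TT (k : ℕ) (t : Σ X : I, Q X × Q X) : Σ X : I, Q X × Q X :=
  ⟨t.1, t.2.1 ⊓ (σ.tr (σ.W k) t.1 ⊔ (t.2.2 ⊓ t.2.1)), t.2.2 ⊓ t.2.1⟩

theorem TT_rel (k : ℕ) {t u : Σ X : I, Q X × Q X} (h : σ.Rel t u) : σ.Rel (σ.TT k t) (σ.TT k u) := by
  obtain ⟨e, h1, h2⟩ := h
  obtain ⟨X, a, b⟩ := t
  obtain ⟨Y, c, d⟩ := u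
  simp only at e h1 h2
  have ea : a ⊓ (σ.tr (σ.W k) X ⊔ b ⊓ a) = b ⊓ a ⊔ σ.tr (σ.W k) X ⊓ a := by
    rw [inf_comm a, sup_comm, sup_inf_assoc_of_le _ inf_le_right]
  have ec : c ⊓ (σ.tr (σ.W k) Y ⊔ d ⊓ c) = d ⊓ c ⊔ σ.tr (σ.W k) Y ⊓ c := by
    rw [inf_comm c, sup_comm, sup_inf_assoc_of_le _ inf_le_right]
  have hle : a ⊓ (σ.tr (σ.W k) X ⊔ b ⊓ a) ≤ a := inf_le_left
  have hf : e.f (a ⊓ (σ.tr (σ.W k) X ⊔ b ⊓ a)) = c ⊓ (σ.tr (σ.W k) Y ⊔ d ⊓ c) := by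
    rw [ea, ec, e.f_sup inf_le_right inf_le_right, h2, tr_pi (W_fm k) e h1]
  obtain ⟨e', he'⟩ := e.restrict' hle hf
  refine ⟨e', fun z hz => ?_, ?_⟩
  · rw [he']; exact h1 _ (le_trans hz hle)
  · rw [he']
    have e1 : b ⊓ a ⊓ (a ⊓ (σ.tr (σ.W k) X ⊔ b ⊓ a)) = b ⊓ a :=
      inf_eq_left.2 (le_inf inf_le_right le_sup_right)
    have e2 : d ⊓ c ⊓ (c ⊓ (σ.tr (σ.W k) Y ⊔ d ⊓ c)) = d ⊓ c :=
      inf_eq_left.2 (le_inf inf_le_right le_sup_right)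
    show e.f (b ⊓ a ⊓ (a ⊓ (σ.tr (σ.W k) X ⊔ b ⊓ a))) = d ⊓ c ⊓ (c ⊓ (σ.tr (σ.W k) Y ⊔ d ⊓ c))
    exact (congrArg e.f e1).trans (h2.trans e2.symm)

variable (σ) in
noncomputable def tau (k : ℕ) : σ.Kt → σ.Kt :=
  Quotient.map' (σ.TT k) (fun _ _ h => TT_rel k h)

theorem tau_key (k : ℕ) (t : Σ X : I, Q X × Q X) : σ.tau k (σ.key t) = σ.key (σ.TT k t) := rfl

variable (σ) in
noncomputable def kF : σ.Kt → I :=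
  Quotient.lift (fun t : Σ X : I, Q X × Q X => σ.cl t.2.1) (by
    rintro t u ⟨e, h1, h2⟩
    have := h1 _ le_rfl
    rw [e.f_top] at this
    exact this.symm)

theorem kF_key (t : Σ X : I, Q X × Q X) : σ.kF (σ.key t) = σ.cl t.2.1 := rfl

theorem key_cl {X : I} (a : Q X) : ∃ e : PI a (⊤ : Q (σ.cl a)), (∀ z, z ≤ a → σ.cl (e.f z) = σ.cl z) ∧
    ∀ b, b ≤ a → σ.key ⟨X, a, b⟩ = σ.key ⟨σ.cl a, ⊤, e.f b⟩ := by
  obtain ⟨e, he⟩ := σ.pi a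
  refine ⟨e, he, fun b hb => key_eq.2 ⟨e, he, ?_⟩⟩
  show e.f (b ⊓ a) = e.f b ⊓ ⊤
  rw [inf_top_eq, inf_eq_left.2 hb]

variable (σ) in
/-- the weight -/
noncomputable def phi (mob : ∀ X : I, Q X → Q X → ℝ) (w : I → ℝ) (E : I) (k : ℕ) (X : I) (a b : Q X) : ℝ :=
  if b ≤ a ∧ σ.cl b = E ∧ σ.tr (σ.W k) X ⊔ b = ⊤ then mob X a ⊤ * w X else 0

theorem phi_step {mob : ∀ X : I, Q X → Q X → ℝ} (h : MobR mob) (w : I → ℝ) (E : I) (k : ℕ) {X : I}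
    (a b : Q X) : σ.phi mob w E k X a b =
      ∑ a' ∈ univ.filter (fun a' : Q X => a' ⊓ (σ.tr (σ.W k) X ⊔ b) = a), σ.phi mob w E (k + 1) X a' b := by
  have hmon : σ.tr (σ.W k) X ≤ σ.tr (σ.W (k + 1)) X := le_tr (W_mono_succ k (tr_mem (W_fm k) X))
  by_cases hE : σ.cl b = E
  swap
  · simp [phi, hE]
  by_cases h1 : σ.tr (σ.W k) X ⊔ b = ⊤
  · have h2 : σ.tr (σ.W (k + 1)) X ⊔ b = ⊤ := top_le_iff.1 (h1 ▸ sup_le_sup_right hmon b)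
    simp [phi, h1, h2, sum_filter]
  · have hz : σ.phi mob w E k X a b = 0 := by simp [phi, h1]
    rw [hz]
    by_cases h2 : σ.tr (σ.W (k + 1)) X ⊔ b = ⊤
    swap
    · simp [phi, h2]
    have h3 := weisner (h.isNu X) h1 a
    by_cases hba : b ≤ a
    · symm
      calc _ = ∑ x ∈ univ.filter (fun x : Q X => x ⊓ (σ.tr (σ.W k) X ⊔ b) = a), mob X x ⊤ * w X := by
            refine sum_congr rfl fun x hx => ?_
            simp only [mem_filter, mem_univ, true_and] at hx
            have : b ≤ x := hba.trans (hx ▸ inf_le_left)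
            simp [phi, this, hE, h2]
        _ = 0 := by rw [← sum_mul, h3, zero_mul]
    · symm
      refine sum_eq_zero fun x hx => ?_
      simp only [mem_filter, mem_univ, true_and] at hx
      have : ¬ b ≤ x := fun hb => hba (hx ▸ le_inf hb le_sup_right)
      simp [phi, this]

theorem phi_bound {mob : ∀ X : I, Q X → Q X → ℝ} (h : MobR mob) (w : I → ℝ) (E : I) (k : ℕ) {X : I}
    (a b : Q X) :
      ∑ a' ∈ univ.filter (fun a' : Q X => a' ⊓ (σ.tr (σ.W k) X ⊔ b) = a), |σ.phi mob w E (k + 1) X a' b|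
      ≤ if b ≤ a then (Znum a : ℝ) ^ 3 * |mob X a ⊤| * |w X| else 0 := by
  by_cases hba : b ≤ a
  swap
  · rw [if_neg hba]
    refine (sum_eq_zero fun x hx => ?_).le
    simp only [mem_filter, mem_univ, true_and] at hx
    have : ¬ b ≤ x := fun hb => hba (hx ▸ le_inf hb le_sup_right)
    simp [phi, this]
  rw [if_pos hba]
  by_cases h2 : σ.tr (σ.W (k + 1)) X ⊔ b = ⊤
  swap
  · simp only [phi, h2, and_false, if_false, abs_zero, sum_const_zero]
    positivity
  refine le_trans (sum_le_sum (g := fun x => |mob X x ⊤| * |w X|) fun x _ => ?_) ?_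
  · rw [phi]; split_ifs
    · rw [abs_mul]
    · rw [abs_zero]; positivity
  · rw [← sum_mul]
    exact mul_le_mul_of_nonneg_right (fib_bound (h.isNu X) (loewy_coM k b h2) a) (abs_nonneg _)

variable (σ) in
/-- well-behaved at `S`. -/
def WB (mob : ∀ X : I, Q X → Q X → ℝ) (w : I → ℝ) (S : Set I) : Prop :=
  ∀ F ∈ S, Summable (fun X : S => (∑ a ∈ univ.filter (fun a : Q X => σ.cl a = F),
    (Znum a : ℝ) ^ 3 * |mob X a ⊤|) * |w X|)

theorem WB.weak {mob : ∀ X : I, Q X → Q X → ℝ} {w : I → ℝ} {S : Set I} (h : σ.WB mob w S) {F : I}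
    (hF : F ∈ S) :
    Summable (fun X : S => (∑ a ∈ univ.filter (fun a : Q X => σ.cl a = F), |mob X a ⊤|) * |w X|) := by
  refine Summable.of_nonneg_of_le (fun X => by positivity) (fun X => ?_) (h F hF)
  refine mul_le_mul_of_nonneg_right (sum_le_sum fun a _ => ?_) (abs_nonneg _)
  refine le_mul_of_one_le_left (abs_nonneg _) (one_le_pow₀ ?_)
  exact_mod_cast Znum_pos a

theorem card_le (F : I) {X : I} (a : Q X) (ha : σ.cl a = F) :
    (univ.filter (fun b : Q X => b ≤ a)).card ≤ Fintype.card (Q F) := by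
  subst ha
  obtain ⟨e, he⟩ := σ.pi a
  refine Finset.card_le_card_of_injOn e.f (fun _ _ => mem_univ _) ?_
  intro x hx y hy hxy
  simp only [coe_filter, mem_univ, true_and, Set.mem_setOf_eq] at hx hy
  exact e.f_inj hx hy hxy

section main
variable {mob : ∀ X : I, Q X → Q X → ℝ} {w : I → ℝ} {S : Set I}

variable (σ mob w S) in
/-- weights on triples over `S` -/
noncomputable def vk (E : I) (k : ℕ) (κ : σ.Kt) : ℝ :=
  ∑' ω : Σ X : S, Q (X : I) × Q (X : I),
    if σ.key ⟨ω.1, ω.2⟩ = κ then σ.phi mob w E k ω.1 ω.2.1 ω.2.2 else 0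

variable (σ mob w) in
/-- auxiliary bookkeeping for the counting argument -/
noncomputable def fk (E : I) (k : ℕ) (κ : σ.Kt) (X : I) (p : Q X × Q X) : ℝ :=
  if σ.key ⟨X, p⟩ = κ then σ.phi mob w E k X p.1 p.2 else 0

variable (σ mob w) in
/-- auxiliary bookkeeping for the counting argument -/
noncomputable def gk (E : I) (k : ℕ) (κ : σ.Kt) (X : I) (p : Q X × Q X) : ℝ :=
  if σ.tau k (σ.key ⟨X, p⟩) = κ then σ.phi mob w E (k + 1) X p.1 p.2 else 0

theorem gk_eq (E : I) (k : ℕ) (κ : σ.Kt) (X : I) (p : Q X × Q X) : σ.gk mob w E k κ X p =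
    ∑ a : Q X, if σ.key ⟨X, a, p.2⟩ = κ then
      (if p.1 ⊓ (σ.tr (σ.W k) X ⊔ p.2) = a then σ.phi mob w E (k + 1) X p.1 p.2 else 0) else 0 := by
  obtain ⟨a', b⟩ := p
  have : ∀ a : Q X, (if σ.key ⟨X, a, b⟩ = κ then
      (if a' ⊓ (σ.tr (σ.W k) X ⊔ b) = a then σ.phi mob w E (k + 1) X a' b else 0) else 0)
      = if a' ⊓ (σ.tr (σ.W k) X ⊔ b) = a then
        (if σ.key ⟨X, a, b⟩ = κ then σ.phi mob w E (k + 1) X a' b else 0) else 0 := by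
    intro a; split_ifs <;> rfl
  simp only [this]
  rw [sum_ite_eq, if_pos (mem_univ _), gk, tau_key]
  by_cases hb : b ≤ a'
  · simp only [TT, inf_eq_left.2 hb]
  · simp [phi, hb]

theorem fk_eq_gk (h : MobR mob) (E : I) (k : ℕ) (κ : σ.Kt) (X : I) :
    ∑ p, σ.fk mob w E k κ X p = ∑ p, σ.gk mob w E k κ X p := by
  simp_rw [gk_eq]
  rw [Fintype.sum_prod_type_right, Fintype.sum_prod_type_right]
  refine sum_congr rfl fun b _ => ?_
  rw [sum_comm]
  refine sum_congr rfl fun a _ => ?_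
  simp only [fk]
  split_ifs
  · rw [phi_step h, sum_filter]
  · simp

theorem gk_bound (h : MobR mob) (E : I) (k : ℕ) (κ : σ.Kt) (X : I) :
    ∑ p, |σ.gk mob w E k κ X p| ≤ Fintype.card (Q (σ.kF κ)) *
      ((∑ a ∈ univ.filter (fun a : Q X => σ.cl a = σ.kF κ), (Znum a : ℝ) ^ 3 * |mob X a ⊤|) * |w X|) := by
  have h1 : ∀ p : Q X × Q X, |σ.gk mob w E k κ X p| ≤ ∑ a : Q X, if σ.key ⟨X, a, p.2⟩ = κ then
      (if p.1 ⊓ (σ.tr (σ.W k) X ⊔ p.2) = a then |σ.phi mob w E (k + 1) X p.1 p.2| else 0) else 0 := by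
    intro p
    rw [gk_eq]
    refine (abs_sum_le_sum_abs _ _).trans (sum_le_sum fun a _ => ?_)
    split_ifs <;> simp
  refine (sum_le_sum fun p _ => h1 p).trans ?_
  rw [Fintype.sum_prod_type_right]
  calc _ ≤ ∑ b : Q X, ∑ a : Q X, if σ.cl a = σ.kF κ then
        (if b ≤ a then (Znum a : ℝ) ^ 3 * |mob X a ⊤| * |w X| else 0) else 0 := by
        refine sum_le_sum fun b _ => ?_
        rw [sum_comm]
        refine sum_le_sum fun a _ => ?_
        by_cases hk : σ.key ⟨X, a, b⟩ = κ
        · simp only [hk, if_true]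
          rw [if_pos (by rw [← hk, kF_key])]
          refine le_trans ?_ (phi_bound (σ := σ) h w E k a b)
          rw [sum_filter]
        · simp only [hk, if_false, sum_const_zero]
          split_ifs <;> positivity
    _ = ∑ a ∈ univ.filter (fun a : Q X => σ.cl a = σ.kF κ), ((univ.filter (fun b : Q X => b ≤ a)).card : ℝ) *
        ((Znum a : ℝ) ^ 3 * |mob X a ⊤| * |w X|) := by
        rw [sum_comm, sum_filter]
        refine sum_congr rfl fun a _ => ?_
        split_ifs
        · rw [← sum_filter, sum_const, nsmul_eq_mul]
        · simp
    _ ≤ _ := by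
        rw [sum_mul, mul_sum]
        refine sum_le_sum fun a ha => ?_
        refine mul_le_mul_of_nonneg_right ?_ (by positivity)
        exact_mod_cast card_le _ a (by simpa using ha)

theorem gk_zero (hS : σ.Fm S) (E : I) (k : ℕ) (κ : σ.Kt) (hκ : σ.kF κ ∉ S) {X : I} (hX : X ∈ S) :
    ∑ p, |σ.gk mob w E k κ X p| = 0 := by
  refine sum_eq_zero fun p _ => ?_
  rw [gk, if_neg, abs_zero]
  rintro rfl
  rw [tau_key, kF_key] at hκ
  exact hκ (hS.dc _ hX)

theorem gk_summable (h : MobR mob) (hS : σ.Fm S) (hwb : σ.WB mob w S) (E : I) (k : ℕ) (κ : σ.Kt) :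
    Summable (fun X : S => ∑ p, |σ.gk mob w E k κ X p|) := by
  by_cases hκ : σ.kF κ ∈ S
  · exact Summable.of_nonneg_of_le (fun X => sum_nonneg fun _ _ => abs_nonneg _)
      (fun X => gk_bound h E k κ X) ((hwb _ hκ).mul_left _)
  · simp_rw [fun X : S => gk_zero (mob := mob) (w := w) hS E k κ hκ X.2]
    exact summable_zero

theorem fk_abs (h : MobR mob) (E : I) (k : ℕ) (κ : σ.Kt) (X : I) :
    ∑ p, |σ.fk mob w E k κ X p| ≤ ∑ p, |σ.gk mob w E k κ X p| := by
  have h1 : ∀ p : Q X × Q X, |σ.gk mob w E k κ X p| = ∑ a : Q X, if σ.key ⟨X, a, p.2⟩ = κ then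
      (if p.1 ⊓ (σ.tr (σ.W k) X ⊔ p.2) = a then |σ.phi mob w E (k + 1) X p.1 p.2| else 0) else 0 := by
    intro p
    rw [gk_eq, sum_eq_single (p.1 ⊓ (σ.tr (σ.W k) X ⊔ p.2)), sum_eq_single (p.1 ⊓ (σ.tr (σ.W k) X ⊔ p.2))]
    · split_ifs <;> simp
    · intro b _ hb; simp [hb.symm]
    · simp
    · intro b _ hb; simp [hb.symm]
    · simp
  simp_rw [h1]
  rw [Fintype.sum_prod_type_right, Fintype.sum_prod_type_right]
  refine sum_le_sum fun b _ => ?_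
  rw [sum_comm]
  refine sum_le_sum fun a _ => ?_
  simp only [fk]
  split_ifs
  · rw [phi_step h, ← sum_filter]
    exact abs_sum_le_sum_abs _ _
  · simp

theorem fk_summable (h : MobR mob) (hS : σ.Fm S) (hwb : σ.WB mob w S) (E : I) (k : ℕ) (κ : σ.Kt) :
    Summable (fun X : S => ∑ p, |σ.fk mob w E k κ X p|) :=
  Summable.of_nonneg_of_le (fun X => sum_nonneg fun _ _ => abs_nonneg _)
    (fun X => fk_abs h E k κ X) (gk_summable h hS hwb E k κ)

theorem vk_eq (h : MobR mob) (hS : σ.Fm S) (hwb : σ.WB mob w S) (E : I) (k : ℕ) (κ : σ.Kt) : σ.vk mob w S E k κ = ∑' X : S, ∑ p, σ.fk mob w E k κ X p :=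
  (sumGroup (f := fun ω : Σ X : S, Q (X : I) × Q (X : I) => σ.fk mob w E k κ ω.1 ω.2)
    (fk_summable h hS hwb E k κ)).2

theorem vk_hasSum (h : MobR mob) (hS : σ.Fm S) (hwb : σ.WB mob w S) (E : I) (k : ℕ) (κ : σ.Kt) :
    HasSum (fun κ' => if σ.tau k κ' = κ then σ.vk mob w S E (k + 1) κ' else 0) (σ.vk mob w S E k κ) := by
  obtain ⟨h1, h2⟩ := sumGroup (f := fun ω : Σ X : S, Q (X : I) × Q (X : I) => σ.gk mob w E k κ ω.1 ω.2)
    (gk_summable h hS hwb E k κ)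
  have h3 := h1.hasSum.tsum_fiberwise (fun ω : Σ X : S, Q (X : I) × Q (X : I) => σ.key ⟨ω.1, ω.2⟩)
  rw [h2] at h3
  simp only [← fk_eq_gk h] at h3
  rw [← vk_eq h hS hwb] at h3
  refine Eq.mp (congrArg (fun f => HasSum f (σ.vk mob w S E k κ)) (funext fun κ' => ?_)) h3
  symm
  rw [_root_.tsum_subtype _ (fun ω : Σ X : S, Q (X : I) × Q (X : I) => σ.gk mob w E k κ ω.1 ω.2), vk]
  simp only [Set.indicator_apply, Set.mem_preimage, Set.mem_singleton_iff, gk]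
  split_ifs with hκ
  · refine tsum_congr fun ω => ?_
    split_ifs with h4 h5 h5
    · rfl
    · exact absurd (h4 ▸ hκ) h5
    · rfl
  · symm
    rw [tsum_congr (g := fun _ => (0 : ℝ)), tsum_zero]
    intro ω
    split_ifs with h4 h5
    · exact absurd (h4 ▸ h5) hκ
    · rfl
    · rfl

theorem vk_step (h : MobR mob) (hS : σ.Fm S) (hwb : σ.WB mob w S) (E : I) (k : ℕ) (h0 : ∀ κ, 0 ≤ σ.vk mob w S E (k + 1) κ) :
    (∀ κ, 0 ≤ σ.vk mob w S E k κ) ∧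
    ∑' κ, ENNReal.ofReal (σ.vk mob w S E k κ) = ∑' κ, ENNReal.ofReal (σ.vk mob w S E (k + 1) κ) := by
  have hh := vk_hasSum h hS hwb E k
  have hn : ∀ κ κ', 0 ≤ (if σ.tau k κ' = κ then σ.vk mob w S E (k + 1) κ' else 0) := by
    intro κ κ'; split_ifs
    · exact h0 _
    · exact le_rfl
  refine ⟨fun κ => (hh κ).nonneg (hn κ), ?_⟩
  have h1 : ∀ κ, ENNReal.ofReal (σ.vk mob w S E k κ) =
      ∑' κ', if σ.tau k κ' = κ then ENNReal.ofReal (σ.vk mob w S E (k + 1) κ') else 0 := by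
    intro κ
    rw [← (hh κ).tsum_eq, ENNReal.ofReal_tsum_of_nonneg (hn κ) (hh κ).summable]
    refine tsum_congr fun κ' => ?_
    split_ifs <;> simp
  simp_rw [h1]
  rw [ENNReal.tsum_comm]
  refine tsum_congr fun κ' => ?_
  rw [tsum_ite_eq']

variable (σ) in
/-- number of classes of type `κ` over `F`. -/
noncomputable def nn (E : I) (F : I) (κ : σ.Kt) : ℕ :=
  (univ.filter (fun β : Q F => σ.cl β = E ∧ σ.key ⟨F, ⊤, β⟩ = κ)).card

theorem nn_ne (E F : I) (κ : σ.Kt) (hne : F ≠ σ.kF κ) : σ.nn E F κ = 0 := by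
  rw [nn, card_eq_zero, filter_eq_empty_iff]
  rintro β - ⟨-, rfl⟩
  rw [kF_key, σ.cl_top] at hne
  exact hne rfl

theorem nn_cl (E : I) {X : I} (a : Q X) (κ : σ.Kt) : σ.nn E (σ.cl a) κ =
    (univ.filter (fun b : Q X => b ≤ a ∧ σ.cl b = E ∧ σ.key ⟨X, a, b⟩ = κ)).card := by
  obtain ⟨e, he, hk⟩ := key_cl (σ := σ) a
  refine Finset.card_bij' (fun x _ => e.g x) (fun x _ => e.f x) ?_ ?_ ?_ ?_
  · intro x hx
    simp only [mem_filter, mem_univ, true_and] at hx ⊢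
    have := e.gle x le_top
    refine ⟨this, ?_, ?_⟩
    · rw [← he _ this, e.fg _ le_top, hx.1]
    · rw [hk _ this, e.fg _ le_top, hx.2]
  · intro x hx
    simp only [mem_filter, mem_univ, true_and] at hx ⊢
    exact ⟨by rw [he _ hx.1, hx.2.1], by rw [← hk _ hx.1, hx.2.2]⟩
  · intro x hx; exact e.fg _ le_top
  · intro x hx
    simp only [mem_filter, mem_univ, true_and] at hx
    exact e.gf _ hx.1

theorem fk_top (E : I) {K : ℕ} (hK : S ⊆ σ.W K) (κ : σ.Kt) {X : I} (hX : X ∈ S) :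
    ∑ p, σ.fk mob w E K κ X p = σ.nn E (σ.kF κ) κ *
      ((∑ a ∈ univ.filter (fun a : Q X => σ.cl a = σ.kF κ), mob X a ⊤) * w X) := by
  have htop : σ.tr (σ.W K) X = ⊤ := (tr_eq_top (W_fm K)).2 (hK hX)
  rw [Fintype.sum_prod_type, sum_mul, mul_sum, sum_filter]
  refine sum_congr rfl fun a _ => ?_
  have h1 : ∑ b : Q X, σ.fk mob w E K κ X (a, b) = σ.nn E (σ.cl a) κ * (mob X a ⊤ * w X) := by
    rw [nn_cl, ← nsmul_eq_mul, ← sum_const, sum_filter]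
    refine sum_congr rfl fun b _ => ?_
    simp only [fk, phi, htop, top_sup_eq, and_true, ← ite_and]
    congr 1
    exact propext ⟨fun h => ⟨h.2.1, h.2.2, h.1⟩, fun h => ⟨h.2.2, h.1, h.2.1⟩⟩
  rw [h1]
  split_ifs with hc
  · rw [hc]
  · rw [nn_ne _ _ _ hc]; simp

theorem vk_top (h : MobR mob) (hS : σ.Fm S) (hwb : σ.WB mob w S) (E : I) {K : ℕ} (hK : S ⊆ σ.W K)
    (κ : σ.Kt) : σ.vk mob w S E K κ = σ.nn E (σ.kF κ) κ * σ.vv mob w S (σ.kF κ) := by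
  rw [vk_eq h hS hwb]
  simp_rw [fun X : S => fk_top (mob := mob) (w := w) E hK κ X.2]
  rw [tsum_mul_left, vv]

theorem vv_notMem (hS : σ.Fm S) {F : I} (hF : F ∉ S) : σ.vv mob w S F = 0 := by
  rw [vv, tsum_congr (g := fun _ => (0 : ℝ)), tsum_zero]
  intro X
  rw [filter_eq_empty_iff.2, sum_empty, zero_mul]
  rintro a - rfl
  exact hF (hS.dc a X.2)

theorem s_eq_tsum (E F : I) : (σ.s F E : ℝ≥0∞) = ∑' κ, (σ.nn E F κ : ℝ≥0∞) := by
  have h1 : ∀ κ, (σ.nn E F κ : ℝ≥0∞) = ∑ β ∈ univ.filter (fun β : Q F => σ.cl β = E),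
      if σ.key ⟨F, ⊤, β⟩ = κ then 1 else 0 := by
    intro κ
    rw [← sum_filter, filter_filter, sum_const, nn, nsmul_one]
  simp_rw [h1]
  rw [Summable.tsum_finsetSum (fun _ _ => ENNReal.summable)]
  simp_rw [tsum_ite_eq']
  rw [sum_const, nsmul_one, s]

theorem top_sum (h : MobR mob) (hS : σ.Fm S) (hwb : σ.WB mob w S) (E : I) {K : ℕ} (hK : S ⊆ σ.W K) :
    ∑' κ, ENNReal.ofReal (σ.vk mob w S E K κ) =
      ∑' F : S, (σ.s F E : ℝ≥0∞) * ENNReal.ofReal (σ.vv mob w S F) := by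
  simp_rw [s_eq_tsum, ← ENNReal.tsum_mul_right]
  rw [ENNReal.tsum_comm]
  refine tsum_congr fun κ => ?_
  rw [vk_top h hS hwb E hK, ENNReal.ofReal_mul (Nat.cast_nonneg _), ENNReal.ofReal_natCast]
  by_cases hκ : σ.kF κ ∈ S
  · rw [tsum_eq_single (⟨σ.kF κ, hκ⟩ : S)]
    intro F hF
    rw [nn_ne _ _ _ (fun hh => hF (Subtype.ext hh))]; simp
  · rw [vv_notMem hS hκ]
    rw [tsum_congr (g := fun _ => (0 : ℝ≥0∞)), tsum_zero]
    · simp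
    · intro F
      rw [nn_ne _ _ _ (fun hh => hκ (hh ▸ F.2))]; simp

theorem MobR.diag (h : MobR mob) (X : I) (x : Q X) : mob X x x = 1 := by
  have := h X x x le_rfl
  rw [if_pos rfl, sum_eq_single x] at this
  · exact this
  · intro b hb hne
    simp only [mem_filter, mem_univ, true_and] at hb
    exact absurd (le_antisymm hb.2 hb.1) hne
  · simp

theorem fk_bot (h : MobR mob) (E : I) (κ : σ.Kt) (X : I) :
    ∑ p, σ.fk mob w E 0 κ X p = if X = E then (if σ.key ⟨E, ⊤, ⊤⟩ = κ then w E else 0) else 0 := by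
  have hbot : σ.tr (σ.W 0) X = ⊥ := (cl_mem_W_zero _).1 (tr_mem (W_fm 0) X)
  rw [sum_eq_single ((⊤ : Q X), (⊤ : Q X))]
  · simp only [fk, phi, hbot, σ.cl_top, bot_sup_eq, and_true, le_refl, true_and, h.diag, one_mul]
    by_cases hX : X = E
    · subst hX; simp
    · simp [hX]
  · rintro ⟨a, b⟩ - hne
    simp only [fk, phi, hbot, bot_sup_eq]
    split_ifs with h1 h2
    · obtain ⟨h2, -, h3⟩ := h2
      subst h3
      exact absurd (by rw [top_le_iff.1 h2]) hne
    · rfl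
    · rfl
  · simp

theorem vk_bot (h : MobR mob) (hS : σ.Fm S) (hwb : σ.WB mob w S) {E : I} (hE : E ∈ S) (κ : σ.Kt) :
    σ.vk mob w S E 0 κ = if σ.key ⟨E, ⊤, ⊤⟩ = κ then w E else 0 := by
  rw [vk_eq h hS hwb]
  simp_rw [fk_bot h]
  rw [tsum_eq_single (⟨E, hE⟩ : S)]
  · rw [if_pos rfl]
  · intro F hF
    rw [if_neg (fun hh => hF (Subtype.ext hh))]

/-- (A) -/
theorem moments (h : MobR mob) (hS : σ.Fm S) (hwb : σ.WB mob w S) {K : ℕ} (hK : S ⊆ σ.W K)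
    (hv : ∀ F ∈ S, 0 ≤ σ.vv mob w S F) {E : I} (hE : E ∈ S) :
    0 ≤ w E ∧ ∑' F : S, (σ.s F E : ℝ≥0∞) * ENNReal.ofReal (σ.vv mob w S F) = ENNReal.ofReal (w E) := by
  have hv' : ∀ F, 0 ≤ σ.vv mob w S F := fun F => by
    by_cases hF : F ∈ S
    · exact hv F hF
    · rw [vv_notMem hS hF]
  have h0 : ∀ j, j ≤ K → (∀ κ, 0 ≤ σ.vk mob w S E (K - j) κ) ∧
      ∑' κ, ENNReal.ofReal (σ.vk mob w S E (K - j) κ) = ∑' κ, ENNReal.ofReal (σ.vk mob w S E K κ) := by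
    intro j
    induction j with
    | zero =>
      intro _
      refine ⟨fun κ => ?_, rfl⟩
      rw [Nat.sub_zero, vk_top h hS hwb E hK]
      exact mul_nonneg (Nat.cast_nonneg _) (hv' _)
    | succ j ih =>
      intro hj
      have ih := ih (by omega)
      have e : K - j = K - (j + 1) + 1 := by omega
      rw [e] at ih
      have := vk_step h hS hwb E (K - (j + 1)) ih.1
      exact ⟨this.1, this.2.trans ih.2⟩
  have h1 := h0 K le_rfl
  rw [Nat.sub_self] at h1
  have hb := vk_bot h hS hwb hE
  constructor
  · have := h1.1 (σ.key ⟨E, ⊤, ⊤⟩)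
    rwa [hb, if_pos rfl] at this
  · rw [← top_sum h hS hwb E hK, ← h1.2]
    simp_rw [hb]
    rw [tsum_eq_single (σ.key ⟨E, ⊤, ⊤⟩)]
    · rw [if_pos rfl]
    · intro κ hκ
      rw [if_neg hκ.symm, ENNReal.ofReal_zero]

theorem s_trI {S : Set I} (hS : σ.Fm S) (X : I) {E : I} (hE : E ∈ S) : σ.s (σ.trI S X) E = σ.s X E := by
  unfold trI s
  obtain ⟨e, he⟩ := σ.pi (σ.tr S X)
  refine Finset.card_bij' (fun x _ => e.g x) (fun x _ => e.f x) ?_ ?_ ?_ ?_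
  · intro x hx
    simp only [mem_filter, mem_univ, true_and] at hx ⊢
    rw [← he _ (e.gle x le_top), e.fg _ le_top, hx]
  · intro x hx
    simp only [mem_filter, mem_univ, true_and] at hx ⊢
    rw [he _ (le_tr (hx ▸ hE)), hx]
  · intro x hx; exact e.fg _ le_top
  · intro x hx
    simp only [mem_filter, mem_univ, true_and] at hx
    exact e.gf _ (le_tr (hx ▸ hE))

/-- (B) -/
theorem consist (h : MobR mob) {S' : Set I} (hS : σ.Fm S) (hS' : σ.Fm S') (hwb : σ.WB mob w S)
    (hwb' : σ.WB mob w S') {K : ℕ} (hK : S' ⊆ σ.W K)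
    (hv' : ∀ F ∈ S', 0 ≤ σ.vv mob w S' F) (hsub : S ⊆ S') {F : I} (hF : F ∈ S) :
    ∑' G : S', (if σ.trI S G = F then ENNReal.ofReal (σ.vv mob w S' G) else 0) =
      ENNReal.ofReal (σ.vv mob w S F) := by
  have hA := fun {E} hE => moments h hS' hwb' hK hv' (E := E) hE
  have hν : ∀ E ∈ S, ∑' F : S, (σ.s F E : ℝ≥0∞) * (∑' G : S',
    (if σ.trI S G = F then ENNReal.ofReal (σ.vv mob w S' G) else 0)) = ENNReal.ofReal (w E) := by
    intro E hE
    rw [← (hA (hsub hE)).2]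
    simp_rw [← ENNReal.tsum_mul_left]
    rw [ENNReal.tsum_comm]
    refine tsum_congr fun G => ?_
    rw [tsum_eq_single (⟨σ.trI S G, tr_mem hS G⟩ : S)]
    · simp only [if_true, s_trI hS (G : I) hE]
    · intro F hF
      rw [if_neg (fun hh => hF (Subtype.ext hh.symm)), mul_zero]
  obtain ⟨h1, h2⟩ := uniq (ν := fun F => ∑' G : S',
    (if σ.trI S G = F then ENNReal.ofReal (σ.vv mob w S' G) else 0)) h hS
    (fun E hE => (hA (hsub hE)).1) hν hF (hwb.weak hF)
  rw [h2, ENNReal.ofReal_toReal h1]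

end main
end MSys
end MomentAux

namespace MomentAux
universe v
variable {I : Type v} {Q : I → Type v} [∀ X, Lattice (Q X)] [∀ X, BoundedOrder (Q X)]
  [∀ X, Fintype (Q X)] [∀ X, IsModularLattice (Q X)]

namespace MSys
variable (σ : MSys I Q)

/-- system of levels with its space of threads -/
structure Lev (L : Set (Set I)) (Ω : Type*) (c : L → Ω → I) : Prop where
  fm : ∀ S : L, σ.Fm S.1
  nar : ∀ S : L, σ.Nar S.1
  loewy : ∀ S : L, ∃ K, S.1 ⊆ σ.W K
  cnt : ∀ S : L, S.1.Countable
  dir : ∀ S S' : L, ∃ T : L, S.1 ⊆ T.1 ∧ S'.1 ⊆ T.1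
  ne : Nonempty L
  mem : ∀ S ω, c S ω ∈ S.1
  compat : ∀ (S S' : L) ω, S.1 ⊆ S'.1 → σ.trI S.1 (c S' ω) = c S ω
  real : ∀ x : L → I, (∀ S, x S ∈ S.1) → (∀ S S' : L, S.1 ⊆ S'.1 → σ.trI S.1 (x S') = x S) →
    ∃ ω, ∀ S, c S ω = x S

variable {σ}
variable {L : Set (Set I)} {Ω : Type*} {c : L → Ω → I}

/-- threads along a chain extend -/
theorem Lev.extend (H : σ.Lev L Ω c) {T : ℕ → L} (hT : Monotone (fun n => (T n).1)) {G : ℕ → I}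
    (hG : ∀ n, G n ∈ (T n).1) (hth : ∀ n, σ.trI (T n).1 (G (n + 1)) = G n) :
    ∃ ω, ∀ n, c (T n) ω = G n := by
  have hth' : ∀ m n, m ≤ n → σ.trI (T m).1 (G n) = G m := by
    intro m n hmn
    induction n, hmn using Nat.le_induction with
    | base => exact trI_eq (H.fm _) (hG m)
    | succ n hn ih =>
      rw [← ih, ← hth n, trI_trI (H.fm _) (H.fm _) (hT hn)]
  have hst : ∀ S : L, ∃ N, ∀ n, N ≤ n → σ.trI S.1 (G n) = σ.trI S.1 (G N) := by
    intro S
    obtain ⟨K, hK⟩ := H.loewy S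
    exact stab (fun n => H.fm (T n)) hT hG hth' (H.fm S) (H.nar S) hK
  choose N hN using hst
  obtain ⟨ω, hω⟩ := H.real (fun S => σ.trI S.1 (G (N S))) (fun S => tr_mem (H.fm S) _) (by
    intro S S' hSS
    show σ.trI S.1 (σ.trI S'.1 (G (N S'))) = σ.trI S.1 (G (N S))
    rw [← hN S' (max (N S) (N S')) (le_max_right _ _), ← hN S (max (N S) (N S')) (le_max_left _ _),
      trI_trI (H.fm _) (H.fm _) hSS])
  refine ⟨ω, fun n => ?_⟩
  rw [hω, ← hN (T n) (max (N (T n)) n) (le_max_left _ _), hth' _ _ (le_max_right _ _)]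

/-- mass of a set at a level -/
noncomputable def mass (ms : L → I → ℝ≥0∞) (S : L) (A : Set I) : ℝ≥0∞ :=
  ∑' G, if G ∈ A then ms S G else 0

theorem mass_mono {ms : L → I → ℝ≥0∞} {S : L} {A B : Set I} (h : A ⊆ B) : mass ms S A ≤ mass ms S B := by
  refine ENNReal.tsum_le_tsum fun G => ?_
  split_ifs with h1 h2
  · exact le_rfl
  · exact absurd (h h1) h2
  · exact zero_le
  · exact le_rfl

theorem mass_singleton {ms : L → I → ℝ≥0∞} {S : L} (F : I) : mass ms S {F} = ms S F := by
  rw [mass, tsum_eq_single F]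
  · simp
  · intro G hG; simp [hG]

theorem mass_part {ms : L → I → ℝ≥0∞} {S : L} (A : Set I) (t : I → I) :
    mass ms S A = ∑' F, mass ms S {G | G ∈ A ∧ t G = F} := by
  simp only [mass]
  rw [ENNReal.tsum_comm]
  refine tsum_congr fun G => ?_
  rw [tsum_eq_single (t G)]
  · simp
  · intro F hF; simp [hF.symm]

/-- consistent masses -/
structure Cons (σ : MSys I Q) (ms : L → I → ℝ≥0∞) : Prop where
  off : ∀ (S : L) F, F ∉ S.1 → ms S F = 0
  fin : ∀ (S : L) F, ms S F ≠ ⊤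
  cons : ∀ (S S' : L) F, S.1 ⊆ S'.1 → ∑' G, (if σ.trI S.1 G = F then ms S' G else 0) = ms S F

theorem Cons.mass {ms : L → I → ℝ≥0∞} (h : Cons σ ms) {S S' : L} (hs : S.1 ⊆ S'.1) (A : Set I) :
    mass ms S' {G | σ.trI S.1 G ∈ A} = mass ms S A := by
  rw [mass_part _ (σ.trI S.1), MSys.mass]
  refine tsum_congr fun F => ?_
  split_ifs with hF
  · rw [← h.cons S S' F hs, MSys.mass]
    refine tsum_congr fun G => ?_
    congr 1
    exact propext ⟨fun h => h.2, fun h => ⟨by rw [Set.mem_setOf_eq, h]; exact hF, h⟩⟩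
  · rw [MSys.mass, tsum_congr (g := fun _ => (0 : ℝ≥0∞)), tsum_zero]
    intro G
    rw [if_neg]
    rintro ⟨h1, h2⟩
    exact hF (h2 ▸ h1)

/-- countable subadditivity -/
theorem Lev.sub (H : σ.Lev L Ω c) {ms : L → I → ℝ≥0∞} (h : Cons σ ms) (S : L) (F : I)
    (Sj : ℕ → L) (A : ℕ → Set I) (hcov : ∀ ω, c S ω = F → ∃ j, c (Sj j) ω ∈ A j) :
    ms S F ≤ ∑' j, MSys.mass ms (Sj j) (A j) := by
  by_contra hlt
  push Not at hlt
  choose D hD1 hD2 using H.dir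
  let T : ℕ → L := fun n => Nat.rec S (fun n t => D t (Sj n)) n
  have hT0 : T 0 = S := rfl
  have hT1 : ∀ n, (T n).1 ⊆ (T (n + 1)).1 := fun n => hD1 _ _
  have hTS : ∀ n, (Sj n).1 ⊆ (T (n + 1)).1 := fun n => hD2 _ _
  have hT : Monotone (fun n => (T n).1) := monotone_nat_of_le_succ hT1
  let cost : ℕ → I → ℝ≥0∞ := fun n G =>
    ∑' j, MSys.mass ms (T (n + j + 1)) {G' | σ.trI (Sj j).1 G' ∈ A j ∧ σ.trI (T n).1 G' = G}
  have hstart : cost 0 F < ms (T 0) F := by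
    refine lt_of_le_of_lt (ENNReal.tsum_le_tsum fun j => ?_) hlt
    have hs : (Sj j).1 ⊆ (T (0 + j + 1)).1 := by rw [zero_add]; exact hTS j
    rw [← h.mass (S := Sj j) (S' := T (0 + j + 1)) hs (A j)]
    exact mass_mono fun G hG => hG.1
  have hstep : ∀ n G, cost n G < ms (T n) G →
      ∃ G', σ.trI (T n).1 G' = G ∧ cost (n + 1) G' < ms (T (n + 1)) G' := by
    intro n G hlt
    by_contra hno
    push Not at hno
    refine absurd hlt (not_lt.2 ?_)
    rw [← h.cons (T n) (T (n + 1)) G (hT1 n)]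
    have e1 : cost n G = ∑' G', if σ.trI (T n).1 G' = G then cost (n + 1) G' else 0 := by
      have e2 : ∀ j, MSys.mass ms (T (n + j + 1)) {G' | σ.trI (Sj j).1 G' ∈ A j ∧ σ.trI (T n).1 G' = G}
          = ∑' G', if σ.trI (T n).1 G' = G then MSys.mass ms (T (n + 1 + j + 1))
            {G'' | σ.trI (Sj j).1 G'' ∈ A j ∧ σ.trI (T (n + 1)).1 G'' = G'} else 0 := by
        intro j
        have hs : (T (n + j + 1)).1 ⊆ (T (n + 1 + j + 1)).1 := hT (show n + j + 1 ≤ n + 1 + j + 1 by omega)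
        rw [← h.mass hs, mass_part _ (σ.trI (T (n + 1)).1)]
        refine tsum_congr fun G' => ?_
        have hset : ∀ G'', (σ.trI (Sj j).1 (σ.trI (T (n + j + 1)).1 G'') = σ.trI (Sj j).1 G'')
            ∧ (σ.trI (T n).1 (σ.trI (T (n + j + 1)).1 G'') = σ.trI (T n).1 (σ.trI (T (n + 1)).1 G'')) := by
          intro G''
          rw [trI_trI (H.fm _) (H.fm _) ((hTS j).trans (hT (show j + 1 ≤ n + j + 1 by omega))),
            trI_trI (H.fm _) (H.fm _) (hT (show n ≤ n + j + 1 by omega)), trI_trI (H.fm _) (H.fm _) (hT (show n ≤ n + 1 by omega))]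
          exact ⟨rfl, rfl⟩
        split_ifs with hG'
        · congr 1
          ext G''
          simp only [Set.mem_setOf_eq, (hset G'').1, (hset G'').2]
          exact ⟨fun h => ⟨h.1.1, h.2⟩, fun h => ⟨⟨h.1, by rw [h.2, hG']⟩, h.2⟩⟩
        · rw [MSys.mass, tsum_congr (g := fun _ => (0 : ℝ≥0∞)), tsum_zero]
          intro G''
          rw [if_neg]
          simp only [Set.mem_setOf_eq, (hset G'').1, (hset G'').2]
          rintro ⟨⟨-, h1⟩, h2⟩
          exact hG' (h2 ▸ h1)
      simp only [cost]
      simp_rw [e2]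
      rw [ENNReal.tsum_comm]
      refine tsum_congr fun G' => ?_
      split_ifs <;> simp
    rw [e1]
    refine ENNReal.tsum_le_tsum fun G' => ?_
    split_ifs with hG'
    · exact hno G' hG'
    · exact le_rfl
  choose! nx hnx1 hnx2 using hstep
  let G : ℕ → I := fun n => Nat.rec F (fun n g => nx n g) n
  have hG : ∀ n, cost n (G n) < ms (T n) (G n) := by
    intro n
    induction n with
    | zero => exact hstart
    | succ n ih => exact hnx2 n (G n) ih
  have hGth : ∀ n, σ.trI (T n).1 (G (n + 1)) = G n := fun n => hnx1 n (G n) (hG n)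
  have hGm : ∀ n, G n ∈ (T n).1 := by
    intro n
    by_contra hn
    have := hG n
    rw [h.off _ _ hn] at this
    exact not_lt_zero this
  obtain ⟨ω, hω⟩ := H.extend hT hGm hGth
  obtain ⟨j, hj⟩ := hcov ω (hω 0)
  rw [← H.compat (Sj j) (T (j + 1)) ω (hTS j), show c (T (j + 1)) ω = G (j + 1) from hω (j + 1)] at hj
  refine absurd (hG (j + 1)) (not_lt.2 ?_)
  refine le_trans ?_ (ENNReal.le_tsum j)
  have hs : (T (j + 1)).1 ⊆ (T (j + 1 + j + 1)).1 := hT (show j + 1 ≤ j + 1 + j + 1 by omega)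
  rw [← mass_singleton (ms := ms), ← h.mass hs]
  refine mass_mono fun G' hG' => ?_
  have hG2 : σ.trI (T (j + 1)).1 G' = G (j + 1) := hG'
  refine ⟨?_, hG2⟩
  rw [← trI_trI (H.fm _) (H.fm _) (hTS j), hG2]
  exact hj

/-- premeasure -/
noncomputable def pre (c : L → Ω → I) (ms : L → I → ℝ≥0∞) (t : Set Ω) : ℝ≥0∞ :=
  ⨅ p : {p : L × Set I // ∀ ω ∈ t, c p.1 ω ∈ p.2}, MSys.mass ms p.1.1 p.1.2

theorem pre_le {ms : L → I → ℝ≥0∞} {t : Set Ω} (S : L) (A : Set I) (h : ∀ ω ∈ t, c S ω ∈ A) :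
    pre c ms t ≤ MSys.mass ms S A :=
  iInf_le (fun p : {p : L × Set I // ∀ ω ∈ t, c p.1 ω ∈ p.2} => MSys.mass ms p.1.1 p.1.2) ⟨(S, A), h⟩

theorem Lev.exists_measure (H : σ.Lev L Ω c) {ms : L → I → ℝ≥0∞} (h : Cons σ ms) [m0 : MeasurableSpace Ω]
    (hgen : m0 = MeasurableSpace.generateFrom {U | ∃ S : L, ∃ F ∈ S.1, U = {ω | c S ω = F}}) :
    ∃ ν : Measure Ω, ∀ S : L, ∀ F ∈ S.1, ν {ω | c S ω = F} = ms S F := by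
  have hpe : pre c ms ∅ = 0 := by
    obtain ⟨S⟩ := H.ne
    refine le_antisymm ((pre_le S ∅ (by simp)).trans ?_) zero_le
    simp [MSys.mass]
  let μ : OuterMeasure Ω := OuterMeasure.ofFunction (pre c ms) hpe
  have hcar : m0 ≤ μ.caratheodory := by
    rw [hgen]
    refine MeasurableSpace.generateFrom_le ?_
    rintro _ ⟨S, F, hF, rfl⟩
    refine OuterMeasure.ofFunction_caratheodory fun t => ?_
    conv_rhs => rw [pre]
    refine le_iInf ?_
    rintro ⟨⟨S', A⟩, hA⟩
    simp only at hA ⊢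
    obtain ⟨D, hD1, hD2⟩ := H.dir S S'
    rw [← h.mass hD2]
    refine (add_le_add (pre_le D {G | σ.trI S'.1 G ∈ A ∧ σ.trI S.1 G = F} ?_)
      (pre_le D {G | σ.trI S'.1 G ∈ A ∧ σ.trI S.1 G ≠ F} ?_)).trans ?_
    · rintro ω ⟨h1, h2⟩
      refine ⟨?_, ?_⟩
      · rw [H.compat _ _ _ hD2]; exact hA ω h1
      · rw [H.compat _ _ _ hD1]; exact h2
    · rintro ω ⟨h1, h2⟩
      refine ⟨?_, ?_⟩
      · rw [H.compat _ _ _ hD2]; exact hA ω h1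
      · rw [H.compat _ _ _ hD1]; exact h2
    · simp only [MSys.mass]
      rw [← ENNReal.tsum_add]
      refine ENNReal.tsum_le_tsum fun G => ?_
      simp only [Set.mem_setOf_eq]
      by_cases h1 : σ.trI S'.1 G ∈ A <;> by_cases h2 : σ.trI S.1 G = F <;> simp [h1, h2]
  refine ⟨μ.toMeasure hcar, fun S F hF => ?_⟩
  have hms : MeasurableSet {ω | c S ω = F} := by
    rw [hgen]
    exact MeasurableSpace.measurableSet_generateFrom ⟨S, F, hF, rfl⟩
  rw [toMeasure_apply _ _ hms]
  refine le_antisymm ?_ ?_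
  · refine (OuterMeasure.ofFunction_le _).trans ?_
    rw [← mass_singleton (ms := ms)]
    exact pre_le S {F} (fun ω hω => hω)
  · rw [OuterMeasure.ofFunction_apply]
    refine le_iInf₂ fun t ht => ?_
    by_contra hlt
    push Not at hlt
    obtain ⟨r, hr, hlt⟩ := ENNReal.lt_iff_exists_add_pos_lt.1 hlt
    obtain ⟨ε, hε, hεr⟩ := ENNReal.exists_pos_sum_of_countable' (ε := (r : ℝ≥0∞))
      (by exact_mod_cast hr.ne') ℕ
    have hch : ∀ n, ∃ p : L × Set I, (∀ ω ∈ t n, c p.1 ω ∈ p.2) ∧ MSys.mass ms p.1 p.2 ≤ pre c ms (t n) + ε n := by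
      intro n
      have hfin : pre c ms (t n) ≠ ⊤ := by
        intro htop
        have := ENNReal.le_tsum (f := fun n => pre c ms (t n)) n
        rw [htop, top_le_iff] at this
        rw [this] at hlt
        simp at hlt
      have : pre c ms (t n) < pre c ms (t n) + ε n := ENNReal.lt_add_right hfin (hε n).ne'
      conv_lhs at this => rw [pre]
      obtain ⟨p, hp⟩ := iInf_lt_iff.1 this
      exact ⟨p.1, p.2, hp.le⟩
    choose p hp1 hp2 using hch
    have := H.sub h S F (fun n => (p n).1) (fun n => (p n).2) (by
      intro ω hω
      obtain ⟨n, hn⟩ := Set.mem_iUnion.1 (ht hω)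
      exact ⟨n, hp1 n ω hn⟩)
    refine absurd (this.trans (ENNReal.tsum_le_tsum hp2)) (not_le.2 ?_)
    rw [ENNReal.tsum_add]
    exact lt_of_le_of_lt (add_le_add le_rfl hεr.le) hlt

section meas
variable [m0 : MeasurableSpace Ω]

theorem Lev.meas (H : σ.Lev L Ω c)
    (hgen : m0 = MeasurableSpace.generateFrom {U | ∃ S : L, ∃ F ∈ S.1, U = {ω | c S ω = F}})
    (S : L) (A : Set I) : MeasurableSet {ω | c S ω ∈ A} := by
  have : {ω | c S ω ∈ A} = ⋃ F ∈ S.1 ∩ A, {ω | c S ω = F} := by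
    ext ω
    simp only [Set.mem_setOf_eq, Set.mem_iUnion, exists_prop, exists_eq_right']
    exact ⟨fun h => ⟨H.mem S ω, h⟩, fun h => h.2⟩
  rw [this]
  refine MeasurableSet.biUnion ((H.cnt S).mono Set.inter_subset_left) fun F hF => ?_
  rw [hgen]
  exact MeasurableSpace.measurableSet_generateFrom ⟨S, F, hF.1, rfl⟩

theorem Lev.lintegral (H : σ.Lev L Ω c)
    (hgen : m0 = MeasurableSpace.generateFrom {U | ∃ S : L, ∃ F ∈ S.1, U = {ω | c S ω = F}})
    (ν : Measure Ω) (S : L) (f : I → ℝ≥0∞) :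
    ∫⁻ ω, f (c S ω) ∂ν = ∑' F : S.1, f F * ν {ω | c S ω = F} := by
  haveI : Countable S.1 := (H.cnt S).to_subtype
  have hm : ∀ F : I, MeasurableSet {ω | c S ω = F} := fun F => H.meas hgen S {F}
  have h1 : ∀ ω, f (c S ω) = ∑' F : S.1, ({ω | c S ω = F} : Set Ω).indicator (fun _ => f F) ω := by
    intro ω
    rw [tsum_eq_single (⟨c S ω, H.mem S ω⟩ : S.1)]
    · simp
    · intro F hF
      rw [Set.indicator_of_notMem]
      exact fun hh => hF (Subtype.ext hh.symm)
  simp_rw [h1]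
  rw [lintegral_tsum (fun F : S.1 => (measurable_const.indicator (hm F)).aemeasurable)]
  refine tsum_congr fun F => ?_
  rw [lintegral_indicator_const (hm F)]

theorem Lev.ext (H : σ.Lev L Ω c)
    (hgen : m0 = MeasurableSpace.generateFrom {U | ∃ S : L, ∃ F ∈ S.1, U = {ω | c S ω = F}})
    (ν ν' : Measure Ω) (hfin : ∀ S : L, ∀ F ∈ S.1, ν {ω | c S ω = F} ≠ ⊤)
    (heq : ∀ S : L, ∀ F ∈ S.1, ν {ω | c S ω = F} = ν' {ω | c S ω = F}) : ν = ν' := by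
  obtain ⟨S₀⟩ := H.ne
  refine Measure.ext_of_generateFrom_of_cover_subset
    (S := {U | ∃ S : L, ∃ A : Set I, U = {ω | c S ω ∈ A}})
    (T := (fun F => {ω | c S₀ ω = F}) '' S₀.1) ?_ ?_ ?_ ((H.cnt S₀).image _) ?_ ?_ ?_
  · refine le_antisymm ?_ (MeasurableSpace.generateFrom_le ?_)
    · conv_lhs => rw [hgen]
      refine MeasurableSpace.generateFrom_mono ?_
      rintro _ ⟨S, F, hF, rfl⟩
      exact ⟨S, {F}, rfl⟩
    · rintro _ ⟨S, A, rfl⟩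
      exact H.meas hgen S A
  · rintro _ ⟨S, A, rfl⟩ _ ⟨S', A', rfl⟩ -
    obtain ⟨D, h1, h2⟩ := H.dir S S'
    refine ⟨D, {G | σ.trI S.1 G ∈ A ∧ σ.trI S'.1 G ∈ A'}, ?_⟩
    ext ω
    simp only [Set.mem_inter_iff, Set.mem_setOf_eq, H.compat _ _ _ h1, H.compat _ _ _ h2]
  · rintro _ ⟨F, hF, rfl⟩
    exact ⟨S₀, {F}, rfl⟩
  · refine Set.eq_univ_of_forall fun ω => ?_
    exact ⟨_, ⟨c S₀ ω, H.mem S₀ ω, rfl⟩, rfl⟩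
  · rintro _ ⟨F, hF, rfl⟩
    exact hfin S₀ F hF
  · rintro _ ⟨S, A, rfl⟩
    have h1 : ∀ κ : Measure Ω, κ {ω | c S ω ∈ A} = ∫⁻ ω, A.indicator 1 (c S ω) ∂κ := by
      intro κ
      rw [← lintegral_indicator_one (H.meas hgen S A)]
      rfl
    rw [h1, h1, H.lintegral hgen, H.lintegral hgen]
    refine tsum_congr fun F => ?_
    rw [heq S F F.2]

variable {mob : ∀ X : I, Q X → Q X → ℝ} {w : I → ℝ}

/-- The abstract theorem. -/
theorem Lev.main (H : σ.Lev L Ω c)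
    (hgen : m0 = MeasurableSpace.generateFrom {U | ∃ S : L, ∃ F ∈ S.1, U = {ω | c S ω = F}})
    (h : MobR mob) (hwb : ∀ S : L, σ.WB mob w S.1) (lv : I → L) (hlv : ∀ E, E ∈ (lv E).1)
    (hlv' : ∀ E (S : L), E ∈ S.1 → (lv E).1 ⊆ S.1) (HM : Measure Ω → Prop)
    (hHM : ∀ ν, HM ν ↔ ∀ E, 0 ≤ w E ∧ ∫⁻ ω, (σ.s (c (lv E) ω) E : ℝ≥0∞) ∂ν = ENNReal.ofReal (w E)) :
    ((∃ ν, HM ν) ↔ ∀ S : L, ∀ F ∈ S.1, 0 ≤ σ.vv mob w S.1 F) ∧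
    ∀ ν, HM ν → (∀ ν', HM ν' → ν = ν') ∧
      ∀ S : L, ∀ F ∈ S.1, ν {ω | c S ω = F} = ENNReal.ofReal (σ.vv mob w S.1 F) := by
  have hmom : ∀ (ν : Measure Ω) (S : L) (E : I), E ∈ S.1 →
      ∫⁻ ω, (σ.s (c (lv E) ω) E : ℝ≥0∞) ∂ν = ∑' F : S.1, (σ.s F E : ℝ≥0∞) * ν {ω | c S ω = F} := by
    intro ν S E hE
    rw [← H.lintegral hgen ν S (fun F => (σ.s F E : ℝ≥0∞))]
    refine lintegral_congr fun ω => ?_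
    rw [← H.compat (lv E) S ω (hlv' E S hE), s_trI (H.fm _) _ (hlv E)]
  have hval : ∀ ν, HM ν → ∀ S : L, ∀ F ∈ S.1, ν {ω | c S ω = F} ≠ ⊤ ∧
      σ.vv mob w S.1 F = (ν {ω | c S ω = F}).toReal := by
    intro ν hν S F hF
    rw [hHM] at hν
    refine uniq (ν := fun F => ν {ω | c S ω = F}) h (H.fm S) (fun E _ => (hν E).1) ?_ hF ((hwb S).weak hF)
    intro E hE
    rw [← hmom ν S E hE, (hν E).2]
  have hval2 : ∀ ν, HM ν → ∀ S : L, ∀ F ∈ S.1,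
      ν {ω | c S ω = F} = ENNReal.ofReal (σ.vv mob w S.1 F) := by
    intro ν hν S F hF
    obtain ⟨h1, h2⟩ := hval ν hν S F hF
    rw [h2, ENNReal.ofReal_toReal h1]
  refine ⟨⟨?_, ?_⟩, fun ν hν => ⟨fun ν' hν' => ?_, hval2 ν hν⟩⟩
  · rintro ⟨ν, hν⟩ S F hF
    rw [(hval ν hν S F hF).2]
    exact ENNReal.toReal_nonneg
  · intro hv
    have hcons : Cons σ (fun (S : L) F => ENNReal.ofReal (σ.vv mob w S.1 F)) := by
      refine ⟨fun S F hF => by rw [vv_notMem (H.fm S) hF, ENNReal.ofReal_zero],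
        fun S F => ENNReal.ofReal_ne_top, fun S S' F hs => ?_⟩
      by_cases hF : F ∈ S.1
      · obtain ⟨K, hK⟩ := H.loewy S'
        rw [← consist h (H.fm S) (H.fm S') (hwb S) (hwb S') hK (hv S') hs hF]
        symm
        refine tsum_subtype_eq_of_support_subset
          (f := fun G => if σ.trI S.1 G = F then ENNReal.ofReal (σ.vv mob w S'.1 G) else 0) ?_
        intro G hG
        by_contra hn
        apply hG
        simp only [vv_notMem (H.fm S') hn, ENNReal.ofReal_zero, ite_self]
      · rw [vv_notMem (H.fm S) hF, ENNReal.ofReal_zero, tsum_congr (g := fun _ => (0 : ℝ≥0∞)), tsum_zero]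
        intro G
        rw [if_neg]
        rintro rfl
        exact hF (tr_mem (H.fm S) G)
    obtain ⟨ν, hν⟩ := H.exists_measure hcons hgen
    refine ⟨ν, (hHM ν).2 fun E => ?_⟩
    obtain ⟨K, hK⟩ := H.loewy (lv E)
    obtain ⟨h1, h2⟩ := moments h (H.fm (lv E)) (hwb _) hK (hv _) (hlv E)
    refine ⟨h1, ?_⟩
    rw [hmom ν (lv E) E (hlv E), ← h2]
    refine tsum_congr fun F => ?_
    rw [hν _ F F.2]
  · exact H.ext hgen ν ν' (fun S F hF => (hval ν hν S F hF).1)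
      (fun S F hF => by rw [hval2 ν hν S F hF, hval2 ν' hν' S F hF])

end meas
end MSys
end MomentAux

namespace MomentAux
open MomentCat

section cat
variable {C : Type u} [SmallCategory C]

theorem qSup_isLUB (hC : IsDiamond C) {G : C} (a b : Quotients G) : IsLUB {a, b} (qSup a b) := by
  unfold qSup
  rw [dif_pos (hC.lub G a b)]
  exact (hC.lub G a b).choose_spec

theorem qInf_isGLB (hC : IsDiamond C) {G : C} (a b : Quotients G) : IsGLB {a, b} (qInf a b) := by
  unfold qInf
  rw [dif_pos (hC.glb G a b)]
  exact (hC.glb G a b).choose_spec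

noncomputable instance instLat [hC : Fact (IsDiamond C)] (G : C) : Lattice (Quotients G) :=
  { (inferInstance : PartialOrder (Quotients G)) with
    sup := qSup
    inf := qInf
    le_sup_left := fun a b => (qSup_isLUB hC.out a b).1 (by simp)
    le_sup_right := fun a b => (qSup_isLUB hC.out a b).1 (by simp)
    sup_le := fun a b c h1 h2 => (qSup_isLUB hC.out a b).2 (by
      rintro x (rfl | rfl)
      · exact h1
      · exact h2)
    inf_le_left := fun a b => (qInf_isGLB hC.out a b).1 (by simp)
    inf_le_right := fun a b => (qInf_isGLB hC.out a b).1 (by simp)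
    le_inf := fun a b c h1 h2 => (qInf_isGLB hC.out b c).2 (by
      rintro x (rfl | rfl)
      · exact h1
      · exact h2) }

noncomputable instance instFin [hC : Fact (IsDiamond C)] (G : C) : Fintype (Quotients G) :=
  haveI := hC.out.quotFinite G
  Fintype.ofFinite _

noncomputable instance instBdd [hC : Fact (IsDiamond C)] (G : C) : BoundedOrder (Quotients G) :=
  { (inferInstance : OrderTop (Quotients G)) with
    bot := Finset.univ.inf' ⟨⊤, Finset.mem_univ _⟩ id
    bot_le := fun a => Finset.inf'_le (f := id) (Finset.mem_univ a) }

instance instMod [hC : Fact (IsDiamond C)] (G : C) : IsModularLattice (Quotients G) where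
  sup_inf_le_assoc_of_le := fun {x} y {z} h => (hC.out.modular G x z y h).symm.le


/-- structure map -/
noncomputable def qMap {G : C} (a : Quotients G) : G ⟶ qObj a := a.arrow.unop

theorem qMap_epi {G : C} (a : Quotients G) : Epi (qMap a) := by
  exact unop_epi_of_mono a.arrow

theorem quotOf_qMap {G : C} (a : Quotients G) : quotOf (qMap a) (qMap_epi a) = a :=
  Subobject.mk_arrow a

theorem quotOf_le {G F F' : C} {π : G ⟶ F} {ρ : G ⟶ F'} {h : Epi π} {h' : Epi ρ} :
    quotOf π h ≤ quotOf ρ h' ↔ ∃ k : F' ⟶ F, ρ ≫ k = π := by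
  haveI := h
  haveI := h'
  constructor
  · intro hle
    refine ⟨(Subobject.ofMkLEMk π.op ρ.op hle).unop, ?_⟩
    apply Quiver.Hom.op_inj
    exact Subobject.ofMkLEMk_comp hle
  · rintro ⟨k, hk⟩
    exact Subobject.mk_le_mk_of_comm k.op (by rw [← op_comp, hk])

theorem quotOf_comp_iso {G F F' : C} {π : G ⟶ F} (h : Epi π) (e : F ≅ F') (h' : Epi (π ≫ e.hom)) :
    quotOf (π ≫ e.hom) h' = quotOf π h := by
  refine le_antisymm (quotOf_le.2 ⟨e.hom, rfl⟩) (quotOf_le.2 ⟨e.inv, by simp⟩)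

theorem qObj_quotOf {G F : C} (π : G ⟶ F) (h : Epi π) : Nonempty (qObj (quotOf π h) ≅ F) := by
  haveI := h
  exact ⟨(Subobject.underlyingIso π.op).symm.unop⟩

theorem cls_eq {G F : C} : cls G = cls F ↔ Nonempty (G ≅ F) := Quotient.eq (r := isIsomorphicSetoid C)

theorem cls_out (X : IsoCls C) : cls X.out = X := Quotient.out_eq X

theorem out_iso (G : C) : Nonempty ((cls G).out ≅ G) := cls_eq.1 (cls_out _)

theorem cls_quotOf {G F : C} (π : G ⟶ F) (h : Epi π) : cls (qObj (quotOf π h)) = cls F :=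
  cls_eq.2 (qObj_quotOf π h)

theorem exists_epi {G F : C} (a : Quotients G) (h : cls (qObj a) = cls F) :
    ∃ (π : G ⟶ F) (hp : Epi π), quotOf π hp = a := by
  obtain ⟨e⟩ := cls_eq.1 h
  haveI := qMap_epi a
  exact ⟨qMap a ≫ e.hom, inferInstance, by rw [quotOf_comp_iso (qMap_epi a), quotOf_qMap]⟩

theorem quotOf_eq_top {G F : C} {π : G ⟶ F} {h : Epi π} : quotOf π h = ⊤ ↔ IsIso π := by
  haveI := h
  unfold quotOf
  rw [← Subobject.isIso_iff_mk_eq_top, isIso_op_iff]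

/-- post-composition with an epimorphism -/
noncomputable def pullQ {G F : C} (π : G ⟶ F) (h : Epi π) (b : Quotients F) : Quotients G :=
  quotOf (π ≫ qMap b) (epiComp h (qMap_epi b))

theorem pullQ_quotOf {G F E : C} (π : G ⟶ F) (h : Epi π) (k : F ⟶ E) (hk : Epi k) :
    pullQ π h (quotOf k hk) = quotOf (π ≫ k) (epiComp h hk) := by
  have h1 := quotOf_qMap (quotOf k hk)
  obtain ⟨k1, hk1⟩ := quotOf_le.1 h1.le
  obtain ⟨k2, hk2⟩ := quotOf_le.1 h1.ge
  refine le_antisymm (quotOf_le.2 ⟨k1, ?_⟩) (quotOf_le.2 ⟨k2, ?_⟩)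
  · rw [Category.assoc, hk1]
  · rw [Category.assoc, hk2]

theorem exists_fac {G F : C} {π : G ⟶ F} {h : Epi π} {z : Quotients G} (hz : z ≤ quotOf π h) :
    ∃ (k : F ⟶ qObj z), Epi k ∧ π ≫ k = qMap z := by
  rw [← quotOf_qMap z, quotOf_le] at hz
  obtain ⟨k, hk⟩ := hz
  haveI := qMap_epi z
  exact ⟨k, epi_of_epi_fac hk, hk⟩

/-- the other direction -/
noncomputable def pushQ {G F : C} (π : G ⟶ F) (z : Quotients G) : Quotients F :=
  if h : ∃ (k : F ⟶ qObj z), Epi k ∧ π ≫ k = qMap z then quotOf h.choose h.choose_spec.1 else ⊤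

theorem pushQ_spec {G F : C} {π : G ⟶ F} {h : Epi π} {z : Quotients G} (hz : z ≤ quotOf π h) :
    ∃ (k : F ⟶ qObj z) (hk : Epi k), π ≫ k = qMap z ∧ pushQ π z = quotOf k hk := by
  have := exists_fac hz
  refine ⟨this.choose, this.choose_spec.1, this.choose_spec.2, ?_⟩
  unfold pushQ
  rw [dif_pos this]

theorem pull_push {G F : C} {π : G ⟶ F} {h : Epi π} {z : Quotients G} (hz : z ≤ quotOf π h) :
    pullQ π h (pushQ π z) = z := by
  obtain ⟨k, hk, h1, h2⟩ := pushQ_spec hz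
  rw [h2, pullQ_quotOf]
  simp only [h1]
  exact quotOf_qMap z

theorem pullQ_le_iff {G F : C} {π : G ⟶ F} {h : Epi π} {b b' : Quotients F} :
    pullQ π h b ≤ pullQ π h b' ↔ b ≤ b' := by
  conv_rhs => rw [← quotOf_qMap b, ← quotOf_qMap b']
  unfold pullQ
  rw [quotOf_le, quotOf_le]
  refine exists_congr fun k => ?_
  rw [Category.assoc, cancel_epi]

theorem pullQ_le {G F : C} {π : G ⟶ F} {h : Epi π} (b : Quotients F) :
    pullQ π h b ≤ quotOf π h := quotOf_le.2 ⟨_, rfl⟩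

theorem push_pull {G F : C} {π : G ⟶ F} {h : Epi π} (b : Quotients F) :
    pushQ π (pullQ π h b) = b := by
  have := pull_push (pullQ_le (h := h) b)
  exact le_antisymm (pullQ_le_iff.1 this.le) (pullQ_le_iff.1 this.ge)

/-- lower set isomorphism -/
noncomputable def piQ [Fact (IsDiamond C)] {G F : C} (π : G ⟶ F) (h : Epi π) :
    PI (quotOf π h) (⊤ : Quotients F) where
  f := pushQ π
  g := pullQ π h
  fle := fun _ _ => le_top
  gle := fun z _ => pullQ_le z
  gf := fun z hz => pull_push hz
  fg := fun z _ => push_pull z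
  fmono := fun z z' hzz hz' => by
    rw [← pullQ_le_iff (h := h), pull_push hz', pull_push (hzz.trans hz')]; exact hzz
  gmono := fun z z' hzz _ => pullQ_le_iff.2 hzz

theorem cls_piQ [Fact (IsDiamond C)] {G F : C} (π : G ⟶ F) (h : Epi π) (z : Quotients G)
    (hz : z ≤ quotOf π h) : cls (qObj ((piQ π h).f z)) = cls (qObj z) := by
  obtain ⟨k, hk, h1, h2⟩ := pushQ_spec hz
  show cls (qObj (pushQ π z)) = _
  rw [h2, cls_quotOf]

theorem cls_top (G : C) : cls (qObj (⊤ : Quotients G)) = cls G := by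
  have : quotOf (𝟙 G) inferInstance = ⊤ := quotOf_eq_top.2 inferInstance
  rw [← this, cls_quotOf]

theorem pi_exists [Fact (IsDiamond C)] {G F : C} (a : Quotients G) (ha : cls (qObj a) = cls F) :
    ∃ e : PI a (⊤ : Quotients F), ∀ z, z ≤ a → cls (qObj (e.f z)) = cls (qObj z) := by
  obtain ⟨π, hp, rfl⟩ := exists_epi a ha
  exact ⟨piQ π hp, cls_piQ π hp⟩

/-- quotients of a representative -/
abbrev QQ (X : IsoCls C) := Quotients X.out

/-- the system of quotient lattices of a diamond category -/
noncomputable def sg [Fact (IsDiamond C)] : MSys (IsoCls C) (QQ (C := C)) where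
  cl := fun a => cls (qObj a)
  cl_top := fun X => (cls_top _).trans (cls_out X)
  pi := fun {X} a => pi_exists a (cls_out _).symm

end cat
end MomentAux

namespace MomentAux
open MomentCat

section cnt
universe v
variable {I : Type v} {Q : I → Type v} [∀ X, Lattice (Q X)] [∀ X, BoundedOrder (Q X)]
  [∀ X, Fintype (Q X)] [∀ X, IsModularLattice (Q X)]
variable {σ : MSys I Q}

theorem MSys.countable {S : Set I} (h : σ.Fm S) (hn : σ.Nar S)
    (hm : {X : I | (⊥ : Q X) = ⊤}.Countable) : S.Countable := by
  let A : ℕ → Set I := fun n => Nat.rec {X : I | (⊥ : Q X) = ⊤}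
    (fun _ T => ⋃ E ∈ (T ∩ S), {Y | Y ∈ S ∧ ∃ a : Q Y, a ⋖ ⊤ ∧ σ.cl a = E}) n
  have hA : ∀ n, (A n).Countable := by
    intro n
    induction n with
    | zero => exact hm
    | succ n ih =>
      exact (ih.mono Set.inter_subset_left).biUnion fun E hE => (hn E hE.2).countable
  have key : ∀ {X : I} (a : Q X), X ∈ S → ∃ n, σ.cl a ∈ A n := by
    intro X a hX
    induction a using WellFoundedLT.induction with
    | ind a ih =>
      by_cases ha : a = ⊥
      · subst ha
        exact ⟨0, σ.cl_bot_triv⟩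
      · obtain ⟨b, -, hb⟩ := exists_le_covBy_of_lt (bot_lt_iff_ne_bot.2 ha)
        obtain ⟨n, hn'⟩ := ih b hb.lt
        refine ⟨n + 1, ?_⟩
        obtain ⟨e, he⟩ := σ.pi a
        refine Set.mem_biUnion (x := σ.cl b) ⟨hn', h.dc b hX⟩ ⟨h.dc a hX, e.f b, ?_, he b hb.le⟩
        have := e.f_covBy le_rfl hb
        rwa [e.f_top] at this
  refine (Set.countable_iUnion hA).mono fun X hX => ?_
  obtain ⟨n, hn⟩ := key (⊤ : Q X) hX
  rw [σ.cl_top] at hn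
  exact Set.mem_iUnion.2 ⟨n, hn⟩

end cnt

section cat
variable {C : Type u} [SmallCategory C]

/-- epimorphisms are pairs of a quotient and an automorphism -/
theorem epis_equiv (G F : C) :
    ∃ e : ({a : Quotients G // cls (qObj a) = cls F} × Aut F) ≃ Epis G F,
      ∀ p, quotOf (e p).1 (e p).2 = p.1.1 := by
  choose ρ hρ hq using fun a : {a : Quotients G // cls (qObj a) = cls F} => exists_epi a.1 a.2
  have hepi : ∀ (a) (α : Aut F), Epi (ρ a ≫ α.hom) := fun a α =>
    epiComp (hρ a) (inferInstanceAs (Epi (Iso.hom (show F ≅ F from α))))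
  let f : ({a : Quotients G // cls (qObj a) = cls F} × Aut F) → Epis G F :=
    fun p => ⟨ρ p.1 ≫ p.2.hom, hepi _ _⟩
  have hf : ∀ p, quotOf (f p).1 (f p).2 = p.1.1 := fun p =>
    (quotOf_comp_iso (hρ p.1) p.2 _).trans (hq p.1)
  refine ⟨Equiv.ofBijective f ⟨?_, ?_⟩, hf⟩
  · rintro ⟨a, α⟩ ⟨b, β⟩ hab
    have h1 : a = b := Subtype.ext (by rw [← hf (a, α), ← hf (b, β), hab])
    subst h1
    have h2 : ρ a ≫ α.hom = ρ a ≫ β.hom := congrArg Subtype.val hab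
    haveI := hρ a
    rw [cancel_epi] at h2
    rw [Iso.ext h2]
  · rintro ⟨π, hπ⟩
    let a : {a : Quotients G // cls (qObj a) = cls F} := ⟨quotOf π hπ, cls_quotOf π hπ⟩
    obtain ⟨k, hk⟩ := (quotOf_le (h := hπ) (h' := hρ a)).1 (hq a).ge
    obtain ⟨k', hk'⟩ := (quotOf_le (h := hρ a) (h' := hπ)).1 (hq a).le
    haveI := hρ a
    refine ⟨(a, ⟨k, k', ?_, ?_⟩), Subtype.ext hk⟩
    · rw [← cancel_epi (ρ a), ← Category.assoc, hk, hk', Category.comp_id]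
    · rw [← cancel_epi π, ← Category.assoc, hk', hk, Category.comp_id]

variable [hC : Fact (IsDiamond C)]

theorem aut_pos (F : C) : (0 : ℝ) < (Nat.card (Aut F) : ℝ) := by
  haveI := hC.out.autFinite F
  exact_mod_cast Nat.card_pos

theorem epis_finite (G F : C) : Finite (Epis G F) := by
  obtain ⟨e, -⟩ := epis_equiv G F
  haveI := hC.out.autFinite F
  exact Finite.of_equiv _ e

theorem tsum_epis (G F : C) (φ : Quotients G → ℝ) :
    ∑' π : Epis G F, φ (quotOf π.1 π.2)
      = (Nat.card (Aut F) : ℝ) * ∑ a ∈ Finset.univ.filter (fun a : Quotients G => cls (qObj a) = cls F), φ a := by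
  obtain ⟨e, he⟩ := epis_equiv G F
  haveI := hC.out.autFinite F
  haveI := Fintype.ofFinite (Aut F)
  rw [← e.tsum_eq]
  simp only [he]
  rw [tsum_fintype, Fintype.sum_prod_type]
  simp only [Finset.sum_const, Finset.card_univ, nsmul_eq_mul]
  rw [← Finset.mul_sum, Nat.card_eq_fintype_card]
  congr 1
  refine (Finset.sum_subtype _ (fun a => ?_) φ).symm
  simp only [Finset.mem_filter, Finset.mem_univ, true_and]

theorem tsum_epis' (X : IsoCls C) (F : C) (φ : QQ X → ℝ) :
    ∑' π : Epis X.out F, φ (quotOf π.1 π.2)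
      = (Nat.card (Aut F) : ℝ) * ∑ a ∈ Finset.univ.filter (fun a : QQ X => sg.cl a = cls F), φ a := by
  rw [tsum_epis]
  congr!

theorem card_epis (X E : IsoCls C) (F : C) (hF : cls F = E) :
    Nat.card (Epis X.out F) = sg.s X E * Nat.card (Aut F) := by
  have h := tsum_epis X.out F (fun _ => 1)
  haveI := epis_finite X.out F
  haveI := Fintype.ofFinite (Epis X.out F)
  rw [tsum_fintype] at h
  simp only [Finset.sum_const, Finset.card_univ, nsmul_eq_mul, mul_one] at h
  rw [Nat.card_eq_fintype_card (α := Epis X.out F), mul_comm]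
  subst hF
  have h2 : Fintype.card (Epis X.out F) = Nat.card (Aut F) *
      (Finset.univ.filter (fun a : Quotients X.out => cls (qObj a) = cls F)).card := by exact_mod_cast h
  rw [h2]
  unfold MSys.s
  congr!

theorem mobR_of {mob : ∀ G : C, Quotients G → Quotients G → ℝ} (h : IsMobiusFamily mob) :
    MSys.MobR (Q := QQ (C := C)) (fun X => mob X.out) := by
  intro X x y hxy
  split_ifs with hh
  · subst hh
    have : (Finset.univ.filter (fun z : QQ X => x ≤ z ∧ z ≤ x)) = {x} := by
      ext z
      simp only [Finset.mem_filter, Finset.mem_univ, true_and, Finset.mem_singleton]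
      exact ⟨fun h => le_antisymm h.2 h.1, fun h => h ▸ ⟨le_rfl, le_rfl⟩⟩
    rw [this, Finset.sum_singleton]
    exact (h X.out).1 x
  · rw [← (h X.out).2 x y (lt_of_le_of_ne hxy hh), ← finsum_mem_coe_finset]
    congr 1
    ext z
    simp [Set.mem_Icc]

/-- isomorphism classes in a set of objects -/
def tS (S : Set C) : Set (IsoCls C) := {X | X.out ∈ S}

/-- objects with class in a set -/
def ob (T : Set (IsoCls C)) : Set C := {G | cls G ∈ T}

theorem tS_ob (T : Set (IsoCls C)) : tS (ob T) = T := by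
  ext X
  show cls X.out ∈ T ↔ _
  rw [cls_out]

theorem DownwardClosed.iso {S : Set C} (h : DownwardClosed S) {G F : C} (e : G ≅ F) (hG : G ∈ S) : F ∈ S :=
  h G hG F e.hom inferInstance

theorem ob_tS {S : Set C} (h : DownwardClosed S) : ob (tS S) = S := by
  ext G
  obtain ⟨e⟩ := out_iso G
  exact ⟨fun hh => DownwardClosed.iso h e hh, fun hh => DownwardClosed.iso h e.symm hh⟩

theorem fm_iff (T : Set (IsoCls C)) : sg.Fm T ↔ IsFormation (ob T) := by
  constructor
  · intro h
    have key : ∀ {G : C} (a : Quotients G) (b : Quotients G), cls (qObj a) ∈ T → cls (qObj b) ∈ T →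
        cls (qObj (a ⊔ b)) ∈ T := by
      intro G a b ha hb
      obtain ⟨e, he⟩ := pi_exists (F := (cls G).out) (⊤ : Quotients G) (by rw [cls_top, cls_out])
      rw [← he _ le_top, e.f_sup le_top le_top]
      refine h.jc (X := cls G) _ _ ?_ ?_
      · show cls (qObj _) ∈ T
        rw [he _ le_top]; exact ha
      · show cls (qObj _) ∈ T
        rw [he _ le_top]; exact hb
    refine ⟨?_, ?_, ?_⟩
    · intro G hG F π hπ
      obtain ⟨e⟩ := out_iso G
      have h1 : Epi (e.hom ≫ π) := inferInstance
      have := h.dc (X := cls G) (quotOf (e.hom ≫ π) h1) hG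
      have h2 : cls (qObj (quotOf (e.hom ≫ π) h1)) ∈ T := this
      rwa [cls_quotOf] at h2
    · intro G a b ha hb _
      exact key a b ha hb
    · intro G hG
      refine h.mc (X := cls G) ?_
      obtain ⟨e⟩ := out_iso G
      obtain ⟨e, he⟩ := pi_exists (F := (cls G).out) (⊤ : Quotients G) (by rw [cls_top, cls_out])
      refine e.f_bot.symm.trans ((congrArg e.f ?_).trans e.f_top)
      exact hG.elim _ _
  · intro ⟨h1, h2, h3⟩
    refine ⟨fun {X} a hX => ?_, fun {X} a b ha hb => ?_, fun {X} hX => ?_⟩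
    · refine h1 X.out ?_ _ (qMap a) (qMap_epi a)
      show cls X.out ∈ T
      rwa [cls_out]
    · exact h2 X.out a b ha hb (hC.out.lub _ _ _)
    · rw [← cls_out X]
      exact h3 X.out (subsingleton_of_bot_eq_top hX)

theorem simple_iff (X : IsoCls C) (G : C) (a : QQ X) (ha : a ⋖ ⊤) (hG : sg.cl a = cls G) :
    ∃ π : X.out ⟶ G, IsSimpleEpi π := by
  obtain ⟨π, hp, rfl⟩ := exists_epi a hG
  refine ⟨π, hp, fun hi => ha.lt.ne (quotOf_eq_top.2 hi), fun Y hY => ?_⟩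
  rcases eq_or_lt_of_le hY with h | h
  · exact Or.inl h.symm
  · right
    by_contra hn
    exact ha.2 h (lt_top_iff_ne_top.2 hn)

theorem nar_of {T : Set (IsoCls C)} (h : Narrow (ob T)) : sg.Nar T := by
  intro A hA
  refine (h A.out (by show cls A.out ∈ T; rwa [cls_out])).subset ?_
  rintro Y ⟨hY, a, ha, hcl⟩
  refine ⟨by show cls Y.out ∈ T; rwa [cls_out], ?_⟩
  exact simple_iff Y A.out a ha (by rw [hcl, cls_out])

theorem wQuot_eq {T : Set (IsoCls C)} (X : IsoCls C) : wQuot (ob T) X.out = sg.tr T X := by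
  have hl : IsLUB {a : Quotients X.out | qObj a ∈ ob T} (sg.tr T X) := by
    constructor
    · intro a ha
      exact MSys.le_tr (σ := sg) ha
    · intro b hb
      refine Finset.sup_le fun z hz => hb ?_
      exact (Finset.mem_filter.1 hz).2
  have hex : ∃ c, IsLUB {a : Quotients X.out | qObj a ∈ ob T} c := ⟨_, hl⟩
  unfold wQuot qsSup
  rw [dif_pos hex]
  exact hex.choose_spec.unique hl

theorem levelGen_formation (B : Set C) : IsFormation (levelGen B) := by
  refine ⟨?_, ?_, ?_⟩
  · intro G hG F π h S hS
    exact hS.1.1 G (hG S hS) F π h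
  · intro G a b ha hb hc S hS
    exact hS.1.2.1 G a b (ha S hS) (hb S hS) hc
  · intro G hG S hS
    exact hS.1.2.2 G hG

theorem subset_levelGen (B : Set C) : B ⊆ levelGen B := fun _ hG _ hS => hS.2 hG

theorem levelGen_subset {B S : Set C} (h : IsFormation S) (hB : B ⊆ S) : levelGen B ⊆ S :=
  fun _ hG => hG S ⟨h, hB⟩

theorem IsLevel.formation {S : Set C} (h : IsLevel S) : IsFormation S := by
  obtain ⟨B, -, rfl⟩ := h
  exact levelGen_formation B

theorem levelGen_iso {G F : C} (h : cls G = cls F) : levelGen {G} = levelGen {F} := by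
  have key : ∀ {G F : C}, cls G = cls F → levelGen {G} ⊆ levelGen {F} := by
    intro G F h
    obtain ⟨e⟩ := cls_eq.1 h
    refine levelGen_subset (levelGen_formation _) ?_
    rintro _ rfl
    exact DownwardClosed.iso (levelGen_formation _).1 e.symm (subset_levelGen _ rfl)
  exact Set.Subset.antisymm (key h) (key h.symm)

end cat
end MomentAux

namespace MomentAux
open MomentCat

section fin
variable {C : Type u} [SmallCategory C] [hC : Fact (IsDiamond C)]

/-- normalised moments -/
noncomputable def wt (M : IsoCls C → ℝ) (X : IsoCls C) : ℝ := M X / (Nat.card (Aut X.out) : ℝ)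

theorem vWF_eq (mob : ∀ G : C, Quotients G → Quotients G → ℝ) (M : IsoCls C → ℝ) (S : Set C) (F : C) :
    vWF mob M S F = sg.vv (fun X => mob X.out) (wt M) (tS S) (cls F) := by
  unfold vWF MSys.vv
  refine tsum_congr fun X => ?_
  unfold muHat muEpi wt
  rw [tsum_epis' X.1 F (fun a => mob X.1.out a ⊤), mul_div_cancel_left₀ _ (aut_pos F).ne', mul_div_assoc]
  congr!

theorem wb_of {mob : ∀ G : C, Quotients G → Quotients G → ℝ} {M : IsoCls C → ℝ} {S : Set C}
    (hS : DownwardClosed S) (h : WellBehavedAt mob M S) :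
    sg.WB (fun X => mob X.out) (wt M) (tS S) := by
  intro E hE
  have h1 := (h E.out hE).sigma
  have h2 := h1.mul_left (Nat.card (Aut E.out) : ℝ)⁻¹
  refine h2.congr fun X => ?_
  have h3 := tsum_epis' X.1 E.out (fun a => |mob X.1.out a ⊤| / (Nat.card (Aut X.1.out) : ℝ)
      * ((Znum a : ℝ)) ^ 3 * |M X.1|)
  have h4 : ∀ π : Epis X.1.out E.out, Znum (quotOf π.1 π.2) = Zfn π.1 π.2 := fun π => rfl
  simp only [h4] at h3
  rw [h3, inv_mul_cancel_left₀ (aut_pos E.out).ne', Finset.sum_mul, cls_out]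
  refine Finset.sum_congr (by congr!) fun a _ => ?_
  unfold wt
  rw [abs_div, abs_of_pos (aut_pos X.1.out)]
  ring

/-- levels, as sets of isomorphism classes -/
def LL (C : Type u) [SmallCategory C] : Set (Set (IsoCls C)) := {T | IsLevel (ob T)}

/-- component -/
def cc (T : LL C) (ω : ProIso C) : IsoCls C := ω.comp (ob T.1) T.2

theorem tS_mem {S : Set C} (hS : IsLevel S) : tS S ∈ LL C := by
  show IsLevel (ob (tS S))
  rwa [ob_tS (IsLevel.formation hS).1]

theorem comp_congr (ω : ProIso C) {S S' : Set C} (h : S = S') (hS : IsLevel S) (hS' : IsLevel S') :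
    ω.comp S hS = ω.comp S' hS' := by
  subst h; rfl

theorem cc_tS {S : Set C} (hS : IsLevel S) (ω : ProIso C) : cc ⟨tS S, tS_mem hS⟩ ω = ω.comp S hS :=
  comp_congr ω (ob_tS (IsLevel.formation hS).1) _ _

theorem ob_mono {T T' : Set (IsoCls C)} : ob T ⊆ ob T' ↔ T ⊆ T' := by
  refine ⟨fun h X hX => ?_, fun h G hG => h hG⟩
  have := @h X.out (by show cls X.out ∈ T; rwa [cls_out])
  have h2 : cls X.out ∈ T' := this
  rwa [cls_out] at h2

theorem lev : sg.Lev (LL C) (ProIso C) cc where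
  fm := fun S => (fm_iff _).2 (IsLevel.formation S.2)
  nar := fun S => nar_of (hC.out.levelNarrow _ S.2)
  loewy := fun S => by
    obtain ⟨B, hB, hS⟩ := S.2
    choose k hk using fun G : C => MSys.exists_W (σ := sg (C := C)) (cls G)
    obtain ⟨K, hK⟩ := (hB.image k).bddAbove
    refine ⟨K, ob_mono.1 ?_⟩
    rw [hS]
    refine levelGen_subset ((fm_iff _).1 (MSys.W_fm K)) fun G hG => ?_
    exact MSys.W_mono (hK (Set.mem_image_of_mem k hG)) (hk G)
  cnt := fun S => by
    refine MSys.countable ((fm_iff _).2 (IsLevel.formation S.2)) (nar_of (hC.out.levelNarrow _ S.2)) ?_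
    refine hC.out.minCountable.mono fun X hX => ?_
    exact subsingleton_of_bot_eq_top hX
  dir := fun S S' => by
    obtain ⟨B, hB, hS⟩ := S.2
    obtain ⟨B', hB', hS'⟩ := S'.2
    have hl : IsLevel (levelGen (B ∪ B')) := ⟨B ∪ B', hB.union hB', rfl⟩
    have hf := levelGen_formation (B ∪ B')
    refine ⟨⟨tS _, tS_mem hl⟩, ob_mono.1 ?_, ob_mono.1 ?_⟩
    · rw [hS]
      show _ ⊆ ob (tS _)
      rw [ob_tS hf.1]
      exact levelGen_subset hf (Set.subset_union_left.trans (subset_levelGen _))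
    · rw [hS']
      show _ ⊆ ob (tS _)
      rw [ob_tS hf.1]
      exact levelGen_subset hf (Set.subset_union_right.trans (subset_levelGen _))
  ne := ⟨⟨tS (levelGen ∅), tS_mem ⟨∅, Set.finite_empty, rfl⟩⟩⟩
  mem := fun S ω => by
    have : cls (cc S ω).out ∈ S.1 := ω.mem _ S.2
    rwa [cls_out] at this
  compat := fun S S' ω h => by
    have := ω.compat _ _ S.2 S'.2 (ob_mono.2 h)
    rw [← cls_eq, cls_out, wQuot_eq] at this
    exact this
  real := fun x hx hc => by
    have hob : ∀ {S : Set C} (hS : IsLevel S), ob (tS S) = S := fun hS => ob_tS (IsLevel.formation hS).1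
    refine ⟨⟨fun S hS => x ⟨tS S, tS_mem hS⟩, fun S hS => hx ⟨tS S, tS_mem hS⟩, fun S S' hS hS' h => ?_⟩, ?_⟩
    · rw [← cls_eq, cls_out, ← hc ⟨tS S, tS_mem hS⟩ ⟨tS S', tS_mem hS'⟩ (fun X hX => h hX)]
      conv_lhs => rw [← hob hS]
      rw [wQuot_eq]
      rfl
    · intro S
      show x ⟨tS (ob S.1), _⟩ = x S
      congr 1
      exact Subtype.ext (tS_ob S.1)

theorem USet_eq {S : Set C} (hS : IsLevel S) (F : C) :
    USet S hS F = {ω | cc ⟨tS S, tS_mem hS⟩ ω = cls F} := by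
  ext ω
  show Nonempty _ ↔ cc _ ω = _
  rw [← cls_eq, cls_out, cc_tS hS]

/-- level generated by a class -/
def lvl (E : IsoCls C) : LL C := ⟨tS (levelGen {E.out}), tS_mem ⟨{E.out}, Set.finite_singleton _, rfl⟩⟩

theorem surCount_eq (ω : ProIso C) (G : C) :
    surCount ω G = sg.s (cc (lvl (cls G)) ω) (cls G) * Nat.card (Aut G) := by
  have h1 : IsLevel (levelGen {G}) := ⟨{G}, Set.finite_singleton _, rfl⟩
  have h2 : IsLevel (levelGen {(cls G).out}) := ⟨{(cls G).out}, Set.finite_singleton _, rfl⟩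
  have h3 : cc (lvl (cls G)) ω = ω.comp _ h1 :=
    (cc_tS h2 ω).trans (comp_congr ω (levelGen_iso (cls_out (cls G))) h2 h1)
  rw [h3, ← card_epis _ (cls G) G rfl]
  rfl

theorem aut_congr {G F : C} (h : cls G = cls F) : Nat.card (Aut G) = Nat.card (Aut F) := by
  obtain ⟨e⟩ := cls_eq.1 h
  exact Nat.card_congr (Aut.autMulEquivOfIso e).toEquiv

theorem hasMoment_iff (ν : Measure (ProIso C)) (M : IsoCls C → ℝ) :
    (∀ G : C, HasMoment ν G (M (cls G))) ↔
      ∀ E, 0 ≤ wt M E ∧ ∫⁻ ω, (sg.s (cc (lvl E) ω) E : ℝ≥0∞) ∂ν = ENNReal.ofReal (wt M E) := by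
  have key : ∀ G : C, HasMoment ν G (M (cls G)) ↔
      0 ≤ wt M (cls G) ∧ ∫⁻ ω, (sg.s (cc (lvl (cls G)) ω) (cls G) : ℝ≥0∞) ∂ν = ENNReal.ofReal (wt M (cls G)) := by
    intro G
    have hp := aut_pos G
    unfold HasMoment
    have h1 : ∫⁻ ω, (surCount ω G : ℝ≥0∞) ∂ν =
        (∫⁻ ω, (sg.s (cc (lvl (cls G)) ω) (cls G) : ℝ≥0∞) ∂ν) * (Nat.card (Aut G) : ℝ≥0∞) := by
      rw [← lintegral_mul_const' _ _ (ENNReal.natCast_ne_top _)]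
      refine lintegral_congr fun ω => ?_
      rw [surCount_eq]
      push_cast
      rfl
    rw [h1]
    unfold wt
    rw [aut_congr (cls_out (cls G))]
    generalize (∫⁻ ω, (sg.s (cc (lvl (cls G)) ω) (cls G) : ℝ≥0∞) ∂ν) = I
    generalize hn : Nat.card (Aut G) = n at *
    have hn0 : (n : ℝ≥0∞) ≠ 0 := by
      intro h
      rw [Nat.cast_eq_zero] at h
      subst h
      simp at hp
    constructor
    · rintro ⟨ha, hb⟩
      have hI : I ≠ ⊤ := by
        rintro rfl
        exact ha (ENNReal.top_mul hn0)
      rw [ENNReal.toReal_mul, ENNReal.toReal_natCast] at hb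
      have : M (cls G) / (n : ℝ) = I.toReal := by rw [← hb]; field_simp
      rw [this]
      exact ⟨ENNReal.toReal_nonneg, (ENNReal.ofReal_toReal hI).symm⟩
    · rintro ⟨ha, hb⟩
      rw [hb]
      refine ⟨ENNReal.mul_ne_top ENNReal.ofReal_ne_top (ENNReal.natCast_ne_top _), ?_⟩
      rw [ENNReal.toReal_mul, ENNReal.toReal_natCast, ENNReal.toReal_ofReal ha]
      field_simp
  constructor
  · intro h E
    have := (key E.out).1 (h E.out)
    rwa [cls_out] at this
  · intro h G
    exact (key G).2 (h (cls G))

theorem hgen : (inferInstance : MeasurableSpace (ProIso C)) =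
    MeasurableSpace.generateFrom {U | ∃ S : LL C, ∃ F ∈ S.1, U = {ω | cc S ω = F}} := by
  show MeasurableSpace.generateFrom _ = _
  congr 1
  ext U
  constructor
  · rintro ⟨S, hS, F, hF, rfl⟩
    refine ⟨⟨tS S, tS_mem hS⟩, cls F, ?_, USet_eq hS F⟩
    show F ∈ ob (tS S)
    rwa [ob_tS (IsLevel.formation hS).1]
  · rintro ⟨S, E, hE, rfl⟩
    refine ⟨ob S.1, S.2, E.out, ?_, ?_⟩
    · show cls E.out ∈ S.1
      rwa [cls_out]
    · refine Eq.trans ?_ (USet_eq (show IsLevel (ob S.1) from S.2) E.out).symm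
      rw [cls_out]
      have : (⟨tS (ob S.1), tS_mem S.2⟩ : LL C) = S := Subtype.ext (tS_ob S.1)
      rw [show (⟨tS (ob S.1), _⟩ : LL C) = S from this]

theorem final (mob : ∀ G : C, Quotients G → Quotients G → ℝ) (hmob : IsMobiusFamily mob)
    (M : IsoCls C → ℝ)
    (hwb : ∀ S : Set C, IsLevel S → WellBehavedAt mob M S) :
    ((∃ ν : MeasureTheory.Measure (ProIso C), ∀ G : C, HasMoment ν G (M (cls G))) ↔
      (∀ (S : Set C), IsLevel S → ∀ F ∈ S, 0 ≤ vWF mob M S F)) ∧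
    (∀ ν : MeasureTheory.Measure (ProIso C), (∀ G : C, HasMoment ν G (M (cls G))) →
      (∀ ν' : MeasureTheory.Measure (ProIso C),
        (∀ G : C, HasMoment ν' G (M (cls G))) → ν = ν') ∧
      (∀ (S : Set C) (hS : IsLevel S), ∀ F ∈ S,
        ν (USet S hS F) = ENNReal.ofReal (vWF mob M S F))) := by
  have hmain := lev.main (w := wt M) hgen (mobR_of hmob)
    (fun S => by
      have := wb_of (IsLevel.formation S.2).1 (hwb _ S.2)
      rwa [tS_ob] at this)
    lvl (fun E => subset_levelGen _ rfl)
    (fun E S hE => ob_mono.1 (by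
      show ob (tS _) ⊆ _
      rw [ob_tS (levelGen_formation _).1]
      refine levelGen_subset (IsLevel.formation S.2) ?_
      rintro _ rfl
      show cls E.out ∈ S.1
      rwa [cls_out]))
    (fun ν => ∀ G : C, HasMoment ν G (M (cls G))) (fun ν => hasMoment_iff ν M)
  have hcls : ∀ {S : Set C} (hS : IsLevel S) {F : C}, F ∈ S → cls F ∈ tS S := by
    intro S hS F hF
    show F ∈ ob (tS S)
    rwa [ob_tS (IsLevel.formation hS).1]
  obtain ⟨h1, h2⟩ := hmain
  refine ⟨h1.trans ⟨fun h S hS F hF => ?_, fun h S E hE => ?_⟩, fun ν hν => ⟨(h2 ν hν).1, fun S hS F hF => ?_⟩⟩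
  · rw [vWF_eq]
    exact h ⟨tS S, tS_mem hS⟩ (cls F) (hcls hS hF)
  · have := h (ob S.1) S.2 E.out (by show cls E.out ∈ S.1; rwa [cls_out])
    rwa [vWF_eq, tS_ob, cls_out] at this
  · rw [vWF_eq, USet_eq]
    exact (h2 ν hν).2 ⟨tS S, tS_mem hS⟩ (cls F) (hcls hS hF)

end fin
end MomentAux

open MomentCat in
/-- Theorem 1.8, Existence and Uniqueness: for well-behaved
moments `(M_G)`, a measure on the pro-isomorphism classes with `G`-moment `M_G`
for every `G` exists iff `v_{𝒞,F} ≥ 0` for every level `𝒞` and `F ∈ 𝒞`; and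
such a measure is unique, with `ν(U_{𝒞,F}) = v_{𝒞,F}`. -/
theorem statement11 {C : Type u} [SmallCategory C] (hC : IsDiamond C)
    (mob : ∀ G : C, Quotients G → Quotients G → ℝ) (hmob : IsMobiusFamily mob)
    (M : IsoCls C → ℝ)
    (hwb : ∀ S : Set C, IsLevel S → WellBehavedAt mob M S) :
    ((∃ ν : MeasureTheory.Measure (ProIso C), ∀ G : C, HasMoment ν G (M (cls G))) ↔
      (∀ (S : Set C), IsLevel S → ∀ F ∈ S, 0 ≤ vWF mob M S F)) ∧
    (∀ ν : MeasureTheory.Measure (ProIso C), (∀ G : C, HasMoment ν G (M (cls G))) →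
      (∀ ν' : MeasureTheory.Measure (ProIso C),
        (∀ G : C, HasMoment ν' G (M (cls G))) → ν = ν') ∧
      (∀ (S : Set C) (hS : IsLevel S), ∀ F ∈ S,
        ν (USet S hS F) = ENNReal.ofReal (vWF mob M S F))) := by
  haveI : Fact (IsDiamond C) := ⟨hC⟩
  exact MomentAux.final mob hmob M hwb
end

section
/- Let L be a finite complemented modular lattice and let d be the height of its top element ⊤ (the common length of all maximal chains from ⊥ to ⊤). Then for every k with 0 ≤ k ≤ d, the number of elements of L of height k is at least the binomial coefficient C(d,k). -/
/-- `x` has height `k`: there is a maximal chain (chain of covers) of length `k`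
from `⊥` to `x`.  In a finite modular lattice all maximal chains between two
elements have the same length, so this determines the height. -/
def ChainHeight {L : Type*} [Lattice L] [OrderBot L] (x : L) (k : ℕ) : Prop :=
  ∃ c : Fin (k + 1) → L, c 0 = ⊥ ∧ c (Fin.last k) = x ∧
    ∀ i : Fin k, c i.castSucc ⋖ c i.succ

theorem chainHeight_succ {L : Type*} [Lattice L] [OrderBot L] {x y : L} {k : ℕ}
    (hx : ChainHeight x k) (h : x ⋖ y) : ChainHeight y (k + 1) := by
  obtain ⟨c, h0, hl, hc⟩ := hx
  refine ⟨Fin.snoc (α := fun _ => L) c y, ?_, ?_, ?_⟩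
  · have : (0 : Fin (k + 1 + 1)) = Fin.castSucc 0 := rfl
    rw [this, Fin.snoc_castSucc, h0]
  · rw [Fin.snoc_last]
  · intro i
    rw [Fin.snoc_castSucc]
    induction i using Fin.lastCases with
    | last => rw [Fin.succ_last, Fin.snoc_last, hl]; exact h
    | cast i => rw [Fin.succ_castSucc, Fin.snoc_castSucc]; exact hc i

theorem chainHeight_pred {L : Type*} [Lattice L] [OrderBot L] {y : L} {k : ℕ}
    (hy : ChainHeight y (k + 1)) : ∃ x, ChainHeight x k ∧ x ⋖ y := by
  obtain ⟨c, h0, hl, hc⟩ := hy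
  refine ⟨c (Fin.last k).castSucc, ⟨fun i => c i.castSucc, by simpa using h0, rfl, ?_⟩, ?_⟩
  · intro i
    have := hc i.castSucc
    rwa [Fin.succ_castSucc] at this
  · have := hc (Fin.last k)
    rwa [Fin.succ_last, hl] at this

theorem choose_le_below {L : Type*} [Lattice L] [BoundedOrder L] [Fintype L]
    [IsModularLattice L] [ComplementedLattice L] (d : ℕ) :
    ∀ (x : L), ChainHeight x d → ∀ k : ℕ,
      d.choose k ≤ {y : L | y ≤ x ∧ ChainHeight y k}.ncard := by
  have hzero : ∀ x : L, 1 ≤ {y : L | y ≤ x ∧ ChainHeight y 0}.ncard := by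
    intro x
    refine Nat.succ_le_of_lt ((Set.ncard_pos (Set.toFinite _)).2 ?_)
    exact ⟨⊥, bot_le, fun _ => ⊥, rfl, rfl, fun i => i.elim0⟩
  induction d with
  | zero =>
    intro x _ k
    cases k with
    | zero => simpa using hzero x
    | succ k => simp
  | succ d ih =>
    intro x hx k
    cases k with
    | zero => simpa using hzero x
    | succ k =>
      obtain ⟨z, hz, hzx⟩ := chainHeight_pred hx
      obtain ⟨b, hb⟩ := exists_isCompl z
      obtain ⟨a, ha1, ha2⟩ : ∃ a, z ⊓ a = ⊥ ∧ z ⊔ a = x := by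
        refine ⟨b ⊓ x, ?_, ?_⟩
        · rw [← inf_assoc, hb.inf_eq_bot, bot_inf_eq]
        · rw [← sup_inf_assoc_of_le b hzx.le, hb.sup_eq_top, top_inf_eq]
      have hatom : ⊥ ⋖ a := by
        rw [← ha1]
        apply inf_covBy_of_covBy_sup_left
        rwa [ha2]
      have hax : a ≤ x := ha2 ▸ le_sup_right
      have hcov : ∀ y, y ≤ z → y ⋖ y ⊔ a := by
        intro y hy
        apply covBy_sup_of_inf_covBy_right
        have : y ⊓ a = ⊥ := le_bot_iff.1 (ha1 ▸ inf_le_inf_right a hy)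
        rwa [this]
      have hinf : ∀ y, y ≤ z → (y ⊔ a) ⊓ z = y := by
        intro y hy
        rw [sup_inf_assoc_of_le a hy, inf_comm, ha1, sup_bot_eq]
      set A := {y : L | y ≤ z ∧ ChainHeight y k}
      set B := {y : L | y ≤ z ∧ ChainHeight y (k + 1)}
      have hinj : Set.InjOn (fun y => y ⊔ a) A := by
        intro y hy w hw h
        have h' : y ⊔ a = w ⊔ a := h
        rw [← hinf y hy.1, h', hinf w hw.1]
      have hdisj : Disjoint ((fun y => y ⊔ a) '' A) B := by
        rw [Set.disjoint_left]
        rintro _ ⟨y, hy, rfl⟩ hB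
        have : a ≤ z := le_trans le_sup_right hB.1
        rw [inf_eq_right.2 this] at ha1
        exact hatom.ne ha1.symm
      calc (d + 1).choose (k + 1) = d.choose k + d.choose (k + 1) := Nat.choose_succ_succ _ _
        _ ≤ A.ncard + B.ncard := add_le_add (ih z hz k) (ih z hz (k + 1))
        _ = ((fun y => y ⊔ a) '' A ∪ B).ncard := by
          rw [Set.ncard_union_eq hdisj (Set.toFinite _) (Set.toFinite _),
            Set.InjOn.ncard_image hinj]
        _ ≤ _ := by
          apply Set.ncard_le_ncard _ (Set.toFinite _)
          rintro w (⟨y, hy, rfl⟩ | hw)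
          · exact ⟨sup_le (hy.1.trans hzx.le) hax, chainHeight_succ hy.2 (hcov y hy.1)⟩
          · exact ⟨hw.1.trans hzx.le, hw.2⟩

/-- Lemma 4.13: in a finite complemented modular lattice whose
top element has height `d`, the number of elements of height `k` is at least
`C(d,k)` for every `0 ≤ k ≤ d`. -/
theorem statement12 {L : Type*} [Lattice L] [BoundedOrder L] [Fintype L]
    [IsModularLattice L] [ComplementedLattice L]
    (d : ℕ) (hd : ChainHeight (⊤ : L) d) :
    ∀ k : ℕ, k ≤ d → (d.choose k : ℕ) ≤ Nat.card {x : L // ChainHeight x k} := by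
  intro k _
  have h := choose_le_below d (⊤ : L) hd k
  simp only [le_top, true_and] at h
  exact h
end
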